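/- There is a constant C > 0, independent of T and of the solution, with the following property. Let (ψ, v, p) be smooth functions on [0,T]×ℝ³ solving the system (S), Schwartz in the space variable for each t, with ‖∇ψ‖_{L^∞_T(H²)}, ‖∇_h∇ψ‖_{L²_T(H¹)}, ‖v‖_{L^∞_T(H²)}, ‖∇v‖_{L²_T(H²)} all finite. Then B_T² ≤ C( ‖v(0,·)‖²_{H²} + ‖∇ψ(0,·)‖²_{H²} ) + C B_T³ (1 + B_T)². -/

import Mathlib

open MeasureTheory Real Set Filter
open scoped ENNReal NNReal

noncomputable section

/-- Spatial points of `ℝ³`. -/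
abbrev Pt : Type := Fin 3 → ℝ

/-- Partial derivative in the `i`-th coordinate direction. -/
def pd (i : Fin 3) (f : Pt → ℝ) : Pt → ℝ := fun x => fderiv ℝ f x (Pi.single i 1)

/-- Iterated partial derivative `∂^α` for a multi-index `α`. -/
def pdM (α : Fin 3 → ℕ) (f : Pt → ℝ) : Pt → ℝ :=
  (pd 0)^[α 0] ((pd 1)^[α 1] ((pd 2)^[α 2] f))

/-- Multi-indices of total degree at most `k`. -/
def midx (k : ℕ) : Finset (Fin 3 → ℕ) :=
  (Fintype.piFinset fun _ => Finset.range (k + 1)).filter fun α => ∑ i, α i ≤ k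

/-- The `H^k` inner product `(f|g)_{H^k} = ∑_{|α| ≤ k} ∫ ∂^α f ∂^α g`. -/
def hInner (k : ℕ) (f g : Pt → ℝ) : ℝ := ∑ α ∈ midx k, ∫ x : Pt, pdM α f x * pdM α g x

/-- The squared `H^k` norm. -/
def hSq (k : ℕ) (f : Pt → ℝ) : ℝ := hInner k f f

/-- The squared `L²` norm. -/
def l2Sq (f : Pt → ℝ) : ℝ := ∫ x : Pt, (f x) ^ 2

/-- The Laplacian. -/
def lapl (f : Pt → ℝ) : Pt → ℝ := fun x => ∑ i, pd i (pd i f) x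

/-- Horizontal directions. -/
def hIdx : Finset (Fin 3) := {0, 1}

/-- `L^∞` norm in time over `[0,T]` of a (nonnegative) function of time. -/
def supT (T : ℝ) (g : ℝ → ℝ) : ℝ := sSup (g '' Icc 0 T)

/-- `L²` norm in time over `[0,T]`. -/
def l2T (T : ℝ) (g : ℝ → ℝ) : ℝ := Real.sqrt (∫ t in (0:ℝ)..T, (g t) ^ 2)

/-- `L⁴` norm in time over `[0,T]`. -/
def l4T (T : ℝ) (g : ℝ → ℝ) : ℝ := (∫ t in (0:ℝ)..T, (g t) ^ 4) ^ ((1:ℝ)/4)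

/-- A function is Schwartz: smooth with all derivatives rapidly decaying. -/
def IsSchwartz (f : Pt → ℝ) : Prop :=
  ContDiff ℝ (⊤ : ℕ∞) f ∧ ∀ k n : ℕ, ∃ C : ℝ, ∀ x, ‖x‖ ^ k * ‖iteratedFDeriv ℝ n f x‖ ≤ C

/-- Smoothness of `f` jointly in `(t,x)` on `s ×ˢ ℝ³`. -/
def SmoothOn2 (s : Set ℝ) (f : ℝ → Pt → ℝ) : Prop :=
  ContDiffOn ℝ (⊤ : ℕ∞) (fun q : ℝ × Pt => f q.1 q.2) (s ×ˢ (univ : Set Pt))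

/-- `‖∇f‖_{H^k}²`. -/
def gradHSq (k : ℕ) (f : Pt → ℝ) : ℝ := ∑ i, hSq k (pd i f)

/-- `‖∇_h∇f‖_{H^k}²`. -/
def gradHHSq (k : ℕ) (f : Pt → ℝ) : ℝ := ∑ i ∈ hIdx, ∑ j, hSq k (pd i (pd j f))

/-- `‖v‖_{H^k}²` for a vector field. -/
def vecHSq (k : ℕ) (v : Fin 3 → Pt → ℝ) : ℝ := ∑ j, hSq k (v j)

/-- `‖∇v‖_{H^k}²` for a vector field. -/
def gradVecHSq (k : ℕ) (v : Fin 3 → Pt → ℝ) : ℝ := ∑ j, gradHSq k (v j)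

/-- `B_T²`. -/
def BTsq (T : ℝ) (ψ : ℝ → Pt → ℝ) (v : Fin 3 → ℝ → Pt → ℝ) : ℝ :=
  (supT T fun t => Real.sqrt (vecHSq 2 fun j => v j t)) ^ 2
  + (supT T fun t => Real.sqrt (gradHSq 2 (ψ t))) ^ 2
  + (l2T T fun t => Real.sqrt (gradVecHSq 2 fun j => v j t)) ^ 2
  + (l2T T fun t => Real.sqrt (gradHHSq 1 (ψ t))) ^ 2

/-- `B_T`. -/
def BT (T : ℝ) (ψ : ℝ → Pt → ℝ) (v : Fin 3 → ℝ → Pt → ℝ) : ℝ := Real.sqrt (BTsq T ψ v)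

/-- The transport equation `∂_tψ + v·∇ψ + v₃ = 0` on `s × ℝ³`. -/
def TransportEq (s : Set ℝ) (ψ : ℝ → Pt → ℝ) (v : Fin 3 → ℝ → Pt → ℝ) : Prop :=
  ∀ t ∈ s, ∀ x, deriv (fun τ => ψ τ x) t + (∑ i, v i t x * pd i (ψ t) x) + v 2 t x = 0

/-- Divergence-free condition on `s × ℝ³`. -/
def DivFree (s : Set ℝ) (v : Fin 3 → ℝ → Pt → ℝ) : Prop :=
  ∀ t ∈ s, ∀ x, (∑ i, pd i (fun y => v i t y) x) = 0

/-- The momentum equations of system (S) on `s × ℝ³`. -/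
def MomentumEq (s : Set ℝ) (ψ : ℝ → Pt → ℝ) (v : Fin 3 → ℝ → Pt → ℝ)
    (p : ℝ → Pt → ℝ) : Prop :=
  ∀ j : Fin 3, ∀ t ∈ s, ∀ x,
    deriv (fun τ => v j τ x) t + (∑ i, v i t x * pd i (v j t) x) - lapl (v j t) x
      + pd j (p t) x + pd j (pd 2 (ψ t)) x + (if j = 2 then lapl (ψ t) x else 0)
    = - ∑ i, pd i (fun y => pd j (ψ t) y * pd i (ψ t) y) x

/-- The full system (S) on `s × ℝ³`. -/
def SolvesS (s : Set ℝ) (ψ : ℝ → Pt → ℝ) (v : Fin 3 → ℝ → Pt → ℝ)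
    (p : ℝ → Pt → ℝ) : Prop :=
  TransportEq s ψ v ∧ MomentumEq s ψ v p ∧ DivFree s v

/-- Finiteness of the four norms entering `B_T`. -/
def FiniteClass (T : ℝ) (ψ : ℝ → Pt → ℝ) (v : Fin 3 → ℝ → Pt → ℝ) : Prop :=
  BddAbove ((fun t => Real.sqrt (vecHSq 2 fun j => v j t)) '' Icc 0 T) ∧
  BddAbove ((fun t => Real.sqrt (gradHSq 2 (ψ t))) '' Icc 0 T) ∧
  IntervalIntegrable (fun t => gradVecHSq 2 fun j => v j t) volume 0 T ∧
  IntervalIntegrable (fun t => gradHHSq 1 (ψ t)) volume 0 T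

/-! ### The algebra of smooth functions of temperate growth -/

/-- Smooth real functions on `ℝ³` of temperate growth, as a subalgebra. -/
def tempAlg : Subalgebra ℝ (Pt → ℝ) where
  carrier := {f | Function.HasTemperateGrowth f}
  mul_mem' hf hg := hf.mul hg
  add_mem' hf hg := hf.add hg
  algebraMap_mem' c := Function.HasTemperateGrowth.const c

/-- Smooth real functions on `ℝ³` of temperate growth. -/
def Temp : Type := tempAlg

namespace Temp

instance : CommRing Temp := inferInstanceAs (CommRing tempAlg)
instance : Algebra ℝ Temp := inferInstanceAs (Algebra ℝ tempAlg)

instance : CoeFun Temp (fun _ => Pt → ℝ) := ⟨fun f => f.1⟩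

@[ext] theorem ext' {f g : Temp} (h : ∀ x, f x = g x) : f = g := Subtype.ext (funext h)

@[simp] theorem add_apply (f g : Temp) (x : Pt) : (f + g) x = f x + g x := rfl
@[simp] theorem sub_apply (f g : Temp) (x : Pt) : (f - g) x = f x - g x := rfl
@[simp] theorem neg_apply (f : Temp) (x : Pt) : (-f) x = -f x := rfl
@[simp] theorem mul_apply (f g : Temp) (x : Pt) : (f * g) x = f x * g x := rfl
@[simp] theorem pow_apply (f : Temp) (n : ℕ) (x : Pt) : (f ^ n) x = f x ^ n := rfl
@[simp] theorem smul_apply (c : ℝ) (f : Temp) (x : Pt) : (c • f) x = c * f x := rfl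
@[simp] theorem one_apply (x : Pt) : (1 : Temp) x = 1 := rfl
@[simp] theorem zero_apply (x : Pt) : (0 : Temp) x = 0 := rfl
@[simp] theorem ofNat_apply (n : ℕ) [n.AtLeastTwo] (x : Pt) :
    (OfNat.ofNat n : Temp) x = OfNat.ofNat n := rfl
@[simp] theorem sum_apply {ι : Type*} (s : Finset ι) (f : ι → Temp) (x : Pt) :
    (∑ i ∈ s, f i) x = ∑ i ∈ s, f i x := by
  classical
  induction s using Finset.induction_on with
  | empty => simp
  | insert a s ha ih => simp [Finset.sum_insert ha, ih]

theorem contDiff (f : Temp) : ContDiff ℝ (⊤ : ℕ∞) f.1 := f.2.1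

theorem differentiable (f : Temp) : Differentiable ℝ f.1 :=
  f.contDiff.differentiable (by simp)

theorem continuous (f : Temp) : Continuous f.1 := f.contDiff.continuous

theorem hasTemperateGrowth_pd (i : Fin 3) {f : Pt → ℝ} (hf : Function.HasTemperateGrowth f) :
    Function.HasTemperateGrowth (pd i f) := by
  have h1 : Function.HasTemperateGrowth (fderiv ℝ f) := by
    refine ⟨hf.1.fderiv_right (by simp), fun n => ?_⟩
    obtain ⟨k, C, h⟩ := hf.2 (n + 1)
    exact ⟨k, C, fun x => by rw [norm_iteratedFDeriv_fderiv]; exact h x⟩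
  have h2 := (ContinuousLinearMap.apply ℝ ℝ (Pi.single i (1 : ℝ) : Pt)).hasTemperateGrowth.comp h1
  exact h2

/-- The partial derivative `∂ᵢ` as a derivation. -/
def D (i : Fin 3) : Derivation ℝ Temp Temp :=
  Derivation.mk'
    { toFun := fun f => ⟨pd i f, hasTemperateGrowth_pd i f.2⟩
      map_add' := fun f g => by
        ext x
        change fderiv ℝ (f.1 + g.1) x _ = _
        rw [fderiv_add (f.differentiable x) (g.differentiable x)]; rfl
      map_smul' := fun c f => by
        ext x
        change fderiv ℝ (c • f.1) x _ = _
        rw [fderiv_const_smul (f.differentiable x)]; rfl }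
    (fun f g => by
      ext x
      change fderiv ℝ (f.1 * g.1) x _ = f x * fderiv ℝ g.1 x _ + g x * fderiv ℝ f.1 x _
      rw [fderiv_mul (f.differentiable x) (g.differentiable x)]; rfl)

theorem D_mul (i : Fin 3) (f g : Temp) : D i (f * g) = D i f * g + f * D i g := by
  rw [Derivation.leibniz]; simp only [smul_eq_mul]; ring

theorem D_pow (i : Fin 3) (f : Temp) (n : ℕ) : D i (f ^ n) = n * f ^ (n - 1) * D i f := by
  rw [Derivation.leibniz_pow]; simp only [smul_eq_mul, nsmul_eq_mul]; ring

theorem D_ofNat (i : Fin 3) (n : ℕ) [n.AtLeastTwo] : D i (OfNat.ofNat n : Temp) = 0 :=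
  Derivation.map_natCast (D i) n

theorem D_comm (i j : Fin 3) (f : Temp) : D i (D j f) = D j (D i f) := by
  ext x
  have hs : IsSymmSndFDerivAt ℝ f.1 x :=
    f.contDiff.contDiffAt.isSymmSndFDerivAt
      (by simpa using WithTop.coe_le_coe.2 (le_top : (2 : ℕ∞) ≤ ⊤))
  have hd : DifferentiableAt ℝ (fderiv ℝ f.1) x :=
    (f.contDiff.fderiv_right (m := 1)
      (WithTop.coe_le_coe.2 (le_top : (2 : ℕ∞) ≤ ⊤))).differentiable (by simp) x
  have key : ∀ a b : Pt, fderiv ℝ (fun y => fderiv ℝ f.1 y a) x b = fderiv ℝ (fderiv ℝ f.1) x b a := by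
    intro a b
    rw [fderiv_clm_apply hd (differentiableAt_const a)]
    simp
  change fderiv ℝ (fun y => fderiv ℝ f.1 y _) x _ = fderiv ℝ (fun y => fderiv ℝ f.1 y _) x _
  rw [key, key]
  exact hs.eq _ _

/-- `Sc f` says that `f` is a Schwartz function. -/
class Sc (f : Temp) : Prop where
  out : ∃ φ : SchwartzMap Pt ℝ, ⇑φ = f.1

variable {f g : Temp}

instance [hf : Sc f] [hg : Sc g] : Sc (f + g) := by
  obtain ⟨φ, hφ⟩ := hf; obtain ⟨χ, hχ⟩ := hg
  exact ⟨φ + χ, by ext x; simp [hφ, hχ]⟩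

instance [hf : Sc f] : Sc (-f) := by
  obtain ⟨φ, hφ⟩ := hf
  exact ⟨-φ, by ext x; simp [hφ]⟩

instance [hf : Sc f] [hg : Sc g] : Sc (f - g) := by
  rw [sub_eq_add_neg]; infer_instance

instance : Sc 0 := ⟨0, by ext x; simp⟩

instance [hf : Sc f] (c : ℝ) : Sc (c • f) := by
  obtain ⟨φ, hφ⟩ := hf
  exact ⟨c • φ, by ext x; simp [hφ]⟩

instance Sc.mul_left [hg : Sc g] : Sc (f * g) := by
  obtain ⟨φ, hφ⟩ := hg
  refine ⟨SchwartzMap.smulLeftCLM ℝ f.1 φ, ?_⟩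
  ext x
  rw [SchwartzMap.smulLeftCLM_apply_apply f.2]
  simp [hφ]

instance Sc.mul_right [hf : Sc f] : Sc (f * g) := by
  rw [mul_comm]; infer_instance

instance Sc.sq [hf : Sc f] : Sc (f ^ 2) := by
  rw [pow_two]; infer_instance

instance Sc.D (i : Fin 3) [hf : Sc f] : Sc (D i f) := by
  obtain ⟨φ, hφ⟩ := hf
  refine ⟨LineDeriv.lineDerivOp (Pi.single i (1 : ℝ) : Pt) φ, ?_⟩
  ext x
  rw [SchwartzMap.lineDerivOp_apply_eq_fderiv, hφ]; rfl

instance Sc.sum {ι : Type*} (s : Finset ι) (f : ι → Temp) [hf : ∀ i, Sc (f i)] :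
    Sc (∑ i ∈ s, f i) := by
  classical
  induction s using Finset.induction_on with
  | empty => simp only [Finset.sum_empty]; infer_instance
  | insert a s ha ih => rw [Finset.sum_insert ha]; infer_instance

theorem integrable (f : Temp) [hf : Sc f] : Integrable f.1 := by
  obtain ⟨φ, hφ⟩ := hf
  rw [← hφ]; exact φ.integrable

/-- The integral over `ℝ³`. -/
def I (f : Temp) : ℝ := ∫ x, f x

theorem I_add (f g : Temp) [Sc f] [Sc g] : I (f + g) = I f + I g :=
  integral_add f.integrable g.integrable

theorem I_sub (f g : Temp) [Sc f] [Sc g] : I (f - g) = I f - I g :=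
  integral_sub f.integrable g.integrable

theorem I_neg (f : Temp) : I (-f) = - I f := integral_neg _

theorem I_smul (c : ℝ) (f : Temp) : I (c • f) = c * I f := integral_const_mul _ _

theorem I_sum {ι : Type*} (s : Finset ι) (f : ι → Temp) [∀ i, Sc (f i)] :
    I (∑ i ∈ s, f i) = ∑ i ∈ s, I (f i) := by
  classical
  induction s using Finset.induction_on with
  | empty => simp [I]
  | insert a s ha ih => rw [Finset.sum_insert ha, Finset.sum_insert ha, I_add, ih]

theorem I_D (i : Fin 3) (f : Temp) [Sc f] : I (D i f) = 0 := by
  have := integral_bilinear_hasLineDerivAt_right_eq_neg_left_of_integrable (μ := volume)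
    (f := fun _ : Pt => (1 : ℝ)) (f' := fun _ => 0) (g := f.1) (g' := (D i f).1)
    (v := Pi.single i 1) (B := ContinuousLinearMap.mul ℝ ℝ) (by simp)
    (by simpa using (D i f).integrable) (by simpa using f.integrable)
    (fun x _ => by simpa using (hasFDerivAt_const (1 : ℝ) x).hasLineDerivAt (Pi.single i 1))
    (fun x _ => (f.differentiable x).hasFDerivAt.hasLineDerivAt _)
  simpa [I] using this

theorem I_nonneg (h : ∀ x, 0 ≤ f x) : 0 ≤ I f := integral_nonneg h

theorem I_mono [Sc f] [Sc g] (h : ∀ x, f x ≤ g x) : I f ≤ I g :=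
  integral_mono f.integrable g.integrable h

/-- Integration by parts. -/
theorem I_parts (i : Fin 3) (f g : Temp) [Sc g] : I (f * D i g) = - I (D i f * g) := by
  have := I_D i (f * g)
  rw [D_mul, I_add] at this
  linarith

/-- The squared `L²` norm. -/
def Q (f : Temp) : ℝ := I (f * f)

theorem Q_nonneg (f : Temp) : 0 ≤ Q f := I_nonneg fun _ => mul_self_nonneg _

/-- The `L²` norm. -/
def N (f : Temp) : ℝ := Real.sqrt (Q f)

theorem N_nonneg (f : Temp) : 0 ≤ N f := Real.sqrt_nonneg _

theorem N_sq (f : Temp) : N f ^ 2 = Q f := Real.sq_sqrt (Q_nonneg f)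

/-- The `L¹` norm. -/
def L1 (f : Temp) : ℝ := ∫ x, |f x|

theorem L1_nonneg (f : Temp) : 0 ≤ L1 f := integral_nonneg fun _ => abs_nonneg _

theorem abs_I_le (f : Temp) : |I f| ≤ L1 f := abs_integral_le_integral_abs

theorem L1_add (f g : Temp) [Sc f] [Sc g] : L1 (f + g) ≤ L1 f + L1 g := by
  unfold L1
  rw [← integral_add f.integrable.abs g.integrable.abs]
  exact integral_mono (f + g).integrable.abs (f.integrable.abs.add g.integrable.abs)
    fun _ => abs_add_le _ _

theorem L1_neg (f : Temp) : L1 (-f) = L1 f := by simp [L1]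

theorem memLp_two (f : Temp) [hf : Sc f] : MemLp f.1 2 := by
  obtain ⟨φ, hφ⟩ := hf
  rw [← hφ]; exact φ.memLp 2

/-- Cauchy–Schwarz. -/
theorem L1_mul_le (f g : Temp) [Sc f] [Sc g] : L1 (f * g) ≤ N f * N g := by
  have h := integral_mul_norm_le_Lp_mul_Lq (μ := volume) (f := f.1) (g := g.1)
    Real.HolderConjugate.two_two (by simpa using f.memLp_two) (by simpa using g.memLp_two)
  simp only [N, Q, I, L1, Real.sqrt_eq_rpow, mul_apply, abs_mul]
  simpa [← pow_two, Real.norm_eq_abs] using h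

theorem abs_I_mul_le (f g : Temp) [Sc f] [Sc g] : |I (f * g)| ≤ N f * N g :=
  (abs_I_le _).trans (L1_mul_le f g)

theorem N_add (f g : Temp) [Sc f] [Sc g] : N (f + g) ≤ N f + N g := by
  have h1 : Q (f + g) = Q f + 2 * I (f * g) + Q g := by
    have : (f + g) * (f + g) = f * f + (2 : ℝ) • (f * g) + g * g := by
      ext x; simp; ring
    rw [Q, this, I_add, I_add, I_smul]; rfl
  refine Real.sqrt_le_iff.2 ⟨add_nonneg (N_nonneg f) (N_nonneg g), ?_⟩
  rw [h1, ← N_sq, ← N_sq]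
  nlinarith [(abs_le.1 (abs_I_mul_le f g)).2]

theorem N_neg (f : Temp) : N (-f) = N f := by simp [N, Q]

/-- `Bd f K` says that `|f| ≤ K` everywhere. -/
def Bd (f : Temp) (K : ℝ) : Prop := ∀ x, |f x| ≤ K

theorem Bd.nonneg {K : ℝ} (h : Bd f K) : 0 ≤ K := (abs_nonneg _).trans (h 0)

theorem Bd.add {K L : ℝ} (h : Bd f K) (h' : Bd g L) : Bd (f + g) (K + L) := fun x =>
  (abs_add_le _ _).trans (add_le_add (h x) (h' x))

theorem N_le_of_abs_le [Sc f] [Sc g] {K : ℝ} (hK : 0 ≤ K) (h : ∀ x, |f x| ≤ K * |g x|) :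
    N f ≤ K * N g := by
  refine Real.sqrt_le_iff.2 ⟨mul_nonneg hK (N_nonneg g), ?_⟩
  rw [mul_pow, N_sq, Q, Q, ← I_smul]
  refine I_mono fun x => ?_
  have := mul_self_le_mul_self (abs_nonneg _) (h x)
  simp only [mul_apply, smul_apply]
  rw [← abs_mul_abs_self]
  calc _ ≤ _ := this
    _ = K ^ 2 * (|g x| * |g x|) := by ring
    _ = _ := by rw [abs_mul_abs_self]

theorem Bd.N_mul {K : ℝ} (h : Bd f K) [Sc g] : N (f * g) ≤ K * N g :=
  N_le_of_abs_le h.nonneg fun x => by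
    rw [mul_apply, abs_mul]; exact mul_le_mul_of_nonneg_right (h x) (abs_nonneg _)

theorem Bd.L1_mul {K : ℝ} (h : Bd f K) [Sc g] : L1 (f * g) ≤ K * L1 g := by
  unfold L1
  rw [← integral_const_mul]
  refine integral_mono (f * g).integrable.abs (g.integrable.abs.const_mul K) fun x => ?_
  simp only [mul_apply, abs_mul]
  exact mul_le_mul_of_nonneg_right (h x) (abs_nonneg _)

end Temp

/-! ### Sobolev inequalities -/

open scoped Topology

namespace Temp

variable {f g : Temp}

theorem eLpNorm_two (f : Temp) [Sc f] : eLpNorm f.1 2 volume = ENNReal.ofReal (N f) := by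
  rw [f.memLp_two.eLpNorm_eq_integral_rpow_norm (by simp) (by simp)]
  congr 1
  simp only [N, Q, I, Real.sqrt_eq_rpow]
  simp [← pow_two]

/-- The sum of the `L²` norms of the first derivatives. -/
def G (f : Temp) : ℝ := ∑ i, N (D i f)

theorem G_nonneg (f : Temp) : 0 ≤ G f := Finset.sum_nonneg fun _ _ => N_nonneg _

theorem norm_fderiv_le (f : Temp) (x : Pt) : ‖fderiv ℝ f.1 x‖ ≤ ∑ i, |D i f x| := by
  refine ContinuousLinearMap.opNorm_le_bound _ (Finset.sum_nonneg fun _ _ => abs_nonneg _)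
    fun y => ?_
  have : fderiv ℝ f.1 x y = ∑ i, y i * D i f x := by
    conv_lhs => rw [pi_eq_sum_univ' y]
    rw [map_sum]
    refine Finset.sum_congr rfl fun i _ => ?_
    rw [map_smul, smul_eq_mul]
    congr 2
  rw [this, Finset.sum_mul]
  refine (Finset.abs_sum_le_sum_abs _ _).trans (Finset.sum_le_sum fun i _ => ?_)
  rw [abs_mul, mul_comm]
  exact mul_le_mul_of_nonneg_left (norm_le_pi_norm y i) (abs_nonneg _)

theorem exists_gns_compact : ∃ K : ℝ, 0 ≤ K ∧ ∀ g : Temp, Sc g → HasCompactSupport g.1 →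
    N (g * g * g) ≤ K * G g ^ 3 := by
  let C : ℝ≥0 := SNormLESNormFDerivOfEqConst ℝ (volume : Measure Pt) ((2 : ℝ≥0) : ℝ)
  refine ⟨(C : ℝ) ^ 3, by positivity, fun g hg hc => ?_⟩
  have h1 := eLpNorm_le_eLpNorm_fderiv_of_eq (volume : Measure Pt) (F := ℝ)
    (g.contDiff.of_le (WithTop.coe_le_coe.2 (le_top : (1 : ℕ∞) ≤ ⊤))) hc (p := 2) (p' := 6)
    (by norm_num) (by simp) (by simp; norm_num)
  have h2 : eLpNorm (fderiv ℝ g.1) 2 volume ≤ ENNReal.ofReal (G g) := by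
    calc eLpNorm (fderiv ℝ g.1) 2 volume
        ≤ eLpNorm (∑ i, fun x => |D i g x|) 2 volume := by
          refine eLpNorm_mono_real fun x => ?_
          simpa using norm_fderiv_le g x
      _ ≤ ∑ i, eLpNorm (fun x => |D i g x|) 2 volume :=
          eLpNorm_sum_le (fun i _ => (D i g).integrable.abs.aestronglyMeasurable) (by norm_num)
      _ = ∑ i, eLpNorm (D i g).1 2 volume := by
          refine Finset.sum_congr rfl fun i _ => ?_
          exact eLpNorm_norm (D i g).1
      _ = _ := by
          rw [G, ENNReal.ofReal_sum_of_nonneg fun _ _ => N_nonneg _]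
          exact Finset.sum_congr rfl fun i _ => eLpNorm_two _
  have h3 : ENNReal.ofReal (N (g * g * g)) = eLpNorm g.1 6 volume ^ 3 := by
    rw [← eLpNorm_two]
    have := eLpNorm_norm_rpow (p := 2) (μ := volume) g.1 (q := 3) (by norm_num)
    have e : (2 : ℝ≥0∞) * ENNReal.ofReal 3 = 6 := by
      rw [ENNReal.ofReal_ofNat]; norm_num
    rw [e] at this
    rw [← ENNReal.rpow_natCast]
    push_cast
    rw [← this, ← eLpNorm_norm]
    refine congrArg (fun u => eLpNorm u 2 volume) (funext fun x => ?_)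
    change ‖g x * g x * g x‖ = _
    rw [norm_mul, norm_mul, show (3 : ℝ) = (3 : ℕ) by norm_num, Real.rpow_natCast]
    ring
  have h4 : ENNReal.ofReal (N (g * g * g)) ≤ ENNReal.ofReal (C ^ 3 * G g ^ 3) := by
    rw [h3, ENNReal.ofReal_mul (by positivity), ENNReal.ofReal_pow (by positivity),
      ENNReal.ofReal_pow (G_nonneg g), ← mul_pow]
    gcongr
    refine h1.trans ?_
    rw [ENNReal.ofReal_coe_nnreal]
    gcongr
    exact h2
  exact (ENNReal.ofReal_le_ofReal_iff (mul_nonneg (by positivity) (pow_nonneg (G_nonneg g) 3))).1 h4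

theorem exists_cutoff : ∃ (c : ℝ) (χ : ℕ → Temp), 0 ≤ c ∧ (∀ n, Sc (χ n)) ∧
    (∀ n, HasCompactSupport (χ n).1) ∧ (∀ n, Bd (χ n) 1) ∧
    (∀ n i, Bd (D i (χ n)) (c / (n + 1))) ∧
    ∀ x, Tendsto (fun n => χ n x) atTop (𝓝 1) := by
  let φ : ContDiffBump (0 : Pt) := ⟨1, 2, one_pos, one_lt_two⟩
  have hφ : ContDiff ℝ (⊤ : ℕ∞) φ := φ.contDiff
  have hcs : ∀ n : ℕ, HasCompactSupport fun x : Pt => φ (((n : ℝ) + 1)⁻¹ • x) := fun n =>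
    φ.hasCompactSupport.comp_smul (by positivity)
  have hcd : ∀ n : ℕ, ContDiff ℝ (⊤ : ℕ∞) fun x : Pt => φ (((n : ℝ) + 1)⁻¹ • x) := fun n =>
    hφ.comp (contDiff_const_smul _)
  obtain ⟨c, hc⟩ := (hφ.continuous_fderiv (by simp)).bounded_above_of_compact_support
    (φ.hasCompactSupport.fderiv ℝ)
  refine ⟨c, fun n => ⟨_, (hcs n).hasTemperateGrowth (hcd n)⟩,
    (norm_nonneg _).trans (hc 0), fun n => ⟨(hcs n).toSchwartzMap (hcd n), rfl⟩, hcs,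
    fun n x => ?_, fun n i x => ?_, fun x => ?_⟩
  · change |φ _| ≤ 1
    rw [abs_of_nonneg φ.nonneg]; exact φ.le_one
  · change |fderiv ℝ (fun x : Pt => φ (((n : ℝ) + 1)⁻¹ • x)) x _| ≤ _
    have h0 : HasFDerivAt (fun x : Pt => ((n : ℝ) + 1)⁻¹ • x)
        (((n : ℝ) + 1)⁻¹ • ContinuousLinearMap.id ℝ Pt) x :=
      ((((n : ℝ) + 1)⁻¹ • ContinuousLinearMap.id ℝ Pt).hasFDerivAt)
    have h : HasFDerivAt (fun x : Pt => φ (((n : ℝ) + 1)⁻¹ • x))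
        ((fderiv ℝ φ (((n : ℝ) + 1)⁻¹ • x)).comp
          (((n : ℝ) + 1)⁻¹ • ContinuousLinearMap.id ℝ Pt)) x :=
      ((hφ.differentiable (by simp)) _).hasFDerivAt.comp x h0
    rw [h.fderiv]
    simp only [ContinuousLinearMap.comp_apply, _root_.smul_apply, map_smul,
      ContinuousLinearMap.id_apply, smul_eq_mul, abs_mul]
    rw [div_eq_inv_mul, abs_of_nonneg (by positivity)]
    gcongr
    refine ((fderiv ℝ φ _).le_opNorm _).trans ?_
    rw [Pi.norm_single, norm_one, mul_one]
    exact hc _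
  · refine tendsto_const_nhds.congr' ?_
    obtain ⟨m, hm⟩ := exists_nat_ge ‖x‖
    filter_upwards [eventually_ge_atTop m] with n hn
    refine (φ.one_of_mem_closedBall ?_).symm
    rw [mem_closedBall_zero_iff, norm_smul, norm_inv, Real.norm_of_nonneg (by positivity)]
    change _ ≤ (1 : ℝ)
    rw [inv_mul_le_one₀ (by positivity)]
    have : (m : ℝ) ≤ n := by exact_mod_cast hn
    linarith

/-- The Gagliardo–Nirenberg–Sobolev inequality `‖f‖_{L⁶} ≲ ‖∇f‖_{L²}`. -/
theorem exists_gns : ∃ K : ℝ, 0 ≤ K ∧ ∀ f : Temp, Sc f → N (f * f * f) ≤ K * G f ^ 3 := by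
  obtain ⟨K, hK, h⟩ := exists_gns_compact
  obtain ⟨c, χ, hc, hS, hcs, hb, hbD, hlim⟩ := exists_cutoff
  refine ⟨K, hK, fun f hf => ?_⟩
  have h1 : ∀ n : ℕ, G (χ n * f) ≤ 3 * (c / (n + 1) * N f) + G f := fun n => by
    have : ∀ i, N (D i (χ n * f)) ≤ c / (n + 1) * N f + N (D i f) := fun i => by
      rw [D_mul]
      refine (N_add _ _).trans (add_le_add (hbD n i).N_mul ?_)
      simpa using (hb n).N_mul (g := D i f)
    calc G (χ n * f) ≤ ∑ i, (c / (n + 1) * N f + N (D i f)) := Finset.sum_le_sum fun i _ => this i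
      _ = _ := by simp [Finset.sum_add_distrib, G]
  have h2 : ∀ n : ℕ, N (χ n * f * (χ n * f) * (χ n * f)) ≤
      K * (3 * (c / (n + 1) * N f) + G f) ^ 3 := fun n => by
    refine (h _ inferInstance (hcs n).mul_right).trans ?_
    gcongr
    · exact G_nonneg _
    · exact h1 n
  have l1 : Tendsto (fun n => N (χ n * f * (χ n * f) * (χ n * f))) atTop (𝓝 (N (f * f * f))) := by
    refine (Real.continuous_sqrt.tendsto _).comp ?_
    refine tendsto_integral_of_dominated_convergence (fun x => (f * f * f * (f * f * f)) x)
      (fun n => (Temp.continuous _).aestronglyMeasurable) (f * f * f * (f * f * f)).integrable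
      (fun n => .of_forall fun x => ?_) (.of_forall fun x => ?_)
    · have e : χ n x * f x * (χ n x * f x) * (χ n x * f x) *
          (χ n x * f x * (χ n x * f x) * (χ n x * f x)) =
          (χ n x ^ 2) ^ 3 * (f x * f x * f x * (f x * f x * f x)) := by ring
      have e2 : 0 ≤ f x * f x * f x * (f x * f x * f x) := mul_self_nonneg _
      simp only [mul_apply]
      rw [e, Real.norm_of_nonneg (by positivity)]
      refine mul_le_of_le_one_left e2 (pow_le_one₀ (sq_nonneg _) ?_)
      exact (sq_le_one_iff_abs_le_one _).2 (hb n x)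
    · simp only [mul_apply]
      have h := hlim x
      have h' : Tendsto (fun n => χ n x * f x) atTop (𝓝 (f x)) := by
        simpa using h.mul_const (f x)
      exact ((h'.mul h').mul h').mul ((h'.mul h').mul h')
  have l2 : Tendsto (fun n : ℕ => K * (3 * (c / ((n : ℝ) + 1) * N f) + G f) ^ 3) atTop
      (𝓝 (K * (3 * (0 * N f) + G f) ^ 3)) := by
    have : Tendsto (fun n : ℕ => c / ((n : ℝ) + 1)) atTop (𝓝 0) := by
      simpa [div_eq_mul_inv] using (tendsto_one_div_add_atTop_nhds_zero_nat (𝕜 := ℝ)).const_mul c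
    exact ((((this.mul_const _).const_mul 3).add_const _).pow 3).const_mul K
  have := le_of_tendsto_of_tendsto' l1 l2 h2
  simpa using this

end Temp

namespace Temp

variable {f g : Temp}

/-- An `H¹` norm. -/
def H1 (f : Temp) : ℝ := N f + G f

theorem H1_nonneg (f : Temp) : 0 ≤ H1 f := add_nonneg (N_nonneg f) (G_nonneg f)

theorem N_le_H1 (f : Temp) : N f ≤ H1 f := le_add_of_nonneg_right (G_nonneg f)

theorem G_le_H1 (f : Temp) : G f ≤ H1 f := le_add_of_nonneg_left (N_nonneg f)

/-- The product estimate `‖f g‖_{L²} ≲ ‖f‖_{H¹} ‖g‖_{H¹}`. -/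
theorem exists_N_mul_le : ∃ K : ℝ, 0 ≤ K ∧ ∀ f g : Temp, Sc f → Sc g →
    N (f * g) ≤ K * H1 f * H1 g := by
  obtain ⟨K, hK, h⟩ := exists_gns
  have sq : ∀ f : Temp, Sc f → N (f * f) ≤ Real.sqrt K * H1 f ^ 2 := fun f hf => by
    refine Real.sqrt_le_iff.2 ⟨by positivity, ?_⟩
    rw [mul_pow, Real.sq_sqrt hK]
    have e : Q (f * f) = I (f * (f * f * f)) := by rw [Q]; congr 1; ring
    have h0 := H1_nonneg f
    calc Q (f * f) ≤ N f * N (f * f * f) := by rw [e]; exact (abs_le.1 (abs_I_mul_le _ _)).2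
      _ ≤ H1 f * (K * H1 f ^ 3) := by
          refine mul_le_mul (N_le_H1 f) ((h f hf).trans ?_) (N_nonneg _) h0
          have := G_nonneg f
          gcongr
          exact G_le_H1 f
      _ = _ := by ring
  refine ⟨Real.sqrt K, Real.sqrt_nonneg _, fun f g hf hg => ?_⟩
  have h0 := H1_nonneg f
  have h1 := H1_nonneg g
  refine Real.sqrt_le_iff.2 ⟨by positivity, ?_⟩
  have e : Q (f * g) = I (f * f * (g * g)) := by rw [Q]; congr 1; ring
  calc Q (f * g) ≤ N (f * f) * N (g * g) := by rw [e]; exact (abs_le.1 (abs_I_mul_le _ _)).2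
    _ ≤ (Real.sqrt K * H1 f ^ 2) * (Real.sqrt K * H1 g ^ 2) :=
        mul_le_mul (sq f hf) (sq g hg) (N_nonneg _) (by positivity)
    _ = _ := by ring

theorem le_add_inv_pow_mul_pow {a m : ℝ} (ha : 0 ≤ a) (hm : 0 < m) : a ≤ m + (m⁻¹) ^ 5 * a ^ 6 := by
  rcases le_total a m with h | h
  · have : 0 ≤ (m⁻¹) ^ 5 * a ^ 6 := by positivity
    linarith
  · have h1 : 1 ≤ m⁻¹ * a := by rw [← div_eq_inv_mul]; exact (one_le_div hm).2 h
    have : a ≤ (m⁻¹ * a) ^ 5 * a := le_mul_of_one_le_left ha (one_le_pow₀ h1)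
    calc a ≤ (m⁻¹ * a) ^ 5 * a := this
      _ = (m⁻¹) ^ 5 * a ^ 6 := by ring
      _ ≤ _ := by linarith

theorem volume_cube : (volume : Measure Pt).real (Icc 0 1) = 1 := by
  simp [Measure.real, Real.volume_Icc_pi]

theorem exists_cube_bound : ∃ K : ℝ, 0 ≤ K ∧ ∀ f : Temp, Sc f → ∀ l : ℝ, 0 < l → G f ≤ l →
    ∀ (x : Pt) (s : ℝ), 0 < s → s * ∫ y in Icc (0 : Pt) 1, |f (x + s ^ 2 • y)| ≤ K * l := by
  obtain ⟨K, hK, h⟩ := exists_gns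
  refine ⟨1 + K ^ 2, by positivity, fun f hf l hl hG x s hs => ?_⟩
  have hS : ∫ y, f y ^ 6 ≤ K ^ 2 * l ^ 6 := by
    have e : ∫ y, f y ^ 6 = N (f * f * f) ^ 2 := by
      rw [N_sq]; refine integral_congr_ae (.of_forall fun y => ?_); simp only [mul_apply]; ring
    rw [e]
    have := G_nonneg f
    calc N (f * f * f) ^ 2 ≤ (K * l ^ 3) ^ 2 := by
          have := N_nonneg (f * f * f)
          gcongr
          exact (h f hf).trans (by gcongr)
      _ = _ := by ring
  have int6 : Integrable fun y => f y ^ 6 := by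
    refine (f * f * f * (f * f * f)).integrable.congr (.of_forall fun y => ?_)
    simp only [mul_apply]; ring
  have int6' : Integrable fun y : Pt => f (x + s ^ 2 • y) ^ 6 :=
    (int6.comp_add_left x).comp_smul (by positivity)
  have e6 : ∫ y : Pt, f (x + s ^ 2 • y) ^ 6 = (s⁻¹) ^ 6 * ∫ y, f y ^ 6 := by
    rw [Measure.integral_comp_smul_of_nonneg volume (fun z : Pt => f (x + z) ^ 6) (s ^ 2)
      (hR := by positivity), integral_add_left_eq_self (fun z => f z ^ 6) x]
    simp only [Module.finrank_fintype_fun_eq_card, Fintype.card_fin, smul_eq_mul]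
    congr 1
    rw [← pow_mul, inv_pow]
  have cont : Continuous fun y : Pt => f (x + s ^ 2 • y) :=
    f.continuous.comp (by fun_prop)
  have hm : 0 < l / s := by positivity
  calc s * ∫ y in Icc (0 : Pt) 1, |f (x + s ^ 2 • y)|
      ≤ s * ∫ y in Icc (0 : Pt) 1, (l / s + ((l / s)⁻¹) ^ 5 * f (x + s ^ 2 • y) ^ 6) := by
        refine mul_le_mul_of_nonneg_left (integral_mono ?_ ?_ fun y => ?_) hs.le
        · exact cont.abs.continuousOn.integrableOn_compact isCompact_Icc
        · exact (continuous_const.add (continuous_const.mul (cont.pow 6))).continuousOn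
            |>.integrableOn_compact isCompact_Icc
        · have := le_add_inv_pow_mul_pow (abs_nonneg (f (x + s ^ 2 • y))) hm
          rwa [Even.pow_abs (by decide)] at this
    _ ≤ s * (l / s + ((l / s)⁻¹) ^ 5 * ((s⁻¹) ^ 6 * (K ^ 2 * l ^ 6))) := by
        gcongr
        rw [integral_add, integral_const_mul, setIntegral_const, volume_cube, one_smul]
        · gcongr
          calc ∫ y in Icc (0 : Pt) 1, f (x + s ^ 2 • y) ^ 6
              ≤ ∫ y : Pt, f (x + s ^ 2 • y) ^ 6 :=
                setIntegral_le_integral int6' (.of_forall fun y => by positivity)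
            _ = (s⁻¹) ^ 6 * ∫ y, f y ^ 6 := e6
            _ ≤ _ := by gcongr
        · exact integrableOn_const (by simp [Real.volume_Icc_pi])
        · exact (int6'.const_mul _).integrableOn
    _ = (1 + K ^ 2) * l := by field_simp

/-- The sum of the `L²` norms of the first and second derivatives. -/
def G2 (f : Temp) : ℝ := G f + ∑ i, G (D i f)

theorem G2_nonneg (f : Temp) : 0 ≤ G2 f :=
  add_nonneg (G_nonneg f) (Finset.sum_nonneg fun _ _ => G_nonneg _)

/-- The embedding `‖f‖_{L^∞} ≲ ‖∇f‖_{H¹}`. -/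
theorem exists_sup_bound : ∃ K : ℝ, 0 ≤ K ∧ ∀ f : Temp, Sc f → Bd f (K * G2 f) := by
  obtain ⟨K, hK, hcube⟩ := exists_cube_bound
  refine ⟨7 * K, by positivity, fun f hf x => ?_⟩
  have main : ∀ ε > 0, |f x| ≤ 7 * K * (G2 f + ε) := by
    intro ε hε
    set l := G2 f + ε with hl
    have hl0 : 0 < l := add_pos_of_nonneg_of_pos (G2_nonneg f) hε
    have hs : 0 ≤ ∑ i, G (D i f) := Finset.sum_nonneg fun _ _ => G_nonneg _
    have hGf : G f ≤ l := by rw [hl, G2]; linarith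
    have hGD : ∀ i, G (D i f) ≤ l := fun i => by
      have := Finset.single_le_sum (fun i _ => G_nonneg (D i f)) (Finset.mem_univ i)
      rw [hl, G2]; linarith [G_nonneg f]
    let H : Pt × ℝ → ℝ := fun q => 2 * q.2 * ∑ i, |D i f (x + q.2 ^ 2 • q.1)|
    have hH : Continuous H := by
      refine Continuous.mul (by fun_prop) (continuous_finsetSum _ fun i _ => ?_)
      exact ((D i f).continuous.comp (by fun_prop)).abs
    have hHint : IntegrableOn H (Icc 0 1 ×ˢ Ioc 0 1) :=
      (hH.continuousOn.integrableOn_compact (isCompact_Icc.prod isCompact_Icc)).mono_set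
        (prod_mono le_rfl Ioc_subset_Icc_self)
    have hHint' : Integrable H ((volume.restrict (Icc (0 : Pt) 1)).prod
        (volume.restrict (Ioc (0 : ℝ) 1))) := by
      rw [Measure.prod_restrict]; exact hHint
    have pt : ∀ y ∈ Icc (0 : Pt) 1, |f x| ≤ |f (x + (1 : ℝ) ^ 2 • y)| + ∫ s in Ioc (0 : ℝ) 1, H (y, s) := by
      intro y hy
      have hy1 : ‖y‖ ≤ 1 := (pi_norm_le_iff_of_nonneg zero_le_one).2 fun i => by
        rw [Real.norm_of_nonneg (hy.1 i)]; exact hy.2 i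
      have hd : ∀ s : ℝ, HasDerivAt (fun s : ℝ => f.1 (x + s ^ 2 • y))
          (fderiv ℝ f.1 (x + s ^ 2 • y) ((2 * s) • y)) s := fun s => by
        have h1 : HasDerivAt (fun s : ℝ => x + s ^ 2 • y) ((2 * s) • y) s := by
          simpa using ((hasDerivAt_pow 2 s).smul_const y).const_add x
        exact (f.differentiable _).hasFDerivAt.comp_hasDerivAt s h1
      have hcont : Continuous fun s : ℝ => fderiv ℝ f.1 (x + s ^ 2 • y) ((2 * s) • y) :=
        ((f.contDiff.continuous_fderiv (by simp)).comp (by fun_prop)).clm_apply (by fun_prop)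
      have ftc := intervalIntegral.integral_eq_sub_of_hasDerivAt (fun s _ => hd s)
        (hcont.intervalIntegrable 0 1)
      have hle : |∫ s in (0 : ℝ)..1, fderiv ℝ f.1 (x + s ^ 2 • y) ((2 * s) • y)| ≤
          ∫ s in Ioc (0 : ℝ) 1, H (y, s) := by
        rw [intervalIntegral.integral_of_le zero_le_one]
        refine (abs_integral_le_integral_abs).trans (setIntegral_mono_on ?_ ?_
          measurableSet_Ioc fun s hs => ?_)
        · exact (hcont.abs.continuousOn.integrableOn_compact isCompact_Icc).mono_set
            Ioc_subset_Icc_self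
        · exact ((hH.comp (by fun_prop : Continuous fun s : ℝ => (y, s))).continuousOn
            |>.integrableOn_compact isCompact_Icc).mono_set Ioc_subset_Icc_self
        · refine ((fderiv ℝ f.1 (x + s ^ 2 • y)).le_opNorm _).trans ?_
          rw [norm_smul, Real.norm_of_nonneg (by linarith [hs.1])]
          calc _ ≤ (∑ i, |D i f (x + s ^ 2 • y)|) * (2 * s * 1) := by
                have := hs.1
                gcongr
                exact norm_fderiv_le f _
            _ = _ := by ring
      simp only [ne_eq, OfNat.ofNat_ne_zero, not_false_eq_true, zero_pow, zero_smul,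
        add_zero] at ftc
      have e : f x = f (x + (1 : ℝ) ^ 2 • y)
          - ∫ s in (0 : ℝ)..1, fderiv ℝ f.1 (x + s ^ 2 • y) ((2 * s) • y) := by
        rw [ftc]; ring
      rw [e]
      exact (abs_sub _ _).trans (by gcongr)
    have hinner : ∀ s ∈ Ioc (0 : ℝ) 1, ‖∫ y in Icc (0 : Pt) 1, H (y, s)‖ ≤ 6 * K * l := by
      intro s hs
      rw [Real.norm_of_nonneg (integral_nonneg fun y =>
        mul_nonneg (by linarith [hs.1]) (Finset.sum_nonneg fun _ _ => abs_nonneg _))]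
      change ∫ y in Icc (0 : Pt) 1, 2 * s * ∑ i, |D i f (x + s ^ 2 • y)| ≤ _
      rw [integral_const_mul, integral_finsetSum _ fun i _ => ?_, mul_assoc, Finset.mul_sum]
      · calc 2 * ∑ i, s * ∫ y in Icc (0 : Pt) 1, |D i f (x + s ^ 2 • y)|
            ≤ 2 * ∑ i : Fin 3, K * l := by
              refine mul_le_mul_of_nonneg_left (Finset.sum_le_sum fun i _ => ?_) zero_le_two
              exact hcube _ inferInstance l hl0 (hGD i) x s hs.1
          _ = _ := by simp; ring
      · exact ((D i f).continuous.comp (by fun_prop)).abs.continuousOn.integrableOn_compact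
          isCompact_Icc
    calc |f x| = ∫ y in Icc (0 : Pt) 1, |f x| := by
          rw [setIntegral_const, volume_cube, one_smul]
      _ ≤ ∫ y in Icc (0 : Pt) 1, (|f (x + (1 : ℝ) ^ 2 • y)| + ∫ s in Ioc (0 : ℝ) 1, H (y, s)) := by
          refine setIntegral_mono_on ?_ ?_ measurableSet_Icc pt
          · exact integrableOn_const (by simp [Real.volume_Icc_pi])
          · refine Integrable.add ?_ hHint'.integral_prod_left
            exact (f.continuous.comp (by fun_prop)).abs.continuousOn.integrableOn_compact
              isCompact_Icc
      _ = (∫ y in Icc (0 : Pt) 1, |f (x + (1 : ℝ) ^ 2 • y)|) +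
            ∫ s in Ioc (0 : ℝ) 1, ∫ y in Icc (0 : Pt) 1, H (y, s) := by
          rw [integral_add, integral_integral_swap hHint']
          · exact (f.continuous.comp (by fun_prop)).abs.continuousOn.integrableOn_compact
              isCompact_Icc
          · exact hHint'.integral_prod_left
      _ ≤ K * l + 6 * K * l := by
          refine add_le_add ?_ ?_
          · simpa using hcube f hf l hl0 hGf x 1 one_pos
          · have := norm_setIntegral_le_of_norm_le_const
              (measure_Ioc_lt_top (μ := (volume : Measure ℝ))) hinner
            exact (le_abs_self _).trans (by simpa using this)
      _ = _ := by ring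
  refine le_of_forall_pos_le_add fun ε hε => ?_
  have h7 : 0 < 7 * K + 1 := by positivity
  refine (main (ε / (7 * K + 1)) (by positivity)).trans ?_
  rw [mul_add]
  gcongr
  rw [mul_div_assoc', div_le_iff₀ h7]
  nlinarith

end Temp

/-! ### States at a fixed time and uniform estimates -/

namespace Temp

theorem exists_inv (s : Temp) (h : Bd s (1 / 10)) : ∃ b : Temp, ∀ x, b x = (1 + s x)⁻¹ := by
  let t : Set ℝ := Icc (-(1 / 10)) (1 / 10)
  have hg : ContDiffOn ℝ (⊤ : ℕ∞) (fun y : ℝ => (1 + y)⁻¹) t := by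
    refine ContDiffOn.inv (by fun_prop) fun y hy => ?_
    have := hy.1
    intro h0
    linarith
  have ht : UniqueDiffOn ℝ t := uniqueDiffOn_Icc (by norm_num)
  have hbd : ∀ n : ℕ, ∃ C : ℝ, 0 ≤ C ∧ ∀ x ∈ t, ‖iteratedFDerivWithin ℝ n (fun y : ℝ => (1 + y)⁻¹) t x‖ ≤ C := by
    intro n
    obtain ⟨C, hC⟩ := isCompact_Icc.exists_bound_of_continuousOn
      (hg.continuousOn_iteratedFDerivWithin (m := n) (WithTop.coe_le_coe.2 le_top) ht)
    exact ⟨max C 0, le_max_right _ _, fun x hx => (hC x hx).trans (le_max_left _ _)⟩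
  choose C hC0 hC using hbd
  refine ⟨⟨_, Function.HasTemperateGrowth.comp' (t := t) (g := fun y : ℝ => (1 + y)⁻¹) (f := s.1)
    ?_ ht hg (fun n => ⟨0, ∑ m ∈ Finset.range (n + 1), C m,
      Finset.sum_nonneg fun m _ => hC0 m, fun m hm x hx => ?_⟩) s.2⟩, fun x => rfl⟩
  · rintro _ ⟨x, rfl⟩
    exact abs_le.1 (h x)
  · rw [pow_zero, mul_one]
    exact (hC m x hx).trans (Finset.single_le_sum (f := C) (fun i _ => hC0 i)
      (Finset.mem_range.2 (by omega)))

/-- The Laplacian. -/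
def Lap (f : Temp) : Temp := ∑ i, D i (D i f)

instance {f : Temp} [Sc f] : Sc (Lap f) := by unfold Lap; infer_instance

/-- The full norm of a state. -/
def normA (v : Fin 3 → Temp) (ψ : Temp) : ℝ :=
  ∑ l, (N (v l) + ∑ i, (N (D i (v l)) + ∑ j, N (D j (D i (v l)))))
    + ∑ i, (N (D i ψ) + ∑ j, (N (D j (D i ψ)) + ∑ k, N (D k (D j (D i ψ)))))

/-- The dissipation norm of a state. -/
def normE (v : Fin 3 → Temp) (ψ : Temp) : ℝ :=
  ∑ l, ∑ i, (N (D i (v l)) + ∑ j, (N (D j (D i (v l))) + ∑ k, N (D k (D j (D i (v l))))))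
    + ∑ i ∈ hIdx, ∑ j, (N (D j (D i ψ)) + ∑ k, N (D k (D j (D i ψ))))

/-- The nonlinear forcing, up to gradients. -/
def force (v : Fin 3 → Temp) (ψ : Temp) (l : Fin 3) : Temp :=
  ∑ i, v i * D i (v l) + (D l ψ * Lap ψ - D 2 ψ * D l (D 2 ψ))

/-- The time derivative of the velocity, pressure excluded. -/
def accel (v : Fin 3 → Temp) (ψ : Temp) (l : Fin 3) : Temp :=
  Lap (v l) - (if l = 2 then Lap ψ else 0) - force v ψ l

end Temp

open Temp in
/-- A state at a fixed time: velocity, potential, total pressure and `b = 1 / (1 + ∂₃ψ)`. -/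
structure St where
  v : Fin 3 → Temp
  ψ : Temp
  P : Temp
  b : Temp
  sc_v : ∀ l, Sc (v l)
  sc_ψ : Sc ψ
  sc_P : Sc P
  div_v : ∑ l, D l (v l) = 0
  div_u : ∑ l, D l (accel v ψ l - D l P) = 0
  hs : Bd (D 2 ψ) (1 / 10)
  hb : b * (1 + D 2 ψ) = 1
  hA : normA v ψ ≤ 1

namespace St

open Temp

instance (σ : St) (l : Fin 3) : Sc (σ.v l) := σ.sc_v l
instance (σ : St) : Sc σ.ψ := σ.sc_ψ
instance (σ : St) : Sc σ.P := σ.sc_P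

/-- The full norm. -/
def A (σ : St) : ℝ := normA σ.v σ.ψ

/-- The dissipation norm. -/
def E (σ : St) : ℝ := normE σ.v σ.ψ

theorem A_nonneg (σ : St) : 0 ≤ σ.A := by
  unfold A normA
  repeat' first
    | with_reducible exact N_nonneg _
    | with_reducible refine add_nonneg ?_ ?_
    | with_reducible refine Finset.sum_nonneg fun _ _ => ?_

theorem E_nonneg (σ : St) : 0 ≤ σ.E := by
  unfold E normE
  repeat' first
    | with_reducible exact N_nonneg _
    | with_reducible refine add_nonneg ?_ ?_
    | with_reducible refine Finset.sum_nonneg fun _ _ => ?_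

theorem A_le_one (σ : St) : σ.A ≤ 1 := σ.hA

/-- The weight `A ^ m * E ^ n`. -/
def W (m n : ℕ) (σ : St) : ℝ := σ.A ^ m * σ.E ^ n

theorem W_mul (m n m' n' : ℕ) (σ : St) : W m n σ * W m' n' σ = W (m + m') (n + n') σ := by
  simp only [W, pow_add]; ring

theorem W_anti {m m' : ℕ} (h : m' ≤ m) (n : ℕ) (σ : St) : W m n σ ≤ W m' n σ :=
  mul_le_mul_of_nonneg_right (pow_le_pow_of_le_one σ.A_nonneg σ.A_le_one h)
    (pow_nonneg σ.E_nonneg _)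

theorem W_le {n : ℕ} (hn : n ≤ 2) (m : ℕ) (σ : St) : W m n σ ≤ 1 + σ.E ^ 2 := by
  refine (W_anti (Nat.zero_le m) n σ).trans ?_
  have := σ.E_nonneg
  simp only [W, pow_zero, one_mul]
  interval_cases n <;> nlinarith [sq_nonneg (σ.E - 1)]

/-- Uniform `L^∞` bounds. -/
def OB (F : St → Temp) (m n : ℕ) : Prop := ∃ K, 0 ≤ K ∧ ∀ σ, Bd (F σ) (K * W m n σ)

/-- Uniform `L²` bounds. -/
def O2 (F : St → Temp) (m n : ℕ) : Prop :=
  (∀ σ, Sc (F σ)) ∧ ∃ K, 0 ≤ K ∧ ∀ σ, N (F σ) ≤ K * W m n σ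

/-- Uniform `L¹` bounds. -/
def O1 (F : St → Temp) (m n : ℕ) : Prop :=
  (∀ σ, Sc (F σ)) ∧ ∃ K, 0 ≤ K ∧ ∀ σ, L1 (F σ) ≤ K * W m n σ

/-- Uniform `H¹` bounds. -/
def OH (F : St → Temp) (m n : ℕ) : Prop := O2 F m n ∧ ∀ i, O2 (fun σ => D i (F σ)) m n

variable {F F' : St → Temp} {m n m' n' : ℕ}

theorem O1.anti (h : O1 F m n) (hm : m' ≤ m) : O1 F m' n := by
  obtain ⟨hS, K, hK, h⟩ := h
  exact ⟨hS, K, hK, fun σ => (h σ).trans (mul_le_mul_of_nonneg_left (W_anti hm n σ) hK)⟩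

theorem OB.anti (h : OB F m n) (hm : m' ≤ m) : OB F m' n := by
  obtain ⟨K, hK, h⟩ := h
  exact ⟨K, hK, fun σ x => (h σ x).trans (mul_le_mul_of_nonneg_left (W_anti hm n σ) hK)⟩

theorem O2.add (h : O2 F m n) (h' : O2 F' m n) : O2 (fun σ => F σ + F' σ) m n := by
  obtain ⟨hS, K, hK, h⟩ := h
  obtain ⟨hS', K', hK', h'⟩ := h'
  exact ⟨fun σ => inferInstance, K + K', by positivity, fun σ =>
    (N_add _ _).trans ((add_le_add (h σ) (h' σ)).trans_eq (by ring))⟩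

theorem O2.neg (h : O2 F m n) : O2 (fun σ => -F σ) m n := by
  obtain ⟨hS, K, hK, h⟩ := h
  exact ⟨fun σ => inferInstance, K, hK, fun σ => (N_neg _).trans_le (h σ)⟩

theorem O2.sub (h : O2 F m n) (h' : O2 F' m n) : O2 (fun σ => F σ - F' σ) m n := by
  simpa only [sub_eq_add_neg] using h.add h'.neg

theorem O2.zero : O2 (fun _ => 0) m n :=
  ⟨fun _ => inferInstance, 0, le_rfl, fun σ => by simp [N, Q, I]⟩

theorem O2.sum {ι : Type*} (s : Finset ι) {F : ι → St → Temp} (h : ∀ i ∈ s, O2 (F i) m n) :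
    O2 (fun σ => ∑ i ∈ s, F i σ) m n := by
  classical
  induction s using Finset.induction_on with
  | empty => simpa using O2.zero
  | insert a s ha ih =>
    simp only [Finset.sum_insert ha]
    exact (h a (by simp)).add (ih fun i hi => h i (by simp [hi]))

theorem O1.add (h : O1 F m n) (h' : O1 F' m n) : O1 (fun σ => F σ + F' σ) m n := by
  obtain ⟨hS, K, hK, h⟩ := h
  obtain ⟨hS', K', hK', h'⟩ := h'
  exact ⟨fun σ => inferInstance, K + K', by positivity, fun σ =>
    (L1_add _ _).trans ((add_le_add (h σ) (h' σ)).trans_eq (by ring))⟩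

theorem O1.neg (h : O1 F m n) : O1 (fun σ => -F σ) m n := by
  obtain ⟨hS, K, hK, h⟩ := h
  exact ⟨fun σ => inferInstance, K, hK, fun σ => (L1_neg _).trans_le (h σ)⟩

theorem O1.sub (h : O1 F m n) (h' : O1 F' m n) : O1 (fun σ => F σ - F' σ) m n := by
  simpa only [sub_eq_add_neg] using h.add h'.neg

theorem O1.zero : O1 (fun _ => 0) m n :=
  ⟨fun _ => inferInstance, 0, le_rfl, fun σ => by simp [L1]⟩

theorem O1.sum {ι : Type*} (s : Finset ι) {F : ι → St → Temp} (h : ∀ i ∈ s, O1 (F i) m n) :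
    O1 (fun σ => ∑ i ∈ s, F i σ) m n := by
  classical
  induction s using Finset.induction_on with
  | empty => simpa using O1.zero
  | insert a s ha ih =>
    simp only [Finset.sum_insert ha]
    exact (h a (by simp)).add (ih fun i hi => h i (by simp [hi]))

theorem mul_W_le {a b K K' : ℝ} {σ : St} (ha : 0 ≤ a) (hb : 0 ≤ b) (h : a ≤ K * W m n σ)
    (h' : b ≤ K' * W m' n' σ) : a * b ≤ K * K' * W (m + m') (n + n') σ :=
  (mul_le_mul h h' hb (ha.trans h)).trans_eq (by rw [← W_mul]; ring)

theorem O2.mul (h : O2 F m n) (h' : O2 F' m' n') :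
    O1 (fun σ => F σ * F' σ) (m + m') (n + n') := by
  obtain ⟨hS, K, hK, h⟩ := h
  obtain ⟨hS', K', hK', h'⟩ := h'
  exact ⟨fun σ => inferInstance, K * K', by positivity, fun σ =>
    (L1_mul_le _ _).trans (mul_W_le (N_nonneg _) (N_nonneg _) (h σ) (h' σ))⟩

theorem OB.mul2 (h : OB F m n) (h' : O2 F' m' n') :
    O2 (fun σ => F σ * F' σ) (m + m') (n + n') := by
  obtain ⟨K, hK, h⟩ := h
  obtain ⟨hS', K', hK', h'⟩ := h'
  exact ⟨fun σ => inferInstance, K * K', by positivity, fun σ =>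
    (h σ).N_mul.trans (mul_W_le (h σ).nonneg (N_nonneg _) le_rfl (h' σ))⟩

theorem OB.mul1 (h : OB F m n) (h' : O1 F' m' n') :
    O1 (fun σ => F σ * F' σ) (m + m') (n + n') := by
  obtain ⟨K, hK, h⟩ := h
  obtain ⟨hS', K', hK', h'⟩ := h'
  exact ⟨fun σ => inferInstance, K * K', by positivity, fun σ =>
    (h σ).L1_mul.trans (mul_W_le (h σ).nonneg (L1_nonneg _) le_rfl (h' σ))⟩

theorem OB.mul (h : OB F m n) (h' : OB F' m' n') :
    OB (fun σ => F σ * F' σ) (m + m') (n + n') := by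
  obtain ⟨K, hK, h⟩ := h
  obtain ⟨K', hK', h'⟩ := h'
  refine ⟨K * K', by positivity, fun σ x => ?_⟩
  rw [mul_apply, abs_mul]
  exact mul_W_le (abs_nonneg _) (abs_nonneg _) (h σ x) (h' σ x)

theorem OB.pow (h : OB F 0 0) (k : ℕ) : OB (fun σ => F σ ^ k) 0 0 := by
  obtain ⟨K, hK, h⟩ := h
  refine ⟨K ^ k, by positivity, fun σ x => ?_⟩
  have := h σ x
  simp only [W, pow_zero, mul_one] at this ⊢
  rw [pow_apply, abs_pow]
  gcongr

theorem OB.add (h : OB F m n) (h' : OB F' m n) : OB (fun σ => F σ + F' σ) m n := by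
  obtain ⟨K, hK, h⟩ := h
  obtain ⟨K', hK', h'⟩ := h'
  exact ⟨K + K', by positivity, fun σ x => ((h σ).add (h' σ) x).trans_eq (by ring)⟩

theorem OB.one : OB (fun _ => 1) 0 0 := ⟨1, zero_le_one, fun σ x => by simp [W]⟩

theorem OH.mul (h : OH F m n) (h' : OH F' m' n') :
    O2 (fun σ => F σ * F' σ) (m + m') (n + n') := by
  have key : ∀ {F m n}, OH F m n → ∃ K, 0 ≤ K ∧ ∀ σ, H1 (F σ) ≤ K * W m n σ := by
    rintro F m n ⟨⟨-, K, hK, h⟩, h'⟩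
    choose _ K' hK' h' using h'
    refine ⟨K + ∑ i, K' i, add_nonneg hK (Finset.sum_nonneg fun i _ => hK' i), fun σ => ?_⟩
    rw [add_mul, Finset.sum_mul]
    exact add_le_add (h σ) (Finset.sum_le_sum fun i _ => h' i σ)
  obtain ⟨K, hK, h0⟩ := key h
  obtain ⟨K', hK', h0'⟩ := key h'
  obtain ⟨L, hL, hmul⟩ := exists_N_mul_le
  have := h.1.1
  have := h'.1.1
  refine ⟨fun σ => inferInstance, L * (K * K'), by positivity, fun σ => ?_⟩
  refine (hmul (F σ) (F' σ) inferInstance inferInstance).trans ?_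
  rw [mul_assoc, mul_assoc L]
  exact mul_le_mul_of_nonneg_left (mul_W_le (H1_nonneg _) (H1_nonneg _) (h0 σ) (h0' σ)) hL

/-- Uniform `L^∞` bounds from `L²` bounds on first and second derivatives. -/
theorem OB.of_O2 (hS : ∀ σ, Sc (F σ)) (h : ∀ i, O2 (fun σ => D i (F σ)) m n)
    (h' : ∀ i j, O2 (fun σ => D j (D i (F σ))) m n) : OB F m n := by
  choose _ K hK h using h
  choose _ K' hK' h' using h'
  obtain ⟨L, hL, hsup⟩ := exists_sup_bound
  have h1 : 0 ≤ ∑ i, K i := Finset.sum_nonneg fun i _ => hK i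
  have h2 : 0 ≤ ∑ i, ∑ j, K' i j := Finset.sum_nonneg fun i _ => Finset.sum_nonneg fun j _ => hK' i j
  refine ⟨L * (∑ i, K i + ∑ i, ∑ j, K' i j), by positivity, fun σ x => ?_⟩
  refine (hsup (F σ) (hS σ) x).trans ?_
  rw [mul_assoc]
  refine mul_le_mul_of_nonneg_left ?_ hL
  rw [add_mul, Finset.sum_mul, Finset.sum_mul]
  refine add_le_add (Finset.sum_le_sum fun i _ => h i σ) (Finset.sum_le_sum fun i _ => ?_)
  rw [Finset.sum_mul]
  exact Finset.sum_le_sum fun j _ => h' i j σ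

theorem O1.abs_I_le (h : O1 F m n) : ∃ K, 0 ≤ K ∧ ∀ σ, |I (F σ)| ≤ K * W m n σ := by
  obtain ⟨-, K, hK, h⟩ := h
  exact ⟨K, hK, fun σ => (Temp.abs_I_le _).trans (h σ)⟩

end St

namespace St

open Temp

theorem le_sum3 {f : Fin 3 → ℝ} (h : ∀ i, 0 ≤ f i) (i : Fin 3) : f i ≤ ∑ j, f j :=
  Finset.single_le_sum (fun j _ => h j) (Finset.mem_univ i)

theorem le_A_v (σ : St) (l : Fin 3) :
    N (σ.v l) + ∑ i, (N (D i (σ.v l)) + ∑ j, N (D j (D i (σ.v l)))) ≤ σ.A := by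
  have := N_nonneg
  refine (le_sum3 (f := fun l => N (σ.v l) + ∑ i, (N (D i (σ.v l)) + ∑ j, N (D j (D i (σ.v l)))))
    (fun l => ?_) l).trans (le_add_of_nonneg_right ?_)
  all_goals
    repeat' first
      | with_reducible exact N_nonneg _
      | with_reducible refine add_nonneg ?_ ?_
      | with_reducible refine Finset.sum_nonneg fun _ _ => ?_

theorem le_A_ψ (σ : St) (i : Fin 3) :
    N (D i σ.ψ) + ∑ j, (N (D j (D i σ.ψ)) + ∑ k, N (D k (D j (D i σ.ψ)))) ≤ σ.A := by
  refine (le_sum3 (f := fun i => N (D i σ.ψ) + ∑ j, (N (D j (D i σ.ψ))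
    + ∑ k, N (D k (D j (D i σ.ψ))))) (fun l => ?_) i).trans (le_add_of_nonneg_left ?_)
  all_goals
    repeat' first
      | with_reducible exact N_nonneg _
      | with_reducible refine add_nonneg ?_ ?_
      | with_reducible refine Finset.sum_nonneg fun _ _ => ?_

theorem le_E_v (σ : St) (l i : Fin 3) :
    N (D i (σ.v l)) + ∑ j, (N (D j (D i (σ.v l))) + ∑ k, N (D k (D j (D i (σ.v l))))) ≤ σ.E := by
  refine (le_sum3 (f := fun i => N (D i (σ.v l)) + ∑ j, (N (D j (D i (σ.v l)))
    + ∑ k, N (D k (D j (D i (σ.v l)))))) (fun l => ?_) i).trans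
    ((le_sum3 (f := fun l => ∑ i, (N (D i (σ.v l)) + ∑ j, (N (D j (D i (σ.v l)))
    + ∑ k, N (D k (D j (D i (σ.v l))))))) (fun l => ?_) l).trans (le_add_of_nonneg_right ?_))
  all_goals
    repeat' first
      | with_reducible exact N_nonneg _
      | with_reducible refine add_nonneg ?_ ?_
      | with_reducible refine Finset.sum_nonneg fun _ _ => ?_

theorem le_E_ψ (σ : St) {i : Fin 3} (hi : i ≠ 2) (j : Fin 3) :
    N (D j (D i σ.ψ)) + ∑ k, N (D k (D j (D i σ.ψ))) ≤ σ.E := by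
  have hm : i ∈ hIdx := by revert hi; revert i; decide
  refine (le_sum3 (f := fun j => N (D j (D i σ.ψ)) + ∑ k, N (D k (D j (D i σ.ψ))))
    (fun j => ?_) j).trans ((Finset.single_le_sum (f := fun i =>
    ∑ j, (N (D j (D i σ.ψ)) + ∑ k, N (D k (D j (D i σ.ψ))))) (fun l _ => ?_) hm).trans
    (le_add_of_nonneg_left ?_))
  all_goals
    repeat' first
      | with_reducible exact N_nonneg _
      | with_reducible refine add_nonneg ?_ ?_
      | with_reducible refine Finset.sum_nonneg fun _ _ => ?_

theorem le_of_add_sum {a c : ℝ} {f : Fin 3 → ℝ} (hf : ∀ i, 0 ≤ f i) (ha : 0 ≤ a)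
    (h : a + ∑ i, f i ≤ c) : a ≤ c ∧ ∀ i, f i ≤ c :=
  ⟨by linarith [Finset.sum_nonneg fun i (_ : i ∈ Finset.univ) => hf i],
    fun i => by linarith [le_sum3 hf i]⟩

theorem O2.of_le {F : St → Temp} (hS : ∀ σ, Sc (F σ)) {m n : ℕ} (h : ∀ σ, N (F σ) ≤ W m n σ) :
    O2 F m n := ⟨hS, 1, zero_le_one, fun σ => (h σ).trans_eq (one_mul _).symm⟩

theorem W10 (σ : St) : W 1 0 σ = σ.A := by simp [W]
theorem W01 (σ : St) : W 0 1 σ = σ.E := by simp [W]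

theorem nn1 (f : Temp) (i : Fin 3) : 0 ≤ N (D i f) + ∑ j, N (D j (D i f)) :=
  add_nonneg (N_nonneg _) (Finset.sum_nonneg fun _ _ => N_nonneg _)

theorem O2_v (l : Fin 3) : O2 (fun σ => σ.v l) 1 0 :=
  .of_le inferInstance fun σ => by
    rw [W10]; exact (le_of_add_sum (nn1 _) (N_nonneg _) (σ.le_A_v l)).1

theorem O2_Dv (i l : Fin 3) : O2 (fun σ => D i (σ.v l)) 1 0 :=
  .of_le inferInstance fun σ => by
    rw [W10]
    exact (le_of_add_sum (fun _ => N_nonneg _) (N_nonneg _)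
      ((le_of_add_sum (nn1 _) (N_nonneg _) (σ.le_A_v l)).2 i)).1

theorem O2_DDv (i j l : Fin 3) : O2 (fun σ => D i (D j (σ.v l))) 1 0 :=
  .of_le inferInstance fun σ => by
    rw [W10]
    exact (le_of_add_sum (fun _ => N_nonneg _) (N_nonneg _)
      ((le_of_add_sum (nn1 _) (N_nonneg _) (σ.le_A_v l)).2 j)).2 i

theorem E2_Dv (i l : Fin 3) : O2 (fun σ => D i (σ.v l)) 0 1 :=
  .of_le inferInstance fun σ => by
    rw [W01]; exact (le_of_add_sum (nn1 _) (N_nonneg _) (σ.le_E_v l i)).1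

theorem E2_DDv (i j l : Fin 3) : O2 (fun σ => D i (D j (σ.v l))) 0 1 :=
  .of_le inferInstance fun σ => by
    rw [W01]
    exact (le_of_add_sum (fun _ => N_nonneg _) (N_nonneg _)
      ((le_of_add_sum (nn1 _) (N_nonneg _) (σ.le_E_v l j)).2 i)).1

theorem E2_DDDv (i j k l : Fin 3) : O2 (fun σ => D i (D j (D k (σ.v l)))) 0 1 :=
  .of_le inferInstance fun σ => by
    rw [W01]
    exact (le_of_add_sum (fun _ => N_nonneg _) (N_nonneg _)
      ((le_of_add_sum (nn1 _) (N_nonneg _) (σ.le_E_v l k)).2 j)).2 i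

theorem O2_Dψ (i : Fin 3) : O2 (fun σ => D i σ.ψ) 1 0 :=
  .of_le inferInstance fun σ => by
    rw [W10]; exact (le_of_add_sum (nn1 _) (N_nonneg _) (σ.le_A_ψ i)).1

theorem O2_DDψ (i j : Fin 3) : O2 (fun σ => D i (D j σ.ψ)) 1 0 :=
  .of_le inferInstance fun σ => by
    rw [W10]
    exact (le_of_add_sum (fun _ => N_nonneg _) (N_nonneg _)
      ((le_of_add_sum (nn1 _) (N_nonneg _) (σ.le_A_ψ j)).2 i)).1

theorem O2_DDDψ (i j k : Fin 3) : O2 (fun σ => D i (D j (D k σ.ψ))) 1 0 :=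
  .of_le inferInstance fun σ => by
    rw [W10]
    exact (le_of_add_sum (fun _ => N_nonneg _) (N_nonneg _)
      ((le_of_add_sum (nn1 _) (N_nonneg _) (σ.le_A_ψ k)).2 j)).2 i

theorem E2_DDψ {i j : Fin 3} (h : i ≠ 2 ∨ j ≠ 2) : O2 (fun σ => D i (D j σ.ψ)) 0 1 := by
  have key : ∀ {i j : Fin 3}, j ≠ 2 → O2 (fun σ => D i (D j σ.ψ)) 0 1 := fun {i j} hj =>
    .of_le inferInstance fun σ => by
      rw [W01]; exact (le_of_add_sum (fun _ => N_nonneg _) (N_nonneg _) (σ.le_E_ψ hj i)).1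
  rcases h with h | h
  · simp only [D_comm i j]; exact key h
  · exact key h

theorem E2_DDDψ {i j k : Fin 3} (h : i ≠ 2 ∨ j ≠ 2 ∨ k ≠ 2) :
    O2 (fun σ => D i (D j (D k σ.ψ))) 0 1 := by
  have key : ∀ {i j k : Fin 3}, k ≠ 2 → O2 (fun σ => D i (D j (D k σ.ψ))) 0 1 := fun {i j k} hk =>
    .of_le inferInstance fun σ => by
      rw [W01]; exact (le_of_add_sum (fun _ => N_nonneg _) (N_nonneg _) (σ.le_E_ψ hk j)).2 i
  rcases h with h | h | h
  · have : ∀ σ : St, D i (D j (D k σ.ψ)) = D j (D k (D i σ.ψ)) := fun σ => by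
      rw [D_comm i j, D_comm i k]
    simp only [this]; exact key h
  · have : ∀ σ : St, D i (D j (D k σ.ψ)) = D i (D k (D j σ.ψ)) := fun σ => by rw [D_comm j k]
    simp only [this]; exact key h
  · exact key h

theorem OB_v (l : Fin 3) : OB (fun σ => σ.v l) 1 0 :=
  .of_O2 inferInstance (fun i => O2_Dv i l) fun i j => O2_DDv j i l

theorem EB_v (l : Fin 3) : OB (fun σ => σ.v l) 0 1 :=
  .of_O2 inferInstance (fun i => E2_Dv i l) fun i j => E2_DDv j i l

theorem EB_Dv (i l : Fin 3) : OB (fun σ => D i (σ.v l)) 0 1 :=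
  .of_O2 inferInstance (fun j => E2_DDv j i l) fun j k => E2_DDDv k j i l

theorem OB_Dψ (i : Fin 3) : OB (fun σ => D i σ.ψ) 1 0 :=
  .of_O2 inferInstance (fun j => O2_DDψ j i) fun j k => O2_DDDψ k j i

theorem EB_Dψ {i : Fin 3} (h : i ≠ 2) : OB (fun σ => D i σ.ψ) 0 1 :=
  .of_O2 inferInstance (fun _ => E2_DDψ (.inr h)) fun _ _ => E2_DDDψ (.inr (.inr h))

theorem EH_DDv (i j l : Fin 3) : OH (fun σ => D i (D j (σ.v l))) 0 1 :=
  ⟨E2_DDv i j l, fun k => E2_DDDv k i j l⟩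

theorem OH_DDψ (i j : Fin 3) : OH (fun σ => D i (D j σ.ψ)) 1 0 :=
  ⟨O2_DDψ i j, fun k => O2_DDDψ k i j⟩

theorem EH_DDψ {i j : Fin 3} (h : i ≠ 2 ∨ j ≠ 2) : OH (fun σ => D i (D j σ.ψ)) 0 1 :=
  ⟨E2_DDψ h, fun _ => E2_DDDψ (.inr h)⟩

theorem b_apply (σ : St) (x : Pt) : σ.b x * (1 + D 2 σ.ψ x) = 1 :=
  congrFun (congrArg Subtype.val σ.hb) x

theorem b_bounds (σ : St) (x : Pt) : 10 / 11 ≤ σ.b x ∧ σ.b x ≤ 10 / 9 := by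
  have h := σ.b_apply x
  have hs := abs_le.1 (σ.hs x)
  constructor <;> nlinarith

theorem OB_b : OB (fun σ => σ.b) 0 0 :=
  ⟨2, zero_le_two, fun σ x => by
    have := σ.b_bounds x
    rw [abs_of_nonneg (by linarith)]; simp [W]; linarith⟩

theorem OB_b_pow (k : ℕ) : OB (fun σ => σ.b ^ k) 0 0 := OB_b.pow k

theorem D_b (σ : St) (i : Fin 3) : D i σ.b = -(σ.b ^ 2 * D i (D 2 σ.ψ)) := by
  have h : D i (σ.b * (1 + D 2 σ.ψ)) = 0 := by rw [σ.hb]; exact (D i).map_one_eq_zero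
  rw [D_mul, map_add, (D i).map_one_eq_zero, zero_add] at h
  linear_combination σ.b * h - D i σ.b * σ.hb

end St

/-! ### Integration by parts identities -/

namespace Temp

variable {f g : Temp}

theorem D_Lap (i : Fin 3) (f : Temp) : D i (Lap f) = Lap (D i f) := by
  simp only [Lap, map_sum, D_comm i]

theorem Lap_add (f g : Temp) : Lap (f + g) = Lap f + Lap g := by
  simp only [Lap, map_add, Finset.sum_add_distrib]

theorem I_Lap_mul (f g : Temp) [Sc g] : I (Lap f * g) = -∑ i, I (D i f * D i g) := by
  simp only [Lap, Finset.sum_mul, I_parts, I_sum, Finset.sum_neg_distrib, neg_neg]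

theorem I_mul_Lap (f g : Temp) [Sc g] : I (f * Lap g) = -∑ i, I (D i f * D i g) := by
  simp only [Lap, Finset.mul_sum, I_parts, I_sum, Finset.sum_neg_distrib]

theorem I_Lap_mul_Lap (f g : Temp) [Sc g] :
    I (Lap f * Lap g) = ∑ i, ∑ j, I (D j (D i f) * D j (D i g)) := by
  simp only [I_Lap_mul, D_Lap, I_mul_Lap, Finset.sum_neg_distrib, neg_neg]

theorem Q_Lap (f : Temp) [Sc f] : Q (Lap f) = ∑ i, ∑ j, Q (D j (D i f)) := I_Lap_mul_Lap f f

theorem sum_I_D_Lap (f g : Temp) [Sc g] : ∑ k, I (D k (Lap f) * D k (Lap g)) =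
    ∑ k, ∑ i, ∑ j, I (D j (D i (D k f)) * D j (D i (D k g))) := by
  simp only [D_Lap, I_Lap_mul_Lap]

theorem sum_Q_D_Lap (f : Temp) [Sc f] : ∑ k, Q (D k (Lap f)) =
    ∑ k, ∑ i, ∑ j, Q (D j (D i (D k f))) := sum_I_D_Lap f f

theorem two_mul_I_le (f g : Temp) [Sc f] [Sc g] : 2 * |I (f * g)| ≤ Q f + Q g := by
  rw [← N_sq, ← N_sq]
  nlinarith [abs_I_mul_le f g, sq_nonneg (N f - N g)]

theorem two_mul_sum_I_le {ι : Type*} (s : Finset ι) (F G : ι → Temp) [∀ i, Sc (F i)] [∀ i, Sc (G i)] :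
    2 * |∑ i ∈ s, I (F i * G i)| ≤ ∑ i ∈ s, Q (F i) + ∑ i ∈ s, Q (G i) := by
  rw [← Finset.sum_add_distrib]
  refine (mul_le_mul_of_nonneg_left (Finset.abs_sum_le_sum_abs _ _) zero_le_two).trans ?_
  rw [Finset.mul_sum]
  exact Finset.sum_le_sum fun i _ => two_mul_I_le _ _

theorem two_mul_Q_Lap_le (f : Temp) [Sc f] :
    2 * Q (Lap f) ≤ ∑ i, Q (D i f) + ∑ i, Q (D i (Lap f)) := by
  rw [Q, I_Lap_mul, mul_neg]
  linarith [neg_abs_le (∑ i, I (D i f * D i (Lap f))), two_mul_sum_I_le Finset.univ (D · f) (D · (Lap f))]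

theorem two_mul_sum_Q_D_le (f : Temp) [Sc f] : 2 * ∑ i, Q (D i f) ≤ Q f + Q (Lap f) := by
  have h := I_Lap_mul f f
  have h' := two_mul_I_le (Lap f) f
  have : ∑ i, Q (D i f) = -I (Lap f * f) := by rw [h, neg_neg]; rfl
  rw [this, mul_neg]
  linarith [neg_abs_le (I (Lap f * f))]

theorem sum_I_mul_D {u : Fin 3 → Temp} (h : ∑ l, D l (u l) = 0) (P : Temp) [Sc P] :
    ∑ l, I (u l * D l P) = 0 := by
  simp only [I_parts, Finset.sum_neg_distrib, ← I_sum, ← Finset.sum_mul, h, zero_mul, neg_eq_zero]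
  simp [I]

theorem I_transport {v : Fin 3 → Temp} (h : ∑ l, D l (v l) = 0) (f : Temp) [Sc f] :
    I (f * ∑ l, v l * D l f) = 0 := by
  have h1 := sum_I_mul_D h (f * f)
  have h2 : ∀ l, v l * D l (f * f) = (2 : ℝ) • (f * (v l * D l f)) := fun l => by
    rw [D_mul, Algebra.smul_def, map_ofNat]; ring
  simp only [h2, I_smul, ← Finset.mul_sum, ← I_sum] at h1
  simpa using h1

theorem sum_Q_le_of_add_grad {u : Fin 3 → Temp} [∀ l, Sc (u l)] (h : ∑ l, D l (u l) = 0) (P : Temp)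
    [Sc P] : ∑ l, Q (u l) ≤ ∑ l, Q (u l + D l P) := by
  have h1 := sum_I_mul_D h P
  have h2 : ∀ l, Q (u l + D l P) = Q (u l) + Q (D l P) + 2 * I (u l * D l P) := fun l => by
    have : (u l + D l P) * (u l + D l P) =
      u l * u l + D l P * D l P + (2 : ℝ) • (u l * D l P) := by
        rw [Algebra.smul_def, map_ofNat]; ring
    rw [Q, this, I_add, I_add, I_smul]; rfl
  simp only [h2, Finset.sum_add_distrib, ← Finset.mul_sum, h1]
  linarith [Finset.sum_nonneg fun l (_ : l ∈ Finset.univ) => Q_nonneg (D l P)]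

/-- The divergence free field `(-∂₁∂₃f, -∂₂∂₃f, ∂₁²f + ∂₂²f)`. -/
def sol (f : Temp) : Fin 3 → Temp :=
  ![-D 0 (D 2 f), -D 1 (D 2 f), D 0 (D 0 f) + D 1 (D 1 f)]

theorem sol_zero (f : Temp) : sol f 0 = -D 0 (D 2 f) := rfl
theorem sol_one (f : Temp) : sol f 1 = -D 1 (D 2 f) := rfl
theorem sol_two (f : Temp) : sol f 2 = D 0 (D 0 f) + D 1 (D 1 f) := rfl

instance (f : Temp) [Sc f] (l : Fin 3) : Sc (sol f l) := by
  fin_cases l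
  · exact inferInstanceAs (Sc (-D 0 (D 2 f)))
  · exact inferInstanceAs (Sc (-D 1 (D 2 f)))
  · exact inferInstanceAs (Sc (D 0 (D 0 f) + D 1 (D 1 f)))

theorem D_sol (k : Fin 3) (f : Temp) (l : Fin 3) : D k (sol f l) = sol (D k f) l := by
  have h : ∀ i j, D k (D i (D j f)) = D i (D j (D k f)) := fun i j => by
    rw [D_comm k i, D_comm k j]
  fin_cases l
  · exact (map_neg (D k) _).trans (congrArg _ (h _ _))
  · exact (map_neg (D k) _).trans (congrArg _ (h _ _))
  · exact (map_add (D k) _ _).trans (congrArg₂ _ (h _ _) (h _ _))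

theorem Lap_sol (f : Temp) (l : Fin 3) : Lap (sol f l) = sol (Lap f) l := by
  have h : ∀ i j, Lap (D i (D j f)) = D i (D j (Lap f)) := fun i j => by simp only [D_Lap]
  have hn : ∀ g : Temp, Lap (-g) = -Lap g := fun g => by simp [Lap]
  fin_cases l
  · exact (hn _).trans (congrArg _ (h _ _))
  · exact (hn _).trans (congrArg _ (h _ _))
  · exact (Lap_add _ _).trans (congrArg₂ _ (h _ _) (h _ _))

theorem div_sol (f : Temp) : ∑ l, D l (sol f l) = 0 := by
  simp only [Fin.sum_univ_three, sol_zero, sol_one, sol_two, map_add, map_neg]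
  rw [D_comm 2 0, D_comm 2 0, D_comm 2 1, D_comm 2 1]
  ring

theorem sum_I_mul_sol {v : Fin 3 → Temp} (h : ∑ l, D l (v l) = 0) (f : Temp) [Sc f] :
    ∑ l, I (v l * sol f l) = I (Lap (v 2) * f) := by
  rw [Fin.sum_univ_three] at h ⊢
  have h2 : D 0 (v 0) + D 1 (v 1) = -D 2 (v 2) := by linear_combination h
  have e1 : I (v 0 * sol f 0) + I (v 1 * sol f 1) = I (D 2 (D 2 (v 2)) * f) := by
    rw [sol_zero, sol_one, mul_neg, mul_neg, I_neg, I_neg, I_parts 0, I_parts 1, neg_neg, neg_neg, ← I_add,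
      ← add_mul, h2, I_parts, map_neg, neg_mul, I_neg, neg_neg]
  have e2 : I (v 2 * sol f 2) = I (D 0 (D 0 (v 2)) * f) + I (D 1 (D 1 (v 2)) * f) := by
    rw [sol_two, mul_add, I_add, I_parts, I_parts, I_parts, I_parts, neg_neg, neg_neg]
  rw [e1, e2, Lap, Fin.sum_univ_three, add_mul, add_mul, I_add, I_add]
  ring

theorem I_Lap_mul_sol (f : Temp) [Sc f] : I (Lap f * sol f 2) = ∑ l, Q (sol f l) := by
  have h := sum_I_mul_sol (div_sol f) f
  rw [Lap_sol] at h
  rw [show ∑ l, Q (sol f l) = ∑ l, I (sol f l * sol f l) from rfl, h, sol_two, sol_two, add_mul,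
    mul_add, I_add, I_add]
  have : ∀ i, I (Lap f * D i (D i f)) = I (D i (D i (Lap f)) * f) := fun i => by
    rw [I_parts, I_parts, neg_neg]
  rw [this, this]

theorem sum_Q_sol (f : Temp) [Sc f] :
    ∑ l, Q (sol f l) = ∑ j, Q (D j (D 0 f)) + ∑ j, Q (D j (D 1 f)) := by
  have : ∀ i, I (Lap f * D i (D i f)) = ∑ j, Q (D j (D i f)) := fun i => by
    rw [I_parts, D_Lap, I_Lap_mul, neg_neg]; rfl
  rw [← I_Lap_mul_sol, sol_two, mul_add, I_add, this, this]

theorem sum_Q_sol_le (f : Temp) [Sc f] : ∑ l, Q (sol f l) ≤ Q (Lap f) := by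
  rw [sum_Q_sol, Q_Lap, Fin.sum_univ_three (fun i => ∑ j, Q (D j (D i f)))]
  exact le_add_of_nonneg_right (Finset.sum_nonneg fun j _ => Q_nonneg _)

end Temp

/-! ### The velocity and potential increments -/

namespace St

open Temp

/-- The time derivative of the velocity. -/
def u (σ : St) (l : Fin 3) : Temp := accel σ.v σ.ψ l - D l σ.P

/-- The advection of the potential. -/
def adv (σ : St) : Temp := ∑ m, σ.v m * D m σ.ψ

/-- The time derivative of the potential. -/
def η (σ : St) : Temp := -(σ.adv + σ.v 2)

instance (σ : St) : Sc σ.adv := by unfold adv; infer_instance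
instance (σ : St) : Sc σ.η := by unfold η; infer_instance
instance (σ : St) (l : Fin 3) : Sc (force σ.v σ.ψ l) := by unfold force; infer_instance
instance (σ : St) (l : Fin 3) : Sc (accel σ.v σ.ψ l) := by
  unfold accel; split_ifs <;> infer_instance
instance (σ : St) (l : Fin 3) : Sc (σ.u l) := by unfold u; infer_instance

theorem sum_D_u (σ : St) : ∑ l, D l (σ.u l) = 0 := σ.div_u

variable {F F' : St → Temp} {m n m' n' : ℕ}

theorem OB.ofNat (k : ℕ) [k.AtLeastTwo] : OB (fun _ => (OfNat.ofNat k : Temp)) 0 0 :=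
  ⟨(OfNat.ofNat k : ℝ), Nat.ofNat_nonneg k, fun σ x => by simp [W]⟩

theorem OB.neg (h : OB F m n) : OB (fun σ => -F σ) m n := by
  obtain ⟨K, hK, h⟩ := h
  exact ⟨K, hK, fun σ x => by rw [neg_apply, abs_neg]; exact h σ x⟩

theorem O2.congr (h : O2 F m n) (e : ∀ σ, F σ = F' σ) : O2 F' m n :=
  (funext e : F = F') ▸ h

theorem O1.congr (h : O1 F m n) (e : ∀ σ, F σ = F' σ) : O1 F' m n :=
  (funext e : F = F') ▸ h

theorem O2_Lapψ : O2 (fun σ => Lap σ.ψ) 1 0 := .sum _ fun _ _ => O2_DDψ _ _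

theorem OH_Lapψ : OH (fun σ => Lap σ.ψ) 1 0 :=
  ⟨O2_Lapψ, fun i => by simp only [Lap, map_sum]; exact .sum _ fun _ _ => O2_DDDψ _ _ _⟩

theorem force_two (σ : St) : force σ.v σ.ψ 2 = ∑ i, σ.v i * D i (σ.v 2)
    + D 2 σ.ψ * (D 0 (D 0 σ.ψ) + D 1 (D 1 σ.ψ)) := by
  simp only [force, Lap, Fin.sum_univ_three]; ring

theorem O2_force (l : Fin 3) : O2 (fun σ => force σ.v σ.ψ l) 1 1 := by
  have h1 : ∀ l, O2 (fun σ => ∑ i, σ.v i * D i (σ.v l)) 1 1 := fun l =>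
    .sum _ fun i _ => (EB_v i).mul2 (O2_Dv i l)
  by_cases hl : l = 2
  · subst hl
    simp only [force_two]
    exact (h1 _).add ((OB_Dψ 2).mul2 ((E2_DDψ (i := 0) (j := 0) (by decide)).add (E2_DDψ (i := 1) (j := 1) (by decide))))
  · exact (h1 _).add (((EB_Dψ hl).mul2 O2_Lapψ).sub ((OB_Dψ 2).mul2 (E2_DDψ (.inl hl))))

theorem O2_Dforce (k l : Fin 3) : O2 (fun σ => D k (force σ.v σ.ψ l)) 1 1 := by
  have h1 : ∀ l, O2 (fun σ => D k (∑ i, σ.v i * D i (σ.v l))) 1 1 := fun l => by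
    simp only [map_sum, D_mul]
    exact .sum _ fun i _ => ((EB_Dv k i).mul2 (O2_Dv i l)).add ((EB_v i).mul2 (O2_DDv k i l))
  by_cases hl : l = 2
  · subst hl
    simp only [force_two, map_add (D k), D_mul k (D 2 _)]
    refine (h1 _).add (.add ?_ ((OB_Dψ 2).mul2
      ((E2_DDDψ (.inr (by decide))).add (E2_DDDψ (.inr (by decide))))))
    simp only [mul_add]
    exact ((OH_DDψ k 2).mul (EH_DDψ (by decide))).add ((OH_DDψ k 2).mul (EH_DDψ (by decide)))
  · simp only [force, map_add (D k), map_sub (D k), D_mul k (D _ _)]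
    exact (h1 _).add (.sub (((EH_DDψ (.inr hl)).mul OH_Lapψ).add ((EB_Dψ hl).mul2 (OH_Lapψ.2 k)))
      (((OH_DDψ k 2).mul (EH_DDψ (.inl hl))).add ((OB_Dψ 2).mul2 (E2_DDDψ (.inr (.inl hl))))))

/-- The commutator of third derivatives with the advection of the potential. -/
def comm (i j k : Fin 3) (σ : St) : Temp :=
  D i (D j (D k σ.adv)) - ∑ m, σ.v m * D m (D i (D j (D k σ.ψ)))

theorem comm_eq (i j k : Fin 3) (σ : St) : comm i j k σ = ∑ m,
    (D i (σ.v m) * D j (D k (D m σ.ψ)) + D j (σ.v m) * D i (D k (D m σ.ψ))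
      + D k (σ.v m) * D i (D j (D m σ.ψ))
      + D i (D j (σ.v m)) * D k (D m σ.ψ) + D i (D k (σ.v m)) * D j (D m σ.ψ)
      + D j (D k (σ.v m)) * D i (D m σ.ψ) + D i (D j (D k (σ.v m))) * D m σ.ψ) := by
  simp only [comm, adv, map_sum, D_mul, map_add, ← Finset.sum_sub_distrib]
  refine Finset.sum_congr rfl fun m _ => ?_
  rw [D_comm m i, D_comm m j, D_comm m k]
  ring

theorem O2_comm (i j k : Fin 3) : O2 (comm i j k) 1 1 := by
  rw [show comm i j k = _ from funext (comm_eq i j k)]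
  refine .sum _ fun m _ => ?_
  refine .add (.add (.add (.add (.add (.add ?_ ?_) ?_) ?_) ?_) ?_) ?_
  · exact (EB_Dv _ _).mul2 (O2_DDDψ _ _ _)
  · exact (EB_Dv _ _).mul2 (O2_DDDψ _ _ _)
  · exact (EB_Dv _ _).mul2 (O2_DDDψ _ _ _)
  · exact (OH_DDψ _ _).mul (EH_DDv _ _ _) |>.congr fun _ => mul_comm _ _
  · exact (OH_DDψ _ _).mul (EH_DDv _ _ _) |>.congr fun _ => mul_comm _ _
  · exact (OH_DDψ _ _).mul (EH_DDv _ _ _) |>.congr fun _ => mul_comm _ _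
  · exact (OB_Dψ _).mul2 (E2_DDDv _ _ _ _) |>.congr fun _ => mul_comm _ _

end St

/-! ### The third order remainder -/

namespace St

open Temp

variable {F F' : St → Temp} {m n m' n' : ℕ}

theorem O1.exists_of_div (h : O1 F m n) (H : Fin 3 → St → Temp) [∀ l σ, Sc (H l σ)]
    (e : ∀ σ, F' σ = F σ + ∑ l, D l (H l σ)) : ∃ K, 0 ≤ K ∧ ∀ σ, |I (F' σ)| ≤ K * W m n σ := by
  obtain ⟨K, hK, hb⟩ := h.abs_I_le
  refine ⟨K, hK, fun σ => ?_⟩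
  have := h.1
  rw [e, I_add, I_sum]
  simpa only [I_D, Finset.sum_const_zero, add_zero] using hb σ

theorem OB_b5 : OB (fun σ => σ.b ^ 5 - 1) 1 0 := by
  have h : OB (fun σ => -(σ.b * (1 + σ.b + σ.b ^ 2 + σ.b ^ 3 + σ.b ^ 4) * D 2 σ.ψ)) 1 0 :=
    ((OB_b.mul ((((OB.one.add OB_b).add (OB_b_pow 2)).add (OB_b_pow 3)).add (OB_b_pow 4))).mul
      (OB_Dψ 2)).neg
  convert h using 2 with σ
  linear_combination (1 + σ.b + σ.b ^ 2 + σ.b ^ 3 + σ.b ^ 4) * σ.hb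

/-- The admissible part of the top vertical remainder. -/
def good (h : Fin 3) (σ : St) : Temp :=
  -(6 * (σ.b ^ 6 * (D 2 (σ.v h) * (D 2 (D 2 (D 2 σ.ψ)) * D h (D 2 (D 2 σ.ψ))))))
  - 6 * (σ.b ^ 6 * (D 2 (D 2 (D 2 σ.ψ)) * (D 2 (D 2 (σ.v h)) * D h (D 2 σ.ψ))))
  - 2 * (σ.b ^ 6 * (D h σ.ψ * (D 2 (D 2 (D 2 σ.ψ)) * D 2 (D 2 (D 2 (σ.v h))))))
  + 6 * (σ.b ^ 7 * (D 2 (σ.v h) * (D h σ.ψ * (D 2 (D 2 (D 2 σ.ψ)) * D 2 (D 2 (D 2 σ.ψ))))))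
  + 126 * (σ.b ^ 8 * (D 2 (σ.v h) *
      ((D 2 (D 2 σ.ψ) * D 2 (D 2 σ.ψ)) * (D 2 (D 2 σ.ψ) * D h (D 2 σ.ψ)))))
  - 54 * (σ.b ^ 7 * (D 2 (σ.v h) * ((D 2 (D 2 σ.ψ) * D 2 (D 2 σ.ψ)) * D h (D 2 (D 2 σ.ψ)))))
  - 18 * (σ.b ^ 7 * ((D 2 (D 2 (σ.v h)) * D 2 (D 2 σ.ψ)) * (D 2 (D 2 σ.ψ) * D h (D 2 σ.ψ))))
  - 4 * (σ.b ^ 6 * ((D 2 (D 2 (σ.v h)) * D 2 (D 2 σ.ψ)) * D h (D 2 (D 2 σ.ψ))))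
  + 10 * (σ.b ^ 6 * ((D 2 (D 2 (σ.v h)) * D h (D 2 σ.ψ)) * D 2 (D 2 (D 2 σ.ψ))))
  + 2 * ((σ.b ^ 5 - 1) * (D h (D 2 (D 2 σ.ψ)) * D 2 (D 2 (D 2 (σ.v h)))))

theorem O1_good {h : Fin 3} (hh : h ≠ 2) : O1 (good h) 1 2 := by
  have q := O2_DDDψ 2 2 2
  have a := OH_DDψ 2 2
  have aa := a.mul a
  have s := EH_DDψ (i := h) (j := 2) (.inl hh)
  have as := a.mul s
  have Da := E2_DDDψ (i := h) (j := 2) (k := 2) (.inl hh)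
  have V := EB_Dv 2 h
  have Y := EH_DDv 2 2 h
  have DY := E2_DDDv 2 2 2 h
  have key : ∀ {k p : ℕ} [p.AtLeastTwo] {F : St → Temp}, O1 F 1 2 →
      O1 (fun σ => (OfNat.ofNat p : Temp) * (σ.b ^ k * F σ)) 1 2 := fun {k p} _ {F} hF => by
    simpa only [zero_add] using (OB.ofNat p).mul1 ((OB_b_pow k).mul1 hF)
  refine .add (.add (.sub (.sub (.sub (.add (.add (.sub (.sub (.neg (key ?_)) (key ?_)) (key ?_))
    (key ?_)) (key ?_)) (key ?_)) (key ?_)) (key ?_)) (key ?_)) ?_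
  · exact V.mul1 (q.mul Da)
  · exact q.mul (Y.mul s)
  · exact (EB_Dψ hh).mul1 (q.mul DY)
  · exact (V.mul1 ((EB_Dψ hh).mul1 (q.mul q))).anti (by norm_num)
  · exact (V.mul1 (aa.mul as)).anti (by norm_num)
  · exact (V.mul1 (aa.mul Da)).anti (by norm_num)
  · exact ((Y.mul a).mul as).anti (by norm_num)
  · exact (Y.mul a).mul Da
  · exact (Y.mul s).mul q
  · exact (OB.ofNat 2).mul1 (OB_b5.mul1 (Da.mul DY))

/-- The remainder in the third order balance. -/
def rem (σ : St) : Temp :=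
  -(2 * ∑ i, ∑ j, ∑ k, D i (D j (D k σ.ψ)) * comm i j k σ)
  + 6 * (σ.b ^ 7 * (∑ m, D 2 (σ.v m) * D m σ.ψ + D 2 (σ.v 2)) * D 2 (D 2 (D 2 σ.ψ)) ^ 2)
  - 2 * ((σ.b ^ 6 - 1) * D 2 (D 2 (D 2 σ.ψ)) * (comm 2 2 2 σ + D 2 (D 2 (D 2 (σ.v 2)))))

/-- The flux in the third order remainder. -/
def remFlux (l : Fin 3) (σ : St) : Temp :=
  if l = 2 then
    -(3 * (σ.b ^ 6 * D 2 (D 2 σ.ψ) ^ 2 * D 2 (D 2 (σ.v 2))))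
    - 2 * ((σ.b ^ 5 - 1) * (D 0 (D 2 (D 2 σ.ψ)) * D 2 (D 2 (σ.v 0))
      + D 1 (D 2 (D 2 σ.ψ)) * D 2 (D 2 (σ.v 1))))
  else
    18 * (σ.b ^ 7 * D 2 (D 2 σ.ψ) ^ 3 * D 2 (σ.v l))
    - 3 * (σ.b ^ 6 * D 2 (D 2 σ.ψ) ^ 2 * D 2 (D 2 (σ.v l)))
    + 2 * ((σ.b ^ 5 - 1) * D 2 (D 2 (D 2 σ.ψ)) * D 2 (D 2 (σ.v l)))

instance (l : Fin 3) (σ : St) : Sc (remFlux l σ) := by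
  unfold remFlux; split_ifs <;> infer_instance

/-- The third order terms with a horizontal derivative. -/
def remHor (σ : St) : Temp := ∑ i, ∑ j, ∑ k,
  if i = 2 ∧ j = 2 ∧ k = 2 then 0 else D i (D j (D k σ.ψ)) * comm i j k σ

theorem O1_remHor : O1 remHor 1 2 := by
  refine .sum _ fun i _ => .sum _ fun j _ => .sum _ fun k _ => ?_
  by_cases h : i = 2 ∧ j = 2 ∧ k = 2
  · simp only [if_pos h]; exact .zero
  · simp only [if_neg h]
    exact (E2_DDDψ (by tauto)).mul (O2_comm i j k)

theorem sum_comm_eq (σ : St) : ∑ i, ∑ j, ∑ k, D i (D j (D k σ.ψ)) * comm i j k σ =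
    remHor σ + D 2 (D 2 (D 2 σ.ψ)) * comm 2 2 2 σ := by
  have : ∀ i j k : Fin 3, D i (D j (D k σ.ψ)) * comm i j k σ =
    (if i = 2 ∧ j = 2 ∧ k = 2 then 0 else D i (D j (D k σ.ψ)) * comm i j k σ) +
      if k = 2 then if j = 2 then if i = 2 then D 2 (D 2 (D 2 σ.ψ)) * comm 2 2 2 σ else 0 else 0
        else 0 := by
    intro i j k
    by_cases hi : i = 2 <;> by_cases hj : j = 2 <;> by_cases hk : k = 2 <;> simp [hi, hj, hk]
  rw [Finset.sum_congr rfl fun i _ => Finset.sum_congr rfl fun j _ =>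
    Finset.sum_congr rfl fun k _ => this i j k]
  simp only [Finset.sum_add_distrib, Finset.sum_ite_eq', Finset.mem_univ, if_true]
  rfl

theorem comm_top (σ : St) : comm 2 2 2 σ = ∑ m, (3 * (D 2 (σ.v m) * D m (D 2 (D 2 σ.ψ)))
    + 3 * (D 2 (D 2 (σ.v m)) * D m (D 2 σ.ψ)) + D 2 (D 2 (D 2 (σ.v m))) * D m σ.ψ) := by
  rw [comm_eq]
  refine Finset.sum_congr rfl fun m _ => ?_
  rw [D_comm 2 m, D_comm 2 m]
  ring

theorem rem_eq (σ : St) : rem σ = (good 0 σ + good 1 σ - 2 * remHor σ) + ∑ l, D l (remFlux l σ) := by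
  have hd := σ.div_v
  rw [Fin.sum_univ_three] at hd
  have h2 : D 0 (D 2 (D 2 (σ.v 0))) + D 1 (D 2 (D 2 (σ.v 1))) + D 2 (D 2 (D 2 (σ.v 2))) = 0 := by
    have := congrArg (fun f => D 2 (D 2 f)) hd
    simpa only [map_add, map_zero, D_comm 2 0, D_comm 2 1] using this
  have h1 : D 0 (D 2 (σ.v 0)) + D 1 (D 2 (σ.v 1)) + D 2 (D 2 (σ.v 2)) = 0 := by
    have := congrArg (fun f => D 2 f) hd
    simpa only [map_add, map_zero, D_comm 2 0, D_comm 2 1] using this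
  have e2 : ∀ i, D i (2 : Temp) = 0 := fun i => D_ofNat i 2
  have e3 : ∀ i, D i (3 : Temp) = 0 := fun i => D_ofNat i 3
  have e18 : ∀ i, D i (18 : Temp) = 0 := fun i => D_ofNat i 18
  rw [rem, sum_comm_eq]
  simp only [comm_top, Fin.sum_univ_three, good, remFlux, if_true,
    show (0 : Fin 3) ≠ 2 by decide, show (1 : Fin 3) ≠ 2 by decide, if_false, map_add, map_sub, map_neg,
    D_mul, D_pow, D_b, e2, e3, e18, (D _).map_one_eq_zero, D_comm 2 0, D_comm 2 1]
  norm_num only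
  linear_combination (6 * σ.b ^ 6 * D 2 (σ.v 2) * D 2 (D 2 (D 2 σ.ψ)) ^ 2
    - 2 * σ.b ^ 5 * D 2 (D 2 (D 2 σ.ψ)) * D 2 (D 2 (D 2 (σ.v 2)))) * σ.hb
    - 18 * σ.b ^ 7 * D 2 (D 2 σ.ψ) ^ 3 * h1
    + (3 * σ.b ^ 6 * D 2 (D 2 σ.ψ) ^ 2 - 2 * (σ.b ^ 5 - 1) * D 2 (D 2 (D 2 σ.ψ))) * h2

theorem exists_rem_le : ∃ K, 0 ≤ K ∧ ∀ σ, |I (rem σ)| ≤ K * W 1 2 σ :=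
  (((O1_good (by decide)).add (O1_good (by decide))).sub
    ((OB.ofNat 2).mul1 O1_remHor)).exists_of_div remFlux rem_eq

end St

/-! ### Energy, production and flux -/

namespace Temp

theorem I_ofNat_mul (k : ℕ) [k.AtLeastTwo] (f : Temp) :
    I ((OfNat.ofNat k : Temp) * f) = (OfNat.ofNat k : ℝ) * I f := by
  rw [← I_smul, Algebra.smul_def, map_ofNat]

end Temp

namespace St

open Temp

/-- The third order energy density. -/
def top (σ : St) : Temp :=
  ∑ i, ∑ j, ∑ k, D i (D j (D k σ.ψ)) * D i (D j (D k σ.ψ))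
    + (σ.b ^ 6 - 1) * (D 2 (D 2 (D 2 σ.ψ)) * D 2 (D 2 (D 2 σ.ψ)))

/-- The energy density. -/
def en (σ : St) : Temp :=
  4 * (∑ l, σ.v l * σ.v l + ∑ l, D l σ.ψ * D l σ.ψ)
  + 4 * ∑ l, ∑ i, ∑ j, D i (D j (σ.v l)) * D i (D j (σ.v l))
  + 4 * top σ
  + 2 * ∑ l, sol σ.ψ l * σ.v l
  - 2 * ∑ l, sol σ.ψ l * Lap (σ.v l)

/-- The formal time derivative of the third order energy density. -/
def topDot (σ : St) : Temp :=
  2 * ∑ i, ∑ j, ∑ k, D i (D j (D k σ.ψ)) * D i (D j (D k σ.η))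
    + (-(6 * (σ.b ^ 7 * D 2 σ.η * (D 2 (D 2 (D 2 σ.ψ)) * D 2 (D 2 (D 2 σ.ψ)))))
      + 2 * ((σ.b ^ 6 - 1) * (D 2 (D 2 (D 2 σ.ψ)) * D 2 (D 2 (D 2 σ.η)))))

/-- The formal time derivative of the energy density. -/
def enDot (σ : St) : Temp :=
  8 * (∑ l, σ.v l * σ.u l + ∑ l, D l σ.ψ * D l σ.η)
  + 8 * ∑ l, ∑ i, ∑ j, D i (D j (σ.v l)) * D i (D j (σ.u l))
  + 4 * topDot σ
  + 2 * (∑ l, sol σ.ψ l * σ.u l + ∑ l, σ.v l * sol σ.η l)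
  - 2 * (∑ l, sol σ.ψ l * Lap (σ.u l) + ∑ l, Lap (σ.v l) * sol σ.η l)

/-- The production of energy. -/
def prod (σ : St) : Temp :=
  8 * (∑ l, σ.v l * σ.u l + ∑ l, D l σ.ψ * D l σ.η)
  - 8 * ∑ j, ∑ l, Lap (D j (σ.v l)) * D j (σ.u l)
  + 4 * (rem σ - 2 * ∑ i, ∑ j, ∑ k, D i (D j (D k σ.ψ)) * D i (D j (D k (σ.v 2))))
  + 2 * (∑ l, sol σ.ψ l * σ.u l + ∑ l, σ.v l * sol σ.η l)
  + 2 * (∑ j, ∑ l, D j (sol σ.ψ l) * D j (σ.u l))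
  - 2 * ∑ l, Lap (σ.v l) * sol σ.η l

/-- The flux of energy. -/
def flux (i : Fin 3) (σ : St) : Temp :=
  8 * ∑ l, ∑ j, D i (D j (σ.v l)) * D j (σ.u l)
  - 4 * (σ.v i * top σ)
  - 2 * ∑ l, sol σ.ψ l * D i (σ.u l)

theorem sum_DD_u (σ : St) : ∑ l, ∑ i, ∑ j, D i (D j (σ.v l)) * D i (D j (σ.u l)) =
    ∑ i, D i (∑ l, ∑ j, D i (D j (σ.v l)) * D j (σ.u l))
      - ∑ j, ∑ l, Lap (D j (σ.v l)) * D j (σ.u l) := by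
  simp only [map_sum, D_mul, Finset.sum_add_distrib, Lap, Finset.sum_mul]
  rw [Finset.sum_comm (f := fun i l => ∑ j, D i (D i (D j (σ.v l))) * D j (σ.u l)),
    Finset.sum_comm (f := fun i l => ∑ j, D i (D j (σ.v l)) * D i (D j (σ.u l))),
    Finset.sum_comm (f := fun j l => ∑ i, D i (D i (D j (σ.v l))) * D j (σ.u l)),
    Finset.sum_congr rfl fun l _ => Finset.sum_comm
      (f := fun i j => D i (D i (D j (σ.v l))) * D j (σ.u l))]
  ring

theorem sum_sol_Lap_u (σ : St) : ∑ l, sol σ.ψ l * Lap (σ.u l) =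
    ∑ i, D i (∑ l, sol σ.ψ l * D i (σ.u l)) - ∑ j, ∑ l, D j (sol σ.ψ l) * D j (σ.u l) := by
  simp only [map_sum, D_mul, Finset.sum_add_distrib, Lap, Finset.mul_sum]
  rw [Finset.sum_comm]
  ring

/-- The derivative along the velocity. -/
def lie (σ : St) : Derivation ℝ Temp Temp := ∑ m, σ.v m • D m

theorem lie_apply (σ : St) (f : Temp) : σ.lie f = ∑ m, σ.v m * D m f := by
  simp [lie, Fin.sum_univ_three]

theorem lie_mul (σ : St) (f g : Temp) : σ.lie (f * g) = σ.lie f * g + f * σ.lie g := by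
  rw [Derivation.leibniz, smul_eq_mul, smul_eq_mul]; ring

theorem sum_D_v_mul (σ : St) (f : Temp) : ∑ i, D i (σ.v i * f) = σ.lie f := by
  simp only [D_mul, Finset.sum_add_distrib, ← Finset.sum_mul, σ.div_v, zero_mul, zero_add, lie_apply]

theorem topDot_eq (σ : St) : topDot σ = rem σ
    - 2 * ∑ i, ∑ j, ∑ k, D i (D j (D k σ.ψ)) * D i (D j (D k (σ.v 2)))
    - ∑ i, D i (σ.v i * top σ) := by
  have h3 : ∀ i j k, D i (D j (D k σ.η)) =
      -(comm i j k σ + σ.lie (D i (D j (D k σ.ψ))) + D i (D j (D k (σ.v 2)))) := fun i j k => by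
    simp only [η, map_neg, map_add, comm, lie_apply]; ring
  have h1 : D 2 σ.η = -(∑ m, D 2 (σ.v m) * D m σ.ψ + σ.lie (D 2 σ.ψ) + D 2 (σ.v 2)) := by
    simp only [η, map_neg, map_add, adv, map_sum, D_mul, lie_apply, Finset.sum_add_distrib, D_comm 2]
  have hb : σ.lie σ.b = -(σ.b ^ 2 * σ.lie (D 2 σ.ψ)) := by
    simp only [lie_apply, D_b, Finset.mul_sum, ← Finset.sum_neg_distrib]
    exact Finset.sum_congr rfl fun m _ => by ring
  have hb6 : σ.lie (σ.b ^ 6) = 6 * σ.b ^ 5 * σ.lie σ.b := by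
    rw [Derivation.leibniz_pow]; simp [mul_assoc]
  have hT : σ.lie (∑ i, ∑ j, ∑ k, D i (D j (D k σ.ψ)) * D i (D j (D k σ.ψ))) =
      2 * ∑ i, ∑ j, ∑ k, D i (D j (D k σ.ψ)) * σ.lie (D i (D j (D k σ.ψ))) := by
    simp only [map_sum, lie_mul, Finset.mul_sum]
    refine Finset.sum_congr rfl fun i _ => Finset.sum_congr rfl fun j _ =>
      Finset.sum_congr rfl fun k _ => by ring
  rw [sum_D_v_mul, topDot, rem, top, map_add, hT, lie_mul, lie_mul, map_sub, hb6, hb,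
    Derivation.map_one_eq_zero]
  simp only [h3, mul_neg, mul_add, Finset.sum_neg_distrib, Finset.sum_add_distrib]
  rw [h1]
  ring

theorem enDot_eq (σ : St) : enDot σ = prod σ + ∑ i, D i (flux i σ) := by
  have e2 : ∀ i, D i (2 : Temp) = 0 := fun i => D_ofNat i 2
  have e4 : ∀ i, D i (4 : Temp) = 0 := fun i => D_ofNat i 4
  have e8 : ∀ i, D i (8 : Temp) = 0 := fun i => D_ofNat i 8
  have h : ∑ i, D i (flux i σ) = 8 * ∑ i, D i (∑ l, ∑ j, D i (D j (σ.v l)) * D j (σ.u l))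
      - 4 * ∑ i, D i (σ.v i * top σ) - 2 * ∑ i, D i (∑ l, sol σ.ψ l * D i (σ.u l)) := by
    simp only [Finset.mul_sum, ← Finset.sum_sub_distrib]
    refine Finset.sum_congr rfl fun i _ => ?_
    rw [flux, map_sub, map_sub, D_mul i 8, D_mul i 4, D_mul i 2, e2, e4, e8, zero_mul, zero_mul,
      zero_mul, zero_add, zero_add, zero_add]
  rw [h, enDot, topDot_eq, sum_DD_u, sum_sol_Lap_u, prod]
  ring

end St

/-! ### Dissipation estimate -/

namespace Temp

theorem div_D {z : Fin 3 → Temp} (h : ∑ l, D l (z l) = 0) (j : Fin 3) : ∑ l, D l (D j (z l)) = 0 := by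
  simpa only [map_sum, map_zero, D_comm j] using congrArg (D j) h

theorem div_Lap {z : Fin 3 → Temp} (h : ∑ l, D l (z l) = 0) : ∑ l, D l (Lap (z l)) = 0 := by
  have := congrArg Lap h
  rw [Lap, Finset.sum_congr rfl fun i _ => by rw [map_sum, map_sum], Finset.sum_comm] at this
  simpa [Lap, map_sum, D_comm] using this

theorem sum_I_mul_eq {z : Fin 3 → Temp} (h : ∑ l, D l (z l) = 0) (V R : Fin 3 → Temp) (f P : Temp)
    [∀ l, Sc (V l)] [∀ l, Sc (R l)] [Sc f] [Sc P] :
    ∑ l, I (z l * (V l - (if l = 2 then f else 0) - R l - D l P)) =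
      ∑ l, I (z l * V l) - I (z 2 * f) - I (∑ l, z l * R l) := by
  have h1 : ∀ l, I (z l * (V l - (if l = 2 then f else 0) - R l - D l P)) =
      I (z l * V l) - (if l = 2 then I (z 2 * f) else 0) - I (z l * R l) - I (z l * D l P) := by
    intro l
    have : Sc (if l = 2 then f else 0) := by split_ifs <;> infer_instance
    rw [mul_sub, mul_sub, mul_sub, I_sub, I_sub, I_sub]
    by_cases hl : l = 2
    · subst hl; simp
    · simp only [if_neg hl, mul_zero]; simp [I]
  simp only [h1, Finset.sum_sub_distrib, sum_I_mul_D h, I_sum]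
  simp

end Temp

namespace St

open Temp

theorem u_eq (σ : St) (l : Fin 3) : σ.u l =
    Lap (σ.v l) - (if l = 2 then Lap σ.ψ else 0) - force σ.v σ.ψ l - D l σ.P := rfl

theorem D_u (σ : St) (k l : Fin 3) : D k (σ.u l) =
    D k (Lap (σ.v l)) - (if l = 2 then D k (Lap σ.ψ) else 0) - D k (force σ.v σ.ψ l)
      - D l (D k σ.P) := by
  rw [u_eq, map_sub, map_sub, map_sub, D_comm k l]
  split_ifs <;> simp

variable (σ : St)

/-- First order velocity dissipation. -/
def X0 : ℝ := ∑ l, ∑ i, Q (D i (σ.v l))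
/-- Second order velocity dissipation. -/
def X1 : ℝ := ∑ l, Q (Lap (σ.v l))
/-- Third order velocity dissipation. -/
def X2 : ℝ := ∑ l, ∑ i, Q (D i (Lap (σ.v l)))
/-- Second order potential dissipation. -/
def Y0 : ℝ := ∑ l, Q (sol σ.ψ l)
/-- Third order potential dissipation. -/
def Y1 : ℝ := ∑ k, ∑ l, Q (D k (sol σ.ψ l))

theorem E2_sol (l : Fin 3) : O2 (fun σ => sol σ.ψ l) 0 1 := by
  fin_cases l
  · exact (E2_DDψ (i := 0) (j := 2) (by decide)).neg
  · exact (E2_DDψ (i := 1) (j := 2) (by decide)).neg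
  · exact (E2_DDψ (i := 0) (j := 0) (by decide)).add (E2_DDψ (i := 1) (j := 1) (by decide))

theorem E2_Dsol (k l : Fin 3) : O2 (fun σ => D k (sol σ.ψ l)) 0 1 := by
  fin_cases l
  · exact (E2_DDDψ (i := k) (j := 0) (k := 2) (.inr (by decide))).neg.congr fun σ => (map_neg (D k) _).symm
  · exact (E2_DDDψ (i := k) (j := 1) (k := 2) (.inr (by decide))).neg.congr fun σ => (map_neg (D k) _).symm
  · exact ((E2_DDDψ (i := k) (j := 0) (k := 0) (.inr (by decide))).add
      (E2_DDDψ (i := k) (j := 1) (k := 1) (.inr (by decide)))).congr fun σ => (map_add (D k) _ _).symm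

theorem E2_Lapv (l : Fin 3) : O2 (fun σ => Lap (σ.v l)) 0 1 := .sum _ fun _ _ => E2_DDv _ _ _

theorem E2_DLapv (k l : Fin 3) : O2 (fun σ => D k (Lap (σ.v l))) 0 1 := by
  simp only [Lap, map_sum]; exact .sum _ fun _ _ => E2_DDDv _ _ _ _

theorem O2_adv : O2 adv 1 1 := .sum _ fun _ _ => (EB_v _).mul2 (O2_Dψ _)

theorem O2_Dadv (k : Fin 3) : O2 (fun σ => D k σ.adv) 1 1 := by
  simp only [adv, map_sum, D_mul]
  exact .sum _ fun _ _ => ((EB_Dv _ _).mul2 (O2_Dψ _)).add ((EB_v _).mul2 (O2_DDψ _ _))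

theorem I_low : I (∑ l, σ.v l * σ.u l + ∑ l, D l σ.ψ * D l σ.η) = -σ.X0 := by
  have h1 : ∑ l, I (σ.v l * Lap (σ.v l)) = -σ.X0 := by
    simp only [I_mul_Lap, Finset.sum_neg_distrib]; rfl
  have h2 : I (∑ l, D l σ.ψ * D l σ.η) = I (Lap σ.ψ * σ.adv) + I (σ.v 2 * Lap σ.ψ) := by
    rw [I_sum, ← neg_neg (∑ i, I _), ← I_Lap_mul, η, mul_neg, I_neg, neg_neg, mul_add, I_add,
      mul_comm (σ.v 2)]
  have h3 : ∑ l, σ.v l * force σ.v σ.ψ l = ∑ l, σ.v l * σ.lie (σ.v l) + Lap σ.ψ * σ.adv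
      - D 2 σ.ψ * σ.lie (D 2 σ.ψ) := by
    simp only [force, lie_apply, adv, mul_add, mul_sub, Finset.sum_add_distrib, Finset.sum_sub_distrib,
      Finset.mul_sum]
    rw [← add_sub_assoc]
    congr 1
    · congr 1; exact Finset.sum_congr rfl fun l _ => by ring
    · exact Finset.sum_congr rfl fun l _ => by ring
  have h4 : ∀ f, Sc f → I (f * σ.lie f) = 0 := fun f _ => by
    rw [lie_apply]; exact I_transport σ.div_v f
  have h5 : ∀ f, Sc f → Sc (σ.lie f) := fun f _ => by rw [lie_apply]; infer_instance
  have : I (∑ l, σ.v l * force σ.v σ.ψ l) = I (Lap σ.ψ * σ.adv) := by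
    rw [h3, I_sub, I_add, h4 _ inferInstance, I_sum]
    simp [fun l => h4 (σ.v l) inferInstance]
  rw [I_add, h2, I_sum]
  simp only [u_eq]
  rw [sum_I_mul_eq σ.div_v (fun l => Lap (σ.v l)) _ (Lap σ.ψ), h1, this]
  ring

theorem exists_high : ∃ K, 0 ≤ K ∧ ∀ σ : St,
    |I (∑ j, ∑ l, Lap (D j (σ.v l)) * D j (σ.u l)) - σ.X2
      + I (∑ i, ∑ j, ∑ k, D i (D j (D k σ.ψ)) * D i (D j (D k (σ.v 2))))| ≤ K * W 1 2 σ := by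
  have h : O1 (fun σ => ∑ j, ∑ l, Lap (D j (σ.v l)) * D j (force σ.v σ.ψ l)) 1 2 := by
    simp only [← D_Lap]
    exact .sum _ fun _ _ => .sum _ fun _ _ => (E2_DLapv _ _).mul (O2_Dforce _ _)
  obtain ⟨K, hK, hb⟩ := h.abs_I_le
  refine ⟨K, hK, fun σ => ?_⟩
  rw [← abs_neg]
  convert hb σ using 2
  have h2 : I (∑ i, ∑ j, ∑ k, D i (D j (D k σ.ψ)) * D i (D j (D k (σ.v 2)))) =
      ∑ j, I (Lap (D j (σ.v 2)) * D j (Lap σ.ψ)) := by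
    simp only [← D_Lap, mul_comm (D _ (Lap (σ.v 2)))]
    rw [sum_I_D_Lap]
    simp only [I_sum]
    rw [Finset.sum_comm, Finset.sum_congr rfl fun j _ => Finset.sum_comm, Finset.sum_comm]
  have h3 : ∀ j, I (∑ l, Lap (D j (σ.v l)) * D j (σ.u l)) = ∑ l, Q (D j (Lap (σ.v l)))
      - I (Lap (D j (σ.v 2)) * D j (Lap σ.ψ))
      - I (∑ l, Lap (D j (σ.v l)) * D j (force σ.v σ.ψ l)) := fun j => by
    rw [I_sum]
    simp only [D_u]
    rw [sum_I_mul_eq (div_Lap (div_D σ.div_v j)) (fun l => D j (Lap (σ.v l))) _ (D j (Lap σ.ψ))]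
    simp only [D_Lap]; rfl
  rw [h2, I_sum, Finset.sum_congr rfl fun j _ => h3 j, I_sum, X2, Finset.sum_comm]
  simp only [Finset.sum_sub_distrib]
  ring

theorem exists_cross_u : ∃ K, 0 ≤ K ∧ ∀ σ : St,
    |I (∑ l, sol σ.ψ l * σ.u l) - ∑ l, I (sol σ.ψ l * Lap (σ.v l)) + σ.Y0| ≤ K * W 1 2 σ := by
  have h : O1 (fun σ => ∑ l, sol σ.ψ l * force σ.v σ.ψ l) 1 2 :=
    .sum _ fun _ _ => (E2_sol _).mul (O2_force _)
  obtain ⟨K, hK, hb⟩ := h.abs_I_le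
  refine ⟨K, hK, fun σ => ?_⟩
  rw [← abs_neg]
  convert hb σ using 2
  rw [I_sum]
  simp only [u_eq]
  rw [sum_I_mul_eq (div_sol σ.ψ) (fun l => Lap (σ.v l)) _ (Lap σ.ψ), mul_comm (sol σ.ψ 2),
    I_Lap_mul_sol, Y0]
  ring

theorem exists_cross_Du : ∃ K, 0 ≤ K ∧ ∀ σ : St,
    |I (∑ k, ∑ l, D k (sol σ.ψ l) * D k (σ.u l))
      - ∑ k, ∑ l, I (D k (sol σ.ψ l) * D k (Lap (σ.v l))) + σ.Y1| ≤ K * W 1 2 σ := by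
  have h : O1 (fun σ => ∑ k, ∑ l, D k (sol σ.ψ l) * D k (force σ.v σ.ψ l)) 1 2 :=
    .sum _ fun _ _ => .sum _ fun _ _ => (E2_Dsol _ _).mul (O2_Dforce _ _)
  obtain ⟨K, hK, hb⟩ := h.abs_I_le
  refine ⟨K, hK, fun σ => ?_⟩
  rw [← abs_neg]
  convert hb σ using 2
  have h3 : ∀ k, I (∑ l, D k (sol σ.ψ l) * D k (σ.u l)) =
      ∑ l, I (D k (sol σ.ψ l) * D k (Lap (σ.v l))) - ∑ l, Q (D k (sol σ.ψ l))
      - I (∑ l, D k (sol σ.ψ l) * D k (force σ.v σ.ψ l)) := fun k => by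
    rw [I_sum]
    simp only [D_u]
    rw [sum_I_mul_eq (div_D (div_sol σ.ψ) k) (fun l => D k (Lap (σ.v l))) _ (D k (Lap σ.ψ))]
    congr 2
    simp only [D_sol]
    rw [mul_comm, D_Lap, I_Lap_mul_sol]
  rw [I_sum, Finset.sum_congr rfl fun j _ => h3 j, I_sum, Y1]
  simp only [Finset.sum_sub_distrib]
  ring

theorem exists_cross_v : ∃ K, 0 ≤ K ∧ ∀ σ : St,
    |I (∑ l, σ.v l * sol σ.η l) - ∑ i, Q (D i (σ.v 2))| ≤ K * W 1 2 σ := by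
  have h : O1 (fun σ => Lap (σ.v 2) * σ.adv) 1 2 := (O2_adv.mul (E2_Lapv 2)).congr fun _ => mul_comm _ _
  obtain ⟨K, hK, hb⟩ := h.abs_I_le
  refine ⟨K, hK, fun σ => ?_⟩
  rw [← abs_neg]
  convert hb σ using 2
  rw [I_sum, sum_I_mul_sol σ.div_v, η, mul_neg, I_neg, mul_add, I_add, I_Lap_mul _ (σ.v 2)]
  simp only [Q]
  ring

theorem exists_cross_Lapv : ∃ K, 0 ≤ K ∧ ∀ σ : St,
    |I (∑ l, Lap (σ.v l) * sol σ.η l) + Q (Lap (σ.v 2))| ≤ K * W 1 2 σ := by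
  have h : O1 (fun σ => ∑ k, D k (Lap (σ.v 2)) * D k σ.adv) 1 2 :=
    .sum _ fun _ _ => (E2_DLapv _ _).mul (O2_Dadv _)
  obtain ⟨K, hK, hb⟩ := h.abs_I_le
  refine ⟨K, hK, fun σ => ?_⟩
  convert hb σ using 2
  have h1 : I (Lap (Lap (σ.v 2)) * σ.v 2) = Q (Lap (σ.v 2)) := by
    rw [I_Lap_mul, ← I_mul_Lap]; rfl
  rw [I_sum, sum_I_mul_sol (div_Lap σ.div_v), η, mul_neg, I_neg, mul_add, I_add, h1, I_Lap_mul, I_sum]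
  ring

theorem X1_le : 2 * σ.X1 ≤ σ.X0 + σ.X2 := by
  rw [X1, X0, X2, Finset.mul_sum, ← Finset.sum_add_distrib]
  exact Finset.sum_le_sum fun l _ => two_mul_Q_Lap_le _

theorem exists_prod_le : ∃ K, 0 ≤ K ∧ ∀ σ : St,
    I σ.prod ≤ -(σ.X0 + σ.X2 + σ.Y0 + σ.Y1) + K * W 1 2 σ := by
  obtain ⟨K1, hK1, h1⟩ := exists_high
  obtain ⟨K2, hK2, h2⟩ := exists_cross_u
  obtain ⟨K3, hK3, h3⟩ := exists_cross_Du
  obtain ⟨K4, hK4, h4⟩ := exists_cross_v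
  obtain ⟨K5, hK5, h5⟩ := exists_cross_Lapv
  obtain ⟨K6, hK6, h6⟩ := exists_rem_le
  refine ⟨8 * K1 + 2 * K2 + 2 * K3 + 2 * K4 + 2 * K5 + 4 * K6, by positivity, fun σ => ?_⟩
  have i1 := (abs_le.1 (h1 σ)).1
  have i2 := (abs_le.1 (h2 σ)).2
  have i3 := (abs_le.1 (h3 σ)).2
  have i4 := (abs_le.1 (h4 σ)).2
  have i5 := (abs_le.1 (h5 σ)).1
  have i6 := (abs_le.1 (h6 σ)).2
  have j1 : 2 * ∑ l, I (sol σ.ψ l * Lap (σ.v l)) ≤ σ.Y0 + σ.X1 :=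
    (mul_le_mul_of_nonneg_left (le_abs_self _) zero_le_two).trans
      (two_mul_sum_I_le Finset.univ (fun l => sol σ.ψ l) (fun l => Lap (σ.v l)))
  have j2 : 2 * ∑ k, ∑ l, I (D k (sol σ.ψ l) * D k (Lap (σ.v l))) ≤ σ.Y1 + σ.X2 := by
    rw [Y1, X2, Finset.sum_comm (f := fun l i => Q (D i (Lap (σ.v l)))), Finset.mul_sum,
      ← Finset.sum_add_distrib]
    exact Finset.sum_le_sum fun k _ => (mul_le_mul_of_nonneg_left (le_abs_self _) zero_le_two).trans
      (two_mul_sum_I_le Finset.univ (fun l => D k (sol σ.ψ l)) (fun l => D k (Lap (σ.v l))))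
  have j3 : ∑ i, Q (D i (σ.v 2)) ≤ σ.X0 := le_sum3 (f := fun l => ∑ i, Q (D i (σ.v l)))
    (fun l => Finset.sum_nonneg fun i _ => Q_nonneg _) 2
  have j4 : Q (Lap (σ.v 2)) ≤ σ.X1 := le_sum3 (f := fun l => Q (Lap (σ.v l))) (fun l => Q_nonneg _) 2
  have j5 := σ.X1_le
  have n0 : 0 ≤ σ.X0 := Finset.sum_nonneg fun _ _ => Finset.sum_nonneg fun i _ => Q_nonneg _
  have n2 : 0 ≤ σ.X2 := Finset.sum_nonneg fun _ _ => Finset.sum_nonneg fun i _ => Q_nonneg _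
  have hrem : Sc (rem σ) := by unfold rem; infer_instance
  rw [prod, I_sub, I_add, I_add, I_add, I_sub, I_ofNat_mul, I_ofNat_mul, I_ofNat_mul, I_ofNat_mul,
    I_ofNat_mul, I_ofNat_mul, I_sub, I_ofNat_mul, I_add (∑ l, sol σ.ψ l * σ.u l), I_low]
  linarith

end St

/-! ### Coercivity -/

namespace St

open Temp

theorem N_le_sqrt {f : Temp} {Z : ℝ} (h : Q f ≤ Z) : N f ≤ √Z := Real.sqrt_le_sqrt h

/-- The coercive part of the production. -/
def Z (σ : St) : ℝ := σ.X0 + σ.X2 + σ.Y0 + σ.Y1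

theorem sum_le_card_mul {f : Fin 3 → ℝ} {c : ℝ} (h : ∀ i, f i ≤ c) : ∑ i, f i ≤ 3 * c := by
  rw [Fin.sum_univ_three]; linarith [h 0, h 1, h 2]

theorem X0_nonneg (σ : St) : 0 ≤ σ.X0 :=
  Finset.sum_nonneg fun _ _ => Finset.sum_nonneg fun _ _ => Q_nonneg _
theorem X2_nonneg (σ : St) : 0 ≤ σ.X2 :=
  Finset.sum_nonneg fun _ _ => Finset.sum_nonneg fun _ _ => Q_nonneg _
theorem Y0_nonneg (σ : St) : 0 ≤ σ.Y0 := Finset.sum_nonneg fun _ _ => Q_nonneg _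
theorem Y1_nonneg (σ : St) : 0 ≤ σ.Y1 :=
  Finset.sum_nonneg fun _ _ => Finset.sum_nonneg fun _ _ => Q_nonneg _

theorem le_sum33 {f : Fin 3 → Fin 3 → ℝ} (h : ∀ i j, 0 ≤ f i j) (i j : Fin 3) :
    f i j ≤ ∑ i, ∑ j, f i j :=
  (le_sum3 (h i) j).trans (le_sum3 (f := fun i => ∑ j, f i j)
    (fun i => Finset.sum_nonneg fun j _ => h i j) i)

theorem Q_DD_le (f : Temp) [Sc f] (i j : Fin 3) : Q (D j (D i f)) ≤ Q (Lap f) := by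
  rw [Q_Lap]
  exact le_sum33 (f := fun i j => Q (D j (D i f))) (fun _ _ => Q_nonneg _) i j

theorem Q_DDψ_le (f : Temp) [Sc f] {i : Fin 3} (hi : i ∈ hIdx) (j : Fin 3) :
    Q (D j (D i f)) ≤ ∑ l, Q (sol f l) := by
  have h0 : ∀ i, 0 ≤ ∑ j, Q (D j (D i f)) := fun i => Finset.sum_nonneg fun _ _ => Q_nonneg _
  have h := le_sum3 (f := fun j => Q (D j (D i f))) (fun _ => Q_nonneg _) j
  rw [sum_Q_sol]
  simp only [hIdx, Finset.mem_insert, Finset.mem_singleton] at hi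
  rcases hi with rfl | rfl
  · linarith [h0 1]
  · linarith [h0 0]

theorem E_sq_le (σ : St) : σ.E ^ 2 ≤ 141 ^ 2 * σ.Z := by
  have a0 := σ.X0_nonneg
  have a2 := σ.X2_nonneg
  have b0 := σ.Y0_nonneg
  have b1 := σ.Y1_nonneg
  have hZ : σ.Z = σ.X0 + σ.X2 + σ.Y0 + σ.Y1 := rfl
  have hZ0 : 0 ≤ σ.Z := by linarith
  have h1 : ∀ l i, N (D i (σ.v l)) ≤ √σ.Z := fun l i => N_le_sqrt <| by
    have : Q (D i (σ.v l)) ≤ σ.X0 :=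
      le_sum33 (f := fun l i => Q (D i (σ.v l))) (fun _ _ => Q_nonneg _) l i
    linarith
  have h2 : ∀ l i j, N (D j (D i (σ.v l))) ≤ √σ.Z := fun l i j => N_le_sqrt <| by
    have : Q (D j (D i (σ.v l))) ≤ σ.X1 := (Q_DD_le _ i j).trans
      (le_sum3 (f := fun l => Q (Lap (σ.v l))) (fun _ => Q_nonneg _) l)
    linarith [σ.X1_le]
  have h3 : ∀ l i j k, N (D k (D j (D i (σ.v l)))) ≤ √σ.Z := fun l i j k => N_le_sqrt <| by
    have : Q (D k (D j (D i (σ.v l)))) ≤ σ.X2 := (Q_DD_le _ j k).trans <| by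
      rw [← D_Lap]
      exact le_sum33 (f := fun l i => Q (D i (Lap (σ.v l)))) (fun _ _ => Q_nonneg _) l i
    linarith
  have h4 : ∀ i ∈ hIdx, ∀ j, N (D j (D i σ.ψ)) ≤ √σ.Z := fun i hi j => N_le_sqrt <| by
    have : Q (D j (D i σ.ψ)) ≤ σ.Y0 := Q_DDψ_le _ hi j
    linarith
  have h5 : ∀ i ∈ hIdx, ∀ j k, N (D k (D j (D i σ.ψ))) ≤ √σ.Z := fun i hi j k => N_le_sqrt <| by
    have : Q (D k (D j (D i σ.ψ))) ≤ σ.Y1 := by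
      rw [D_comm k j, D_comm k i]
      refine (Q_DDψ_le (D k σ.ψ) hi j).trans ?_
      simp only [← D_sol]
      exact le_sum3 (f := fun k => ∑ l, Q (D k (sol σ.ψ l)))
        (fun _ => Finset.sum_nonneg fun _ _ => Q_nonneg _) k
    linarith
  have hE : σ.E ≤ 141 * √σ.Z := by
    have e1 : ∑ l, ∑ i, (N (D i (σ.v l)) + ∑ j, (N (D j (D i (σ.v l)))
        + ∑ k, N (D k (D j (D i (σ.v l)))))) ≤ 3 * (3 * (√σ.Z + 3 * (√σ.Z + 3 * √σ.Z))) :=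
      sum_le_card_mul fun l => sum_le_card_mul fun i => add_le_add (h1 l i) <|
        sum_le_card_mul fun j => add_le_add (h2 l i j) <| sum_le_card_mul (h3 l i j)
    have e2 : ∑ i ∈ hIdx, ∑ j, (N (D j (D i σ.ψ)) + ∑ k, N (D k (D j (D i σ.ψ))))
        ≤ ∑ i ∈ hIdx, 3 * (√σ.Z + 3 * √σ.Z) :=
      Finset.sum_le_sum fun i hi => sum_le_card_mul fun j => add_le_add (h4 i hi j) <|
        sum_le_card_mul (h5 i hi j)
    rw [show ∑ i ∈ hIdx, 3 * (√σ.Z + 3 * √σ.Z) = 2 * (3 * (√σ.Z + 3 * √σ.Z)) by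
      rw [Finset.sum_const, show hIdx.card = 2 from rfl]; ring] at e2
    unfold E normE
    linarith
  calc σ.E ^ 2 ≤ (141 * √σ.Z) ^ 2 := pow_le_pow_left₀ σ.E_nonneg hE 2
    _ = 141 ^ 2 * σ.Z := by rw [mul_pow, Real.sq_sqrt hZ0]

instance (σ : St) : Sc σ.top := by unfold top; infer_instance
instance (σ : St) : Sc σ.en := by unfold en; infer_instance

theorem I_top (σ : St) : ∑ i, ∑ j, ∑ k, Q (D i (D j (D k σ.ψ))) ≤ 2 * I σ.top := by
  have hq : Q (D 2 (D 2 (D 2 σ.ψ))) ≤ ∑ i, ∑ j, ∑ k, Q (D i (D j (D k σ.ψ))) :=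
    (le_sum33 (f := fun j k => Q (D 2 (D j (D k σ.ψ)))) (fun _ _ => Q_nonneg _) 2 2).trans
      (le_sum3 (f := fun i => ∑ j, ∑ k, Q (D i (D j (D k σ.ψ))))
        (fun i => Finset.sum_nonneg fun _ _ => Finset.sum_nonneg fun _ _ => Q_nonneg _) 2)
  have h1 : I σ.top = ∑ i, ∑ j, ∑ k, Q (D i (D j (D k σ.ψ)))
      + I ((σ.b ^ 6 - 1) * (D 2 (D 2 (D 2 σ.ψ)) * D 2 (D 2 (D 2 σ.ψ)))) := by
    rw [top, I_add]; simp only [I_sum]; rfl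
  have h2 : 0 ≤ I (2 * ((σ.b ^ 6 - 1) * (D 2 (D 2 (D 2 σ.ψ)) * D 2 (D 2 (D 2 σ.ψ))))
      + D 2 (D 2 (D 2 σ.ψ)) * D 2 (D 2 (D 2 σ.ψ))) := by
    refine I_nonneg fun x => ?_
    have hb := (b_bounds σ x).1
    have h6 : (10 / 11 : ℝ) ^ 6 ≤ (σ.b x) ^ 6 := pow_le_pow_left₀ (by norm_num) hb 6
    have : 0 ≤ (2 * (σ.b x) ^ 6 - 1) * (D 2 (D 2 (D 2 σ.ψ)) x) ^ 2 :=
      mul_nonneg (by norm_num at h6; linarith) (sq_nonneg _)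
    simp only [add_apply, mul_apply, sub_apply, pow_apply, one_apply, show (2 : Temp) x = 2 from rfl]
    linarith
  rw [I_add, I_ofNat_mul] at h2
  change _ ≤ 2 * _ + Q _ at h2
  linarith

theorem exists_A_sq_le : ∃ K, 0 < K ∧ ∀ σ : St, σ.A ^ 2 ≤ K * I σ.en := by
  refine ⟨159 ^ 2, by norm_num, fun σ => ?_⟩
  set V0 := ∑ l, Q (σ.v l) with hV0
  set V2 := ∑ l, Q (Lap (σ.v l)) with hV2
  set Ψ1 := ∑ l, Q (D l σ.ψ) with hΨ1
  set Ψ3 := ∑ i, ∑ j, ∑ k, Q (D i (D j (D k σ.ψ))) with hΨ3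
  have p0 : 0 ≤ V0 := Finset.sum_nonneg fun _ _ => Q_nonneg _
  have p2 : 0 ≤ V2 := Finset.sum_nonneg fun _ _ => Q_nonneg _
  have p1 : 0 ≤ Ψ1 := Finset.sum_nonneg fun _ _ => Q_nonneg _
  have p3 : 0 ≤ Ψ3 := Finset.sum_nonneg fun _ _ => Finset.sum_nonneg fun _ _ =>
    Finset.sum_nonneg fun _ _ => Q_nonneg _
  have eΨ3 : ∑ i, Q (D i (Lap σ.ψ)) = Ψ3 := by
    rw [sum_Q_D_Lap]
    refine Finset.sum_congr rfl fun i _ => ?_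
    rw [Finset.sum_comm]
    refine Finset.sum_congr rfl fun j _ => Finset.sum_congr rfl fun k _ => ?_
    rw [D_comm j k, D_comm j i, D_comm k i, D_comm k j]
  have hLψ : 2 * Q (Lap σ.ψ) ≤ Ψ1 + Ψ3 := (two_mul_Q_Lap_le _).trans_eq (by rw [eΨ3])
  have hen : 3 * V0 + 3 * V2 + 3 * Ψ1 + Ψ3 ≤ I σ.en := by
    have e : I σ.en = 4 * (V0 + Ψ1) + 4 * V2 + 4 * I σ.top
        + 2 * ∑ l, I (sol σ.ψ l * σ.v l) - 2 * ∑ l, I (sol σ.ψ l * Lap (σ.v l)) := by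
      rw [en, I_sub, I_add, I_add, I_add, I_ofNat_mul, I_ofNat_mul, I_ofNat_mul, I_ofNat_mul,
        I_ofNat_mul, I_add]
      simp only [I_sum, hV2, Q_Lap]
      rw [Finset.sum_congr rfl fun l _ => Finset.sum_comm
        (f := fun i j => I (D i (D j (σ.v l)) * D i (D j (σ.v l))))]
      rfl
    have c1 := two_mul_sum_I_le Finset.univ (sol σ.ψ ·) (σ.v ·)
    have c2 := two_mul_sum_I_le Finset.univ (sol σ.ψ ·) (fun l => Lap (σ.v l))
    have c3 := sum_Q_sol_le σ.ψ
    have c4 := I_top σ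
    have c5 := neg_abs_le (∑ l, I (sol σ.ψ l * σ.v l))
    have c6 := le_abs_self (∑ l, I (sol σ.ψ l * Lap (σ.v l)))
    linarith
  set R := I σ.en with hR
  have h1 : ∀ l, N (σ.v l) ≤ √R := fun l => N_le_sqrt <| by
    have : Q (σ.v l) ≤ V0 := le_sum3 (f := fun l => Q (σ.v l)) (fun _ => Q_nonneg _) l
    linarith
  have hQL : ∀ l, Q (Lap (σ.v l)) ≤ V2 :=
    le_sum3 (f := fun l => Q (Lap (σ.v l))) (fun _ => Q_nonneg _)
  have h2 : ∀ l i, N (D i (σ.v l)) ≤ √R := fun l i => N_le_sqrt <| by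
    have := two_mul_sum_Q_D_le (σ.v l)
    have h0 : Q (σ.v l) ≤ V0 := le_sum3 (f := fun l => Q (σ.v l)) (fun _ => Q_nonneg _) l
    have := le_sum3 (f := fun i => Q (D i (σ.v l))) (fun _ => Q_nonneg _) i
    linarith [hQL l]
  have h3 : ∀ l i j, N (D j (D i (σ.v l))) ≤ √R := fun l i j => N_le_sqrt <| by
    linarith [Q_DD_le (σ.v l) i j, hQL l]
  have h4 : ∀ i, N (D i σ.ψ) ≤ √R := fun i => N_le_sqrt <| by
    have : Q (D i σ.ψ) ≤ Ψ1 := le_sum3 (f := fun l => Q (D l σ.ψ)) (fun _ => Q_nonneg _) i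
    linarith
  have h5 : ∀ i j, N (D j (D i σ.ψ)) ≤ √R := fun i j => N_le_sqrt <| by
    linarith [Q_DD_le σ.ψ i j]
  have h6 : ∀ i j k, N (D k (D j (D i σ.ψ))) ≤ √R := fun i j k => N_le_sqrt <| by
    have : Q (D k (D j (D i σ.ψ))) ≤ Ψ3 :=
      (le_sum33 (f := fun j i => Q (D k (D j (D i σ.ψ)))) (fun _ _ => Q_nonneg _) j i).trans
      (le_sum3 (f := fun k => ∑ j, ∑ i, Q (D k (D j (D i σ.ψ))))
        (fun i => Finset.sum_nonneg fun _ _ => Finset.sum_nonneg fun _ _ => Q_nonneg _) k)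
    linarith
  have hA : σ.A ≤ 159 * √R := by
    have e1 : ∑ l, (N (σ.v l) + ∑ i, (N (D i (σ.v l)) + ∑ j, N (D j (D i (σ.v l))))) ≤
        3 * (√R + 3 * (√R + 3 * √R)) :=
      sum_le_card_mul fun l => add_le_add (h1 l) <| sum_le_card_mul fun i =>
        add_le_add (h2 l i) <| sum_le_card_mul (h3 l i)
    have e2 : ∑ i, (N (D i σ.ψ) + ∑ j, (N (D j (D i σ.ψ)) + ∑ k, N (D k (D j (D i σ.ψ))))) ≤
        3 * (√R + 3 * (√R + 3 * √R)) :=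
      sum_le_card_mul fun l => add_le_add (h4 l) <| sum_le_card_mul fun i =>
        add_le_add (h5 l i) <| sum_le_card_mul (h6 l i)
    unfold A normA
    linarith [Real.sqrt_nonneg R]
  calc σ.A ^ 2 ≤ (159 * √R) ^ 2 := pow_le_pow_left₀ σ.A_nonneg hA 2
    _ = 159 ^ 2 * R := by rw [mul_pow, Real.sq_sqrt (by linarith)]

end St

/-! ### Crude bounds -/

namespace St

open Temp

/-- `L²` norm bounded by `1 + E`. -/
def C2 (F : St → Temp) : Prop := (∀ σ, Sc (F σ)) ∧ ∃ K, 0 ≤ K ∧ ∀ σ, N (F σ) ≤ K * (1 + σ.E)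

/-- `L¹` norm bounded by `1 + E ^ 2`. -/
def C1 (F : St → Temp) : Prop := (∀ σ, Sc (F σ)) ∧ ∃ K, 0 ≤ K ∧ ∀ σ, L1 (F σ) ≤ K * (1 + σ.E ^ 2)

variable {F F' : St → Temp} {m n : ℕ}

theorem O2.crude (h : O2 F m n) (hn : n ≤ 1) : C2 F := by
  obtain ⟨hS, K, hK, h⟩ := h
  refine ⟨hS, K, hK, fun σ => (h σ).trans (mul_le_mul_of_nonneg_left
    ((W_anti (Nat.zero_le m) n σ).trans ?_) hK)⟩
  have := σ.E_nonneg
  simp only [W, pow_zero, one_mul]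
  interval_cases n <;> linarith

theorem O1.crude (h : O1 F m n) (hn : n ≤ 2) : C1 F := by
  obtain ⟨hS, K, hK, h⟩ := h
  exact ⟨hS, K, hK, fun σ => (h σ).trans (mul_le_mul_of_nonneg_left (W_le hn m σ) hK)⟩

theorem C2.mul (h : C2 F) (h' : C2 F') : C1 fun σ => F σ * F' σ := by
  obtain ⟨hS, K, hK, h⟩ := h
  obtain ⟨hS', K', hK', h'⟩ := h'
  refine ⟨fun σ => inferInstance, K * K' * 2, by positivity, fun σ => ?_⟩
  have hE := σ.E_nonneg
  calc L1 (F σ * F' σ) ≤ N (F σ) * N (F' σ) := L1_mul_le _ _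
    _ ≤ (K * (1 + σ.E)) * (K' * (1 + σ.E)) :=
      mul_le_mul (h σ) (h' σ) (N_nonneg _) (by positivity)
    _ = K * K' * (1 + σ.E) ^ 2 := by ring
    _ ≤ K * K' * (2 * (1 + σ.E ^ 2)) :=
      mul_le_mul_of_nonneg_left (by nlinarith [sq_nonneg (σ.E - 1)]) (by positivity)
    _ = K * K' * 2 * (1 + σ.E ^ 2) := by ring

theorem OB.mulC1 (h : OB F 0 0) (h' : C1 F') : C1 fun σ => F σ * F' σ := by
  obtain ⟨K, hK, h⟩ := h
  obtain ⟨hS', K', hK', h'⟩ := h'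
  refine ⟨fun σ => inferInstance, K * K', by positivity, fun σ => ?_⟩
  have h := h σ
  simp only [W, pow_zero, mul_one] at h
  refine h.L1_mul.trans ((mul_le_mul_of_nonneg_left (h' σ) hK).trans_eq (by ring))

theorem C1.add (h : C1 F) (h' : C1 F') : C1 fun σ => F σ + F' σ := by
  obtain ⟨hS, K, hK, h⟩ := h
  obtain ⟨hS', K', hK', h'⟩ := h'
  exact ⟨fun σ => inferInstance, K + K', by positivity, fun σ =>
    (L1_add _ _).trans ((add_le_add (h σ) (h' σ)).trans_eq (by ring))⟩

theorem C1.neg (h : C1 F) : C1 fun σ => -F σ := by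
  obtain ⟨hS, K, hK, h⟩ := h
  exact ⟨fun σ => inferInstance, K, hK, fun σ => (L1_neg _).trans_le (h σ)⟩

theorem C1.sub (h : C1 F) (h' : C1 F') : C1 fun σ => F σ - F' σ := by
  simpa only [sub_eq_add_neg] using h.add h'.neg

theorem C1.sum {ι : Type*} (s : Finset ι) {F : ι → St → Temp} (h : ∀ i ∈ s, C1 (F i)) :
    C1 fun σ => ∑ i ∈ s, F i σ := by
  classical
  induction s using Finset.induction_on with
  | empty =>
    simp only [Finset.sum_empty]
    exact O1.crude (m := 0) (n := 0) .zero (by norm_num)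
  | insert a s ha ih =>
    simp only [Finset.sum_insert ha]
    exact (h a (by simp)).add (ih fun i hi => h i (by simp [hi]))

theorem C2.add (h : C2 F) (h' : C2 F') : C2 fun σ => F σ + F' σ := by
  obtain ⟨hS, K, hK, h⟩ := h
  obtain ⟨hS', K', hK', h'⟩ := h'
  exact ⟨fun σ => inferInstance, K + K', by positivity, fun σ =>
    (N_add _ _).trans ((add_le_add (h σ) (h' σ)).trans_eq (by ring))⟩

theorem C2.neg (h : C2 F) : C2 fun σ => -F σ := by
  obtain ⟨hS, K, hK, h⟩ := h
  exact ⟨fun σ => inferInstance, K, hK, fun σ => (N_neg _).trans_le (h σ)⟩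

theorem C2.sub (h : C2 F) (h' : C2 F') : C2 fun σ => F σ - F' σ := by
  simpa only [sub_eq_add_neg] using h.add h'.neg

theorem C2_of_add_grad {U : Fin 3 → St → Temp} {R : St → Temp} [∀ l σ, Sc (U l σ)]
    [∀ σ, Sc (R σ)] (hd : ∀ σ, ∑ l, D l (U l σ) = 0)
    (h : ∀ l, C2 fun σ => U l σ + D l (R σ)) (l : Fin 3) : C2 (U l) := by
  choose _ K hK h using h
  refine ⟨inferInstance, ∑ l, K l, Finset.sum_nonneg fun l _ => hK l, fun σ => ?_⟩
  have h1 : ∀ l, 0 ≤ N (U l σ + D l (R σ)) := fun _ => N_nonneg _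
  have h2 : N (U l σ) ≤ ∑ l, N (U l σ + D l (R σ)) := by
    refine Real.sqrt_le_iff.2 ⟨Finset.sum_nonneg fun l _ => h1 l, ?_⟩
    refine (le_sum3 (f := fun l => Q (U l σ)) (fun _ => Q_nonneg _) l).trans
      ((sum_Q_le_of_add_grad (hd σ) (R σ)).trans ?_)
    simp only [← N_sq, Fin.sum_univ_three]
    nlinarith [mul_nonneg (h1 0) (h1 1), mul_nonneg (h1 0) (h1 2), mul_nonneg (h1 1) (h1 2)]
  refine h2.trans ?_
  rw [Finset.sum_mul]
  exact Finset.sum_le_sum fun l _ => h l σ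

theorem C2_u (l : Fin 3) : C2 fun σ => σ.u l := by
  refine C2_of_add_grad (U := fun l σ => σ.u l) (R := fun σ => σ.P) sum_D_u (fun l => ?_) l
  simp only [u, sub_add_cancel, accel]
  refine ((E2_Lapv l).crude le_rfl |>.sub ?_).sub ((O2_force l).crude le_rfl)
  split_ifs
  · exact O2_Lapψ.crude (by norm_num)
  · exact O2.crude (m := 0) (n := 0) .zero (by norm_num)

theorem C2_Du (k l : Fin 3) : C2 fun σ => D k (σ.u l) := by
  refine C2_of_add_grad (U := fun l σ => D k (σ.u l)) (R := fun σ => D k σ.P)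
    (fun σ => div_D σ.sum_D_u k) (fun l => ?_) l
  simp only [D_u, sub_add_cancel]
  refine ((E2_DLapv k l).crude le_rfl |>.sub ?_).sub ((O2_Dforce k l).crude le_rfl)
  split_ifs
  · exact (OH_Lapψ.2 k).crude (by norm_num)
  · exact O2.crude (m := 0) (n := 0) .zero (by norm_num)

theorem C2_Dη (k : Fin 3) : C2 fun σ => D k σ.η := by
  simp only [η, map_neg, map_add]
  exact ((O2_Dadv k).crude le_rfl |>.add ((E2_Dv k 2).crude le_rfl)).neg

theorem C2_DDη (i k : Fin 3) : C2 fun σ => D i (D k σ.η) := by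
  have h : O2 (fun σ => D i (D k σ.adv)) 1 1 := by
    simp only [adv, map_sum, D_mul, map_add]
    refine .sum _ fun m _ => ((.add ?_ ?_ : O2 _ 1 1)).add (.add ?_ ?_)
    · exact ((OB_Dψ _).mul2 (E2_DDv _ _ _)).congr fun _ => mul_comm _ _
    · exact (EB_Dv _ _).mul2 (O2_DDψ _ _)
    · exact (EB_Dv _ _).mul2 (O2_DDψ _ _)
    · exact (EB_v _).mul2 (O2_DDDψ _ _ _)
  simp only [η, map_neg, map_add]
  exact (h.crude le_rfl |>.add ((E2_DDv i k 2).crude le_rfl)).neg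

theorem C2_solη (l : Fin 3) : C2 fun σ => sol σ.η l := by
  fin_cases l
  · exact (C2_DDη 0 2).neg
  · exact (C2_DDη 1 2).neg
  · exact (C2_DDη 0 0).add (C2_DDη 1 1)

theorem OB_b6 : OB (fun σ => σ.b ^ 6 - 1) 0 0 := by
  simpa only [sub_eq_add_neg] using (OB_b_pow 6).add OB.one.neg

theorem O2_sol (l : Fin 3) : O2 (fun σ => sol σ.ψ l) 1 0 := by
  fin_cases l
  · exact (O2_DDψ 0 2).neg
  · exact (O2_DDψ 1 2).neg
  · exact (O2_DDψ 0 0).add (O2_DDψ 1 1)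

theorem O1_top : O1 top 2 0 :=
  (O1.sum _ fun _ _ => .sum _ fun _ _ => .sum _ fun _ _ => (O2_DDDψ _ _ _).mul (O2_DDDψ _ _ _)).add
    (OB_b6.mul1 ((O2_DDDψ _ _ _).mul (O2_DDDψ _ _ _)))

theorem C1_rem : C1 rem := by
  have q := O2_DDDψ 2 2 2
  refine C1.sub (C1.add ?_ ?_) ?_
  · exact ((OB.ofNat 2).mul1 (O1.sum _ fun _ _ => .sum _ fun _ _ => .sum _ fun _ _ =>
      (O2_DDDψ _ _ _).mul (O2_comm _ _ _))).neg.crude (by norm_num)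
  · have h : OB (fun σ => ∑ m, D 2 (σ.v m) * D m σ.ψ + D 2 (σ.v 2)) 0 1 := by
      simp only [Fin.sum_univ_three]
      have h1 := fun m => ((EB_Dv 2 m).mul (OB_Dψ m)).anti (Nat.zero_le _)
      exact (((h1 0).add (h1 1)).add (h1 2)).add (EB_Dv 2 2)
    have h2 := (OB.ofNat 6).mul1 (((OB_b_pow 7).mul h).mul1 (q.mul q))
    exact (h2.congr fun σ => by rw [sq]).crude (by norm_num)
  · have h1 : C2 fun σ => (σ.b ^ 6 - 1) * D 2 (D 2 (D 2 σ.ψ)) := (OB_b6.mul2 q).crude (by norm_num)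
    exact (OB.ofNat 2).mulC1 (h1.mul (((O2_comm 2 2 2).crude le_rfl).add
      ((E2_DDDv 2 2 2 2).crude le_rfl)))

theorem C1_prod : C1 prod := by
  have v := fun l => (O2_v l).crude (Nat.zero_le _)
  have s := fun l => (E2_sol l).crude le_rfl
  refine .sub (.add (.add (.add (.sub ?_ ?_) ?_) ?_) ?_) ?_
  · exact (OB.ofNat 8).mulC1 (.add (.sum _ fun l _ => (v l).mul (C2_u l))
      (.sum _ fun l _ => ((O2_Dψ l).crude (Nat.zero_le _)).mul (C2_Dη l)))
  · refine (OB.ofNat 8).mulC1 (.sum _ fun j _ => .sum _ fun l _ => ?_)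
    simp only [← D_Lap]
    exact ((E2_DLapv j l).crude le_rfl).mul (C2_Du j l)
  · refine (OB.ofNat 4).mulC1 (C1_rem.sub ((OB.ofNat 2).mulC1 ?_))
    exact .sum _ fun _ _ => .sum _ fun _ _ => .sum _ fun _ _ =>
      ((O2_DDDψ _ _ _).crude (Nat.zero_le _)).mul ((E2_DDDv _ _ _ _).crude le_rfl)
  · exact (OB.ofNat 2).mulC1 (.add (.sum _ fun l _ => (s l).mul (C2_u l))
      (.sum _ fun l _ => (v l).mul (C2_solη l)))
  · exact (OB.ofNat 2).mulC1 (.sum _ fun j _ => .sum _ fun l _ =>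
      ((E2_Dsol j l).crude le_rfl).mul (C2_Du j l))
  · exact (OB.ofNat 2).mulC1 (.sum _ fun l _ => ((E2_Lapv l).crude le_rfl).mul (C2_solη l))

theorem C1_flux (i : Fin 3) : C1 (flux i) := by
  refine .sub (.sub ?_ ?_) ?_
  · exact (OB.ofNat 8).mulC1 (.sum _ fun l _ => .sum _ fun j _ =>
      ((E2_DDv i j l).crude le_rfl).mul (C2_Du j l))
  · exact (OB.ofNat 4).mulC1 (((OB_v i).mul1 O1_top).crude (by norm_num))
  · exact (OB.ofNat 2).mulC1 (.sum _ fun l _ => ((E2_sol l).crude le_rfl).mul (C2_Du i l))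

theorem exists_I_en_le : ∃ K, 0 ≤ K ∧ ∀ σ : St, I σ.en ≤ K * σ.A ^ 2 := by
  have h : O1 en 2 0 := by
    refine .sub (.add (.add (.add ?_ ?_) ?_) ?_) ?_
    · exact (OB.ofNat 4).mul1 (.add (.sum _ fun l _ => (O2_v l).mul (O2_v l))
        (.sum _ fun l _ => (O2_Dψ l).mul (O2_Dψ l)))
    · exact (OB.ofNat 4).mul1 (.sum _ fun _ _ => .sum _ fun _ _ => .sum _ fun _ _ =>
        (O2_DDv _ _ _).mul (O2_DDv _ _ _))
    · exact (OB.ofNat 4).mul1 O1_top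
    · exact (OB.ofNat 2).mul1 (.sum _ fun l _ => (O2_sol l).mul (O2_v l))
    · exact (OB.ofNat 2).mul1 (.sum _ fun l _ => (O2_sol l).mul
        (.sum _ fun _ _ => O2_DDv _ _ _))
  obtain ⟨K, hK, h⟩ := h.abs_I_le
  refine ⟨K, hK, fun σ => (le_abs_self _).trans ((h σ).trans_eq (by simp [W]))⟩

theorem exists_I_prod_le : ∃ c K, 0 < c ∧ 0 ≤ K ∧ ∀ σ : St,
    I σ.prod ≤ -(c * σ.E ^ 2) + K * (σ.A * σ.E ^ 2) := by
  obtain ⟨K, hK, h⟩ := exists_prod_le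
  refine ⟨1 / 141 ^ 2, K, by norm_num, hK, fun σ => (h σ).trans ?_⟩
  have := σ.E_sq_le
  simp only [W, pow_one]
  unfold Z at this
  linarith

end St

/-! ### Time dependent families -/

namespace Temp

/-- Joint smoothness on `[0, T] × ℝ³`. -/
def SM (T : ℝ) (F : ℝ → Temp) : Prop := SmoothOn2 (Icc 0 T) fun t => (F t).1

/-- `F'` is the time derivative of `F`, both being jointly smooth. -/
structure TD (T : ℝ) (F F' : ℝ → Temp) : Prop where
  sm : SM T F
  sm' : SM T F'
  hasDerivAt : ∀ t ∈ Ioo 0 T, ∀ x, HasDerivAt (fun τ => F τ x) (F' t x) t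

variable {T : ℝ} {F F' G G' : ℝ → Temp}

theorem SM.add (hF : SM T F) (hG : SM T G) : SM T fun t => F t + G t := ContDiffOn.add hF hG
theorem SM.sub (hF : SM T F) (hG : SM T G) : SM T fun t => F t - G t := ContDiffOn.sub hF hG
theorem SM.mul (hF : SM T F) (hG : SM T G) : SM T fun t => F t * G t := ContDiffOn.mul hF hG
theorem SM.neg (hF : SM T F) : SM T fun t => -F t := ContDiffOn.neg hF
theorem SM.const (f : Temp) : SM T fun _ => f :=
  (f.contDiff.comp contDiff_snd).contDiffOn

theorem SM.sum {ι : Type*} (s : Finset ι) {F : ι → ℝ → Temp} (h : ∀ i ∈ s, SM T (F i)) :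
    SM T fun t => ∑ i ∈ s, F i t := by
  unfold SM SmoothOn2
  simp only [sum_apply]
  exact ContDiffOn.sum h

theorem SM.congr (h : SM T F) (e : ∀ t ∈ Icc 0 T, F t = G t) : SM T G :=
  ContDiffOn.congr h fun q hq => by simp only [e q.1 hq.1]

theorem SM.continuousOn (h : SM T F) :
    ContinuousOn (fun q : ℝ × Pt => F q.1 q.2) (Icc 0 T ×ˢ univ) := ContDiffOn.continuousOn h

theorem uniqueDiffOn_strip (hT : 0 < T) : UniqueDiffOn ℝ (Icc 0 T ×ˢ (univ : Set Pt)) :=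
  (uniqueDiffOn_Icc hT).prod uniqueDiffOn_univ

theorem D_eq_fderivWithin (hF : SM T F) (i : Fin 3) {t : ℝ} (ht : t ∈ Icc 0 T) (x : Pt) :
    D i (F t) x = fderivWithin ℝ (fun q : ℝ × Pt => F q.1 q.2) (Icc 0 T ×ˢ univ) (t, x)
      (0, Pi.single i 1) := by
  have h1 := ((hF.differentiableOn (by simp)) (t, x) ⟨ht, mem_univ _⟩).hasFDerivWithinAt
  have h2 : HasFDerivWithinAt (fun y : Pt => (t, y)) (ContinuousLinearMap.inr ℝ ℝ Pt) univ x :=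
    (hasFDerivAt_prodMk_right t x).hasFDerivWithinAt
  have h3 := h1.comp x h2 fun y _ => ⟨ht, mem_univ _⟩
  rw [hasFDerivWithinAt_univ] at h3
  change fderiv ℝ (F t).1 x _ = _
  rw [show fderiv ℝ (F t).1 x = _ from h3.fderiv]
  simp

theorem SM.D (hT : 0 < T) (hF : SM T F) (i : Fin 3) : SM T fun t => D i (F t) := by
  have h : ContDiffOn ℝ (⊤ : ℕ∞) (fun q => fderivWithin ℝ (fun q : ℝ × Pt => F q.1 q.2)
      (Icc 0 T ×ˢ univ) q ((0 : ℝ), (Pi.single i 1 : Pt))) (Icc 0 T ×ˢ univ) :=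
    (ContDiffOn.fderivWithin hF (uniqueDiffOn_strip hT) (by simp)).clm_apply contDiffOn_const
  exact h.congr fun q hq => D_eq_fderivWithin hF i hq.1 q.2

theorem SM.inv (hF : SM T F) (h : ∀ t ∈ Icc 0 T, ∀ x, F t x ≠ 0)
    (e : ∀ t ∈ Icc 0 T, ∀ x, G t x = (F t x)⁻¹) : SM T G :=
  (ContDiffOn.inv hF fun q hq => h q.1 hq.1 q.2).congr fun q hq => e q.1 hq.1 q.2

theorem TD.add (h : TD T F F') (h' : TD T G G') : TD T (fun t => F t + G t) fun t => F' t + G' t :=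
  ⟨h.sm.add h'.sm, h.sm'.add h'.sm', fun t ht x => (h.hasDerivAt t ht x).add (h'.hasDerivAt t ht x)⟩

theorem TD.neg (h : TD T F F') : TD T (fun t => -F t) fun t => -F' t :=
  ⟨h.sm.neg, h.sm'.neg, fun t ht x => (h.hasDerivAt t ht x).neg⟩

theorem TD.sub (h : TD T F F') (h' : TD T G G') : TD T (fun t => F t - G t) fun t => F' t - G' t :=
  ⟨h.sm.sub h'.sm, h.sm'.sub h'.sm', fun t ht x => (h.hasDerivAt t ht x).sub (h'.hasDerivAt t ht x)⟩

theorem TD.mul (h : TD T F F') (h' : TD T G G') :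
    TD T (fun t => F t * G t) fun t => F' t * G t + F t * G' t :=
  ⟨h.sm.mul h'.sm, (h.sm'.mul h'.sm).add (h.sm.mul h'.sm'),
    fun t ht x => (h.hasDerivAt t ht x).mul (h'.hasDerivAt t ht x)⟩

theorem TD.const (f : Temp) : TD T (fun _ => f) fun _ => 0 :=
  ⟨.const f, .const 0, fun t _ x => hasDerivAt_const t (f x)⟩

theorem TD.congr (h : TD T F F') (e : ∀ t, F' t = G' t) : TD T F G' :=
  (funext e : F' = G') ▸ h

theorem TD.const_mul (f : Temp) (h : TD T F F') : TD T (fun t => f * F t) fun t => f * F' t :=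
  ((TD.const f).mul h).congr fun t => by rw [zero_mul, zero_add]

theorem TD.sum {ι : Type*} (s : Finset ι) {F F' : ι → ℝ → Temp} (h : ∀ i, TD T (F i) (F' i)) :
    TD T (fun t => ∑ i ∈ s, F i t) fun t => ∑ i ∈ s, F' i t := by
  refine ⟨.sum _ fun i _ => (h i).sm, .sum _ fun i _ => (h i).sm', fun t ht x => ?_⟩
  simp only [sum_apply]
  exact HasDerivAt.fun_sum fun i _ => (h i).hasDerivAt t ht x

theorem TD.pow (h : TD T F F') (n : ℕ) :
    TD T (fun t => F t ^ (n + 1)) fun t => (n + 1) * (F t ^ n * F' t) := by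
  induction n with
  | zero => simpa using h
  | succ n ih =>
    simp only [pow_succ (F _) (n + 1)]
    exact (ih.mul h).congr fun t => by push_cast; ring

theorem hasDerivAt_fderiv_snd {f : ℝ × Pt → ℝ} {t : ℝ} {x : Pt}
    (hc : ContDiffAt ℝ (⊤ : ℕ∞) f (t, x)) (w : Pt) :
    HasDerivAt (fun s => fderiv ℝ f (s, x) (0, w))
      (fderiv ℝ (fun y => fderiv ℝ f (t, y) (1, 0)) x w) t := by
  have h3 : HasFDerivAt (fderiv ℝ f) (fderiv ℝ (fderiv ℝ f) (t, x)) (t, x) :=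
    ((hc.fderiv_right (m := (⊤ : ℕ∞)) (by simp)).differentiableAt (by simp)).hasFDerivAt
  have hsymm : IsSymmSndFDerivAt ℝ f (t, x) := hc.isSymmSndFDerivAt (by
    rw [minSmoothness_of_isRCLikeNormedField]; exact WithTop.coe_le_coe.2 le_top)
  set L := fderiv ℝ (fderiv ℝ f) (t, x) with hL
  have d1 : HasDerivAt (fun s : ℝ => (s, x)) ((1 : ℝ), (0 : Pt)) t :=
    (hasDerivAt_id t).prodMk (hasDerivAt_const t x)
  have e3 : HasDerivAt (fun s => fderiv ℝ f (s, x) (0, w)) (L (1, 0) (0, w)) t := by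
    have e : HasDerivAt (fun s => fderiv ℝ f (s, x)) (L (1, 0)) t := h3.comp_hasDerivAt t d1
    exact (ContinuousLinearMap.apply ℝ ℝ ((0 : ℝ), w)).hasFDerivAt.comp_hasDerivAt t e
  have e4 : HasFDerivAt (fun y => fderiv ℝ f (t, y) (1, 0))
      ((ContinuousLinearMap.apply ℝ ℝ ((1 : ℝ), (0 : Pt))).comp
        (L.comp (ContinuousLinearMap.inr ℝ ℝ Pt))) x := by
    have e : HasFDerivAt (fun y => fderiv ℝ f (t, y)) (L.comp (ContinuousLinearMap.inr ℝ ℝ Pt)) x :=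
      h3.comp x (hasFDerivAt_prodMk_right t x)
    exact (ContinuousLinearMap.apply ℝ ℝ ((1 : ℝ), (0 : Pt))).hasFDerivAt.comp x e
  rw [e4.fderiv]
  exact e3.congr_deriv (hsymm.eq _ _)

theorem TD.D (hT : 0 < T) (h : TD T F F') (i : Fin 3) : TD T (fun t => D i (F t)) fun t => D i (F' t) := by
  refine ⟨h.sm.D hT i, h.sm'.D hT i, fun t ht x => ?_⟩
  set f : ℝ × Pt → ℝ := fun q => F q.1 q.2 with hf
  have hU : IsOpen (Ioo 0 T ×ˢ (univ : Set Pt)) := isOpen_Ioo.prod isOpen_univ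
  have hsub : Ioo 0 T ×ˢ (univ : Set Pt) ⊆ Icc 0 T ×ˢ univ := prod_mono Ioo_subset_Icc_self subset_rfl
  have hn : ∀ {s y}, s ∈ Ioo 0 T → Icc 0 T ×ˢ (univ : Set Pt) ∈ 𝓝 (s, y) := fun hs =>
    mem_of_superset (hU.mem_nhds ⟨hs, mem_univ _⟩) hsub
  have hc : ∀ {s y}, s ∈ Ioo 0 T → ContDiffAt ℝ (⊤ : ℕ∞) f (s, y) := fun hs =>
    ContDiffOn.contDiffAt h.sm (hn hs)
  have h1 : ∀ s ∈ Ioo 0 T, ∀ y, Temp.D i (F s) y = fderiv ℝ f (s, y) (0, Pi.single i 1) := fun s hs y => by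
    rw [D_eq_fderivWithin h.sm i (Ioo_subset_Icc_self hs), fderivWithin_of_mem_nhds (hn hs)]
  have h2 : ∀ s ∈ Ioo 0 T, ∀ y, F' s y = fderiv ℝ f (s, y) (1, 0) := fun s hs y => by
    have e1 := ((hc (y := y) hs).differentiableAt (by simp)).hasFDerivAt
    have e2 := e1.comp_hasDerivAt s ((hasDerivAt_id s).prodMk (hasDerivAt_const s y))
    exact (h.hasDerivAt s hs y).unique e2
  have e3 := hasDerivAt_fderiv_snd (hc (y := x) ht) (Pi.single i 1)
  rw [← show (F' t).1 = fun y => fderiv ℝ f (t, y) (1, 0) from funext (h2 t ht)] at e3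
  refine e3.congr_of_eventuallyEq ?_
  filter_upwards [isOpen_Ioo.mem_nhds ht] with s hs using h1 s hs x

end Temp

/-! ### Integrated balance laws -/

namespace Temp

variable {T : ℝ} {F F' : ℝ → Temp} {χ : Temp}

theorem SM.continuousOn_I_mul (hc : HasCompactSupport χ.1) (h : SM T F) :
    ContinuousOn (fun t => I (χ * F t)) (Icc 0 T) := by
  refine continuousOn_integral_of_compact_support (f := fun t x => (χ * F t) x) hc
    ((χ.continuous.comp continuous_snd).continuousOn.mul h.continuousOn) fun t x _ hx => ?_
  simp [image_eq_zero_of_notMem_tsupport hx]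

theorem SM.exists_bound (hc : HasCompactSupport χ.1) (h : SM T F) :
    ∃ M, ∀ t ∈ Icc 0 T, ∀ x, |(χ * F t) x| ≤ M * |χ x| := by
  obtain ⟨M, hM⟩ := (isCompact_Icc.prod hc).exists_bound_of_continuousOn
    (h.continuousOn.mono (prod_mono subset_rfl (subset_univ (tsupport χ.1))))
  refine ⟨M, fun t ht x => ?_⟩
  by_cases hx : x ∈ tsupport χ.1
  · rw [mul_apply, abs_mul, mul_comm]
    exact mul_le_mul_of_nonneg_right (hM (t, x) ⟨ht, hx⟩) (abs_nonneg _)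
  · simp [image_eq_zero_of_notMem_tsupport hx]

theorem TD.hasDerivAt_I_mul [Sc χ] (hc : HasCompactSupport χ.1) (h : TD T F F') {t : ℝ}
    (ht : t ∈ Ioo 0 T) : HasDerivAt (fun s => I (χ * F s)) (I (χ * F' t)) t := by
  obtain ⟨M, hM⟩ := h.sm'.exists_bound hc
  refine (hasDerivAt_integral_of_dominated_loc_of_deriv_le (μ := volume)
    (F := fun s x => (χ * F s) x) (F' := fun s x => (χ * F' s) x) (bound := fun x => M * |χ x|)
    (isOpen_Ioo.mem_nhds ht) (Eventually.of_forall fun s => (integrable (χ * F s)).1)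
    (integrable (χ * F t)) (integrable (χ * F' t)).1
    (Eventually.of_forall fun x s hs => hM s (Ioo_subset_Icc_self hs) x)
    ((integrable χ).abs.const_mul M) (Eventually.of_forall fun x s hs => ?_)).2
  exact (h.hasDerivAt s hs x).const_mul (χ x)

theorem TD.integral_I_mul [Sc χ] (hc : HasCompactSupport χ.1) (h : TD T F F') {b : ℝ}
    (hb : b ∈ Icc 0 T) : ∫ t in (0 : ℝ)..b, I (χ * F' t) = I (χ * F b) - I (χ * F 0) := by
  have hs : Icc 0 b ⊆ Icc 0 T := Icc_subset_Icc_right hb.2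
  refine intervalIntegral.integral_eq_sub_of_hasDerivAt_of_le hb.1
    ((h.sm.continuousOn_I_mul hc).mono hs)
    (fun t ht => h.hasDerivAt_I_mul hc (Ioo_subset_Ioo_right hb.2 ht)) ?_
  refine ContinuousOn.intervalIntegrable ?_
  rw [uIcc_of_le hb.1]
  exact (h.sm'.continuousOn_I_mul hc).mono hs

theorem tendsto_I_mul {χ : ℕ → Temp} (h1 : ∀ n, Bd (χ n) 1)
    (hχ : ∀ x, Tendsto (fun n => χ n x) atTop (𝓝 1)) (f : Temp) [Sc f] :
    Tendsto (fun n => I (χ n * f)) atTop (𝓝 (I f)) := by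
  refine tendsto_integral_of_dominated_convergence (fun x => |f x|)
    (fun n => (integrable (χ n * f)).1) (integrable f).abs
    (fun n => Eventually.of_forall fun x => ?_) (Eventually.of_forall fun x => ?_)
  · rw [mul_apply, Real.norm_eq_abs, abs_mul]
    exact mul_le_of_le_one_left (abs_nonneg _) (h1 n x)
  · simpa using (hχ x).mul_const (f x)

/-- A balance law `∂ₜ F = g + div Φ` integrates over space and time. -/
theorem TD.integral_balance [∀ t, Sc (F t)] {g : ℝ → Temp} {Φ : Fin 3 → ℝ → Temp}
    [∀ t, Sc (g t)] [∀ i t, Sc (Φ i t)] (h : TD T F fun t => g t + ∑ i, Temp.D i (Φ i t)) {R : ℝ → ℝ}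
    (hR : IntervalIntegrable R volume 0 T) (hg : ∀ t ∈ Icc 0 T, L1 (g t) ≤ R t)
    (hΦ : ∀ i, ∀ t ∈ Icc 0 T, L1 (Φ i t) ≤ R t) {b : ℝ} (hb : b ∈ Icc 0 T) :
    IntervalIntegrable (fun t => I (g t)) volume 0 b ∧
      ∫ t in (0 : ℝ)..b, I (g t) = I (F b) - I (F 0) := by
  obtain ⟨c, χ, hc, hSc, hcs, h1, hD, hχ⟩ := exists_cutoff
  have hs : Icc 0 b ⊆ Icc 0 T := Icc_subset_Icc_right hb.2
  have hsI : uIoc 0 b ⊆ Icc 0 T := by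
    rw [uIoc_of_le hb.1]; exact Ioc_subset_Icc_self.trans hs
  have hRb : IntervalIntegrable R volume 0 b := hR.mono_set (by
    rw [uIcc_of_le hb.1, uIcc_of_le (hb.1.trans hb.2)]; exact hs)
  set e : ℕ → ℝ → ℝ := fun n t => I (χ n * (g t + ∑ i, Temp.D i (Φ i t))) with he
  have e1 : ∀ n t, e n t = I (χ n * g t) - ∑ i, I (Temp.D i (χ n) * Φ i t) := fun n t => by
    simp only [he, mul_add, Finset.mul_sum]
    rw [I_add, I_sum, sub_eq_add_neg, ← Finset.sum_neg_distrib]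
    exact congrArg _ (Finset.sum_congr rfl fun i _ => I_parts i _ _)
  have hflux : ∀ n, ∀ t ∈ Icc 0 T, ∀ i, |I (Temp.D i (χ n) * Φ i t)| ≤ c / (n + 1) * R t :=
    fun n t ht i => (abs_I_le _).trans (((hD n i).L1_mul).trans
      (mul_le_mul_of_nonneg_left (hΦ i t ht) (by positivity)))
  have hmeas : ∀ n, AEStronglyMeasurable (e n) (volume.restrict (uIoc 0 b)) := fun n =>
    ((h.sm'.continuousOn_I_mul (hcs n)).mono hsI).aestronglyMeasurable measurableSet_uIoc
  have hlim : ∀ t ∈ Icc 0 T, Tendsto (fun n => e n t) atTop (𝓝 (I (g t))) := fun t ht => by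
    simp only [e1]
    rw [← sub_zero (I (g t))]
    refine (tendsto_I_mul h1 hχ (g t)).sub ?_
    rw [← Finset.sum_const_zero (s := (Finset.univ : Finset (Fin 3)))]
    refine tendsto_finsetSum _ fun i _ => squeeze_zero_norm (hflux · t ht i) ?_
    have := (tendsto_one_div_add_atTop_nhds_zero_nat (𝕜 := ℝ)).const_mul (c * R t)
    rw [mul_zero] at this
    exact this.congr fun n => by ring
  have hbound : ∀ n, ∀ t ∈ Icc 0 T, |e n t| ≤ (1 + 3 * c) * R t := fun n t ht => by
    have hR0 : 0 ≤ R t := (L1_nonneg _).trans (hg t ht)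
    rw [e1]
    refine (abs_sub _ _).trans ?_
    have a1 : |I (χ n * g t)| ≤ R t :=
      (abs_I_le _).trans ((h1 n).L1_mul.trans (by rw [one_mul]; exact hg t ht))
    have a2 : |∑ i, I (Temp.D i (χ n) * Φ i t)| ≤ ∑ _i : Fin 3, c * R t :=
      (Finset.abs_sum_le_sum_abs _ _).trans (Finset.sum_le_sum fun i _ => (hflux n t ht i).trans
        (mul_le_mul_of_nonneg_right (div_le_self hc (by linarith [n.cast_nonneg (α := ℝ)])) hR0))
    simp only [Finset.sum_const, Finset.card_univ, Fintype.card_fin, nsmul_eq_mul] at a2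
    push_cast at a2
    linarith
  have hRK : IntervalIntegrable (fun t => (1 + 3 * c) * R t) volume 0 b := hRb.const_mul _
  refine ⟨?_, ?_⟩
  · refine hRK.mono_fun (aestronglyMeasurable_of_tendsto_ae atTop hmeas ?_) ?_
    · exact (ae_restrict_iff' measurableSet_uIoc).2 (.of_forall fun t ht => hlim t (hsI ht))
    · refine (ae_restrict_iff' measurableSet_uIoc).2 (.of_forall fun t ht => ?_)
      have hR0 : 0 ≤ R t := (L1_nonneg _).trans (hg t (hsI ht))
      simp only [Real.norm_eq_abs]
      refine ((abs_I_le _).trans (hg t (hsI ht))).trans (le_trans ?_ (le_abs_self _))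
      nlinarith
  · refine tendsto_nhds_unique (f := fun n => ∫ t in (0 : ℝ)..b, e n t) ?_ (l := atTop) ?_
    · exact intervalIntegral.tendsto_integral_filter_of_dominated_convergence _
        (.of_forall hmeas) (.of_forall fun n => .of_forall fun t ht => hbound n t (hsI ht)) hRK
        (.of_forall fun t ht => hlim t (hsI ht))
    · simp only [he, h.integral_I_mul (hcs _) hb]
      exact (tendsto_I_mul h1 hχ _).sub (tendsto_I_mul h1 hχ _)

end Temp

/-! ### Trajectories -/

namespace Temp

/-- A Schwartz function as a function of temperate growth. -/
def ofSchwartz {f : Pt → ℝ} (hf : IsSchwartz f) : Temp :=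
  ⟨f, SchwartzMap.hasTemperateGrowth (⟨f, hf.1, hf.2⟩ : SchwartzMap Pt ℝ)⟩

theorem sc_ofSchwartz {f : Pt → ℝ} (hf : IsSchwartz f) : Sc (ofSchwartz hf) :=
  ⟨⟨f, hf.1, hf.2⟩, rfl⟩

variable {T : ℝ} {F F' : ℝ → Temp}

theorem TD.mul_self (h : TD T F F') : TD T (fun t => F t * F t) fun t => 2 * (F t * F' t) :=
  (h.mul h).congr fun _ => by ring

theorem TD.Lap (hT : 0 < T) (h : TD T F F') : TD T (fun t => Lap (F t)) fun t => Lap (F' t) :=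
  .sum _ fun i => (h.D hT i).D hT i

theorem TD.sol (hT : 0 < T) (h : TD T F F') (l : Fin 3) :
    TD T (fun t => sol (F t) l) fun t => sol (F' t) l := by
  fin_cases l
  · exact ((h.D hT _).D hT _).neg
  · exact ((h.D hT _).D hT _).neg
  · exact ((h.D hT _).D hT _).add ((h.D hT _).D hT _)

theorem SM.hasDerivAt {f : ℝ → Pt → ℝ} (hf : SmoothOn2 (Icc 0 T) f) {t : ℝ} (ht : t ∈ Ioo 0 T)
    (x : Pt) : HasDerivAt (fun τ => f τ x) (deriv (fun τ => f τ x) t) t := by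
  have hn : Icc 0 T ×ˢ (univ : Set Pt) ∈ 𝓝 (t, x) :=
    prod_mem_nhds (Icc_mem_nhds ht.1 ht.2) univ_mem
  have h := ((ContDiffOn.contDiffAt hf hn).differentiableAt (by simp)).hasFDerivAt
  exact (h.comp_hasDerivAt t ((hasDerivAt_id t).prodMk (hasDerivAt_const t x))).differentiableAt.hasDerivAt

theorem TD.eq_zero (hT : 0 < T) (h : TD T F F') (h0 : ∀ t, F t = 0) {t : ℝ} (ht : t ∈ Icc 0 T) :
    F' t = 0 := by
  ext x
  have hc : ContinuousOn (fun t => F' t x) (Icc 0 T) :=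
    h.sm'.continuousOn.comp (f := fun s => (s, x)) (by fun_prop) fun s hs => ⟨hs, mem_univ _⟩
  refine EqOn.of_subset_closure (s := Ioo 0 T) (g := fun _ => 0) (fun s hs => ?_) hc
    continuousOn_const Ioo_subset_Icc_self (closure_Ioo hT.ne).ge ht
  have := h.hasDerivAt s hs x
  simp only [h0, zero_apply] at this
  exact this.unique (hasDerivAt_const s (0 : ℝ))

end Temp

namespace St

open Temp

variable {T : ℝ} {σ : ℝ → St}

theorem td_b (hT : 0 < T) (h : TD T (fun t => (σ t).ψ) fun t => (σ t).η) :
    TD T (fun t => (σ t).b) fun t => -((σ t).b ^ 2 * D 2 (σ t).η) := by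
  have h1 := (TD.const 1).add (h.D hT 2)
  have h0 : ∀ t x, (1 + D 2 (σ t).ψ) x ≠ 0 := fun t x h => by
    have := congrArg (fun f : Temp => f x) (σ t).hb
    simp only [mul_apply, h, mul_zero, one_apply, zero_ne_one] at this
  have e : ∀ t x, (σ t).b x = ((1 + D 2 (σ t).ψ) x)⁻¹ := fun t x =>
    eq_inv_of_mul_eq_one_left (b_apply (σ t) x)
  have hsm : SM T fun t => (σ t).b := h1.sm.inv (fun t _ => h0 t) fun t _ => e t
  refine ⟨hsm, ((hsm.mul hsm).mul (h.sm'.D hT 2)).neg.congr fun t _ => by ring, fun t ht x => ?_⟩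
  refine (((h1.hasDerivAt t ht x).inv (h0 t x)).congr_of_eventuallyEq
    (.of_forall fun s => e s x)).congr_deriv ?_
  rw [neg_apply, mul_apply, pow_apply, e, Temp.add_apply 0, zero_apply, zero_add, inv_pow, neg_div,
    div_eq_mul_inv, mul_comm]

theorem td_top (hT : 0 < T) (h : TD T (fun t => (σ t).ψ) fun t => (σ t).η) :
    TD T (fun t => (σ t).top) fun t => (σ t).topDot := by
  refine ((TD.sum _ fun i => TD.sum _ fun j => TD.sum _ fun k =>
    (((h.D hT k).D hT j).D hT i).mul_self).add ((((td_b hT h).pow 5).sub (.const 1)).mul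
      (((h.D hT 2).D hT 2).D hT 2).mul_self)).congr fun t => ?_
  simp only [topDot, Finset.mul_sum]
  push_cast
  ring

theorem td_en (hT : 0 < T) (hv : ∀ l, TD T (fun t => (σ t).v l) fun t => (σ t).u l)
    (h : TD T (fun t => (σ t).ψ) fun t => (σ t).η) :
    TD T (fun t => (σ t).en) fun t => (σ t).enDot := by
  refine ((((((TD.sum _ fun l => (hv l).mul_self).add
    (TD.sum _ fun l => (h.D hT l).mul_self)).const_mul 4).add
    ((TD.sum _ fun l => TD.sum _ fun i => TD.sum _ fun j =>
      (((hv l).D hT j).D hT i).mul_self).const_mul 4)).add ((td_top hT h).const_mul 4)).add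
    ((TD.sum _ fun l => (h.sol hT l).mul (hv l)).const_mul 2)).sub
    ((TD.sum _ fun l => (h.sol hT l).mul ((hv l).Lap hT)).const_mul 2) |>.congr fun t => ?_
  simp only [enDot, ← Finset.mul_sum, Finset.sum_add_distrib]
  simp only [mul_comm (sol (σ t).η _)]
  ring

end St

/-! ### Trajectories from solutions -/

namespace Temp

theorem lapl_eq (f : Temp) (x : Pt) : lapl f.1 x = Lap f x := by
  simp only [Lap, sum_apply]; rfl

/-- The total pressure. -/
def totalP (p ψ : Temp) : Temp :=
  p + D 2 ψ + (1 / 2 : ℝ) • (∑ i, D i ψ * D i ψ + D 2 ψ * D 2 ψ)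

theorem sum_D_mul_D (ψ : Temp) (l : Fin 3) : ∑ i, D i (D l ψ * D i ψ) =
    D l ψ * Lap ψ - D 2 ψ * D l (D 2 ψ)
      + D l ((1 / 2 : ℝ) • (∑ i, D i ψ * D i ψ + D 2 ψ * D 2 ψ)) := by
  have h : ∀ f : Temp, D l ((1 / 2 : ℝ) • (f * f)) = f * D l f := fun f => by
    ext x
    rw [(D l).map_smul, D_mul]
    simp only [smul_apply, add_apply, mul_apply]
    ring
  rw [smul_add, Finset.smul_sum, map_add, map_sum]
  simp only [h, D_mul, Lap, Finset.mul_sum, Finset.sum_add_distrib, D_comm l]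
  simp only [mul_comm (D _ ψ) (D _ (D l ψ))]
  ring

theorem accel_sub_eq (v : Fin 3 → Temp) (ψ p : Temp) (l : Fin 3) :
    accel v ψ l - D l (totalP p ψ) = -∑ i, D i (D l ψ * D i ψ) - (∑ i, v i * D i (v l)
      - Lap (v l) + D l p + D l (D 2 ψ) + if l = 2 then Lap ψ else 0) := by
  rw [sum_D_mul_D]
  simp only [accel, force, totalP, map_add (D l) (p + _), map_add (D l) p]
  ring

theorem SM.Lap {T : ℝ} {F : ℝ → Temp} (hT : 0 < T) (h : SM T F) : SM T fun t => Lap (F t) :=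
  .sum _ fun i _ => (h.D hT i).D hT i

end Temp

namespace St

open Temp

theorem exists_trajectory {T : ℝ} (hT : 0 < T) {ψ p : ℝ → Pt → ℝ} {v : Fin 3 → ℝ → Pt → ℝ}
    (hψ : SmoothOn2 (Icc 0 T) ψ) (hp : SmoothOn2 (Icc 0 T) p) (hv : ∀ j, SmoothOn2 (Icc 0 T) (v j))
    (hsch : ∀ t ∈ Icc (0 : ℝ) T, IsSchwartz (ψ t) ∧ IsSchwartz (p t) ∧ ∀ j, IsSchwartz (v j t))
    (hS : SolvesS (Icc 0 T) ψ v p)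
    (hsmall : ∀ t ∈ Icc 0 T, ∀ (V : Fin 3 → Temp) (Ψ : Temp), (∀ l, Sc (V l)) → Sc Ψ →
      (∀ l, (V l).1 = v l t) → Ψ.1 = ψ t → normA V Ψ ≤ 1 ∧ Bd (D 2 Ψ) (1 / 10)) :
    ∃ σ : ℝ → St, (∀ t ∈ Icc 0 T, (σ t).ψ.1 = ψ t ∧ ∀ l, ((σ t).v l).1 = v l t) ∧
      (∀ l, TD T (fun t => (σ t).v l) fun t => (σ t).u l) ∧
      TD T (fun t => (σ t).ψ) fun t => (σ t).η := by
  set s : ℝ → ℝ := fun t => projIcc 0 T hT.le t with hs_def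
  have hs : ∀ t, s t ∈ Icc 0 T := fun t => (projIcc 0 T hT.le t).2
  have hst : ∀ t ∈ Icc 0 T, s t = t := fun t ht => by simp only [hs_def, projIcc_of_mem _ ht]
  set V : Fin 3 → ℝ → Temp := fun l t => ofSchwartz ((hsch _ (hs t)).2.2 l) with hV
  set Ψ : ℝ → Temp := fun t => ofSchwartz (hsch _ (hs t)).1 with hΨ
  set p' : ℝ → Temp := fun t => ofSchwartz (hsch _ (hs t)).2.1 with hp'
  have eV : ∀ t ∈ Icc 0 T, ∀ l, (V l t).1 = v l t := fun t ht l => congrArg (v l) (hst t ht)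
  have eΨ : ∀ t ∈ Icc 0 T, (Ψ t).1 = ψ t := fun t ht => congrArg ψ (hst t ht)
  have ep : ∀ t ∈ Icc 0 T, (p' t).1 = p t := fun t ht => congrArg p (hst t ht)
  have cV : ∀ l t, Sc (V l t) := fun l t => sc_ofSchwartz _
  have cΨ : ∀ t, Sc (Ψ t) := fun t => sc_ofSchwartz _
  have cp : ∀ t, Sc (p' t) := fun t => sc_ofSchwartz _
  have smV : ∀ l, SM T (V l) := fun l =>
    (hv l).congr fun q hq => congrFun (eV q.1 hq.1 l) q.2
  have smΨ : SM T Ψ := ContDiffOn.congr hψ fun q hq => congrFun (eΨ q.1 hq.1) q.2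
  have smp : SM T p' := ContDiffOn.congr hp fun q hq => congrFun (ep q.1 hq.1) q.2
  have deriv_eq : ∀ {f : ℝ → Pt → ℝ} {F : ℝ → Temp}, SmoothOn2 (Icc 0 T) f →
      (∀ t ∈ Icc 0 T, (F t).1 = f t) → ∀ t ∈ Ioo 0 T, ∀ x,
      HasDerivAt (fun τ => F τ x) (deriv (fun τ => f τ x) t) t := fun hf hF t ht x => by
    refine (SM.hasDerivAt hf ht x).congr_of_eventuallyEq ?_
    filter_upwards [Icc_mem_nhds ht.1 ht.2] with τ hτ using congrFun (hF τ hτ) x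
  have tdV : ∀ l, TD T (V l) fun t => accel (V · t) (Ψ t) l - D l (totalP (p' t) (Ψ t)) := fun l => by
    simp only [accel_sub_eq]
    refine ⟨smV l, ?_, fun t ht x => (deriv_eq (hv l) (fun t ht => eV t ht l) t ht x).congr_deriv ?_⟩
    · refine (SM.sum _ fun i _ => ((smΨ.D hT l).mul (smΨ.D hT i)).D hT i).neg.sub
        (((((SM.sum _ fun i _ => (smV i).mul ((smV l).D hT i)).sub ((smV l).Lap hT)).add
          (smp.D hT l)).add ((smΨ.D hT 2).D hT l)).add ?_)
      split_ifs
      exacts [smΨ.Lap hT, .const 0]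
    · have ht' := Ioo_subset_Icc_self ht
      have h := hS.2.1 l t ht' x
      simp only [← eV t ht', ← eΨ t ht', ← ep t ht', lapl_eq] at h
      replace h : deriv (fun τ => v l τ x) t + ∑ i, V i t x * D i (V l t) x - Lap (V l t) x
        + D l (p' t) x + D l (D 2 (Ψ t)) x + (if l = 2 then Lap (Ψ t) x else 0)
        = -∑ i, D i (D l (Ψ t) * D i (Ψ t)) x := h
      split_ifs at h ⊢ <;>
      · simp only [Temp.sub_apply, Temp.neg_apply, Temp.add_apply, Temp.sum_apply, Temp.mul_apply,
          Temp.zero_apply]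
        linear_combination h
  have tdΨ : TD T Ψ fun t => -(∑ m, V m t * D m (Ψ t) + V 2 t) := by
    refine ⟨smΨ, ((SM.sum _ fun m _ => (smV m).mul (smΨ.D hT m)).add (smV 2)).neg,
      fun t ht x => (deriv_eq hψ eΨ t ht x).congr_deriv ?_⟩
    have ht' := Ioo_subset_Icc_self ht
    have h := hS.1 t ht' x
    simp only [← eV t ht', ← eΨ t ht'] at h
    replace h : deriv (fun τ => ψ τ x) t + ∑ i, V i t x * D i (Ψ t) x + V 2 t x = 0 := h
    simp only [Temp.neg_apply, Temp.add_apply, Temp.sum_apply, Temp.mul_apply]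
    linear_combination h
  have divV : ∀ t, ∑ l, D l (V l t) = 0 := fun t => by
    ext x
    rw [Temp.sum_apply]
    exact hS.2.2 (s t) (hs t) x
  have divU : ∀ t ∈ Icc 0 T, ∑ l, D l (accel (V · t) (Ψ t) l - D l (totalP (p' t) (Ψ t))) = 0 :=
    fun t ht => TD.eq_zero hT (TD.sum Finset.univ fun l => (tdV l).D hT l) divV ht
  have small : ∀ t, normA (V · t) (Ψ t) ≤ 1 ∧ Bd (D 2 (Ψ t)) (1 / 10) := fun t =>
    hsmall (s t) (hs t) _ _ (fun l => cV l t) (cΨ t) (fun l => rfl) rfl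
  choose b hb using fun t => exists_inv _ (small t).2
  have hs2 : ∀ t, s (s t) = s t := fun t => hst _ (hs t)
  refine ⟨fun t => ⟨(V · t), Ψ t, totalP (p' t) (Ψ t), b t, fun l => cV l t, cΨ t, ?_, divV t, ?_,
    (small t).2, ?_, (small t).1⟩, fun t ht => ⟨eΨ t ht, eV t ht⟩, tdV, tdΨ⟩
  · unfold totalP; infer_instance
  · have := divU (s t) (hs t)
    simp only [hV, hΨ, hp', hs2] at this
    exact this
  · ext x
    have := (abs_le.1 ((small t).2 x)).1
    simp only [Temp.mul_apply, hb, Temp.add_apply, Temp.one_apply]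
    exact inv_mul_cancel₀ (by linarith)

end St

/-! ### The energy estimate -/

namespace St

open Temp

theorem exists_energy_estimate {κ : ℝ} (hκ : 0 < κ) : ∃ C, 0 ≤ C ∧ ∀ {T : ℝ}, 0 < T →
    ∀ {σ : ℝ → St}, (∀ l, TD T (fun t => (σ t).v l) fun t => (σ t).u l) →
    (TD T (fun t => (σ t).ψ) fun t => (σ t).η) → ∀ {H : ℝ → ℝ} {M : ℝ},
    IntervalIntegrable H volume 0 T →
    (∀ t ∈ Icc 0 T, (σ t).E ^ 2 ≤ κ * H t ∧ H t ≤ κ * (σ t).E ^ 2 ∧ (σ t).A ≤ M) →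
    ∀ b ∈ Icc 0 T, (σ b).A ^ 2 + ∫ t in (0:ℝ)..b, H t
      ≤ C * ((σ 0).A ^ 2 + M * ∫ t in (0:ℝ)..T, H t) := by
  obtain ⟨K2, hK2, h2⟩ := exists_A_sq_le
  obtain ⟨K3, hK3, h3⟩ := exists_I_en_le
  obtain ⟨c, K4, hc, hK4, h4⟩ := exists_I_prod_le
  obtain ⟨Kp, hKp, hp⟩ := C1_prod.2
  choose Kf hKf hf using fun i => (C1_flux i).2
  refine ⟨(K2 + κ / c) * (K3 + K4 * κ), by positivity, fun {T} hT {σ} hv hψ {H M} hH hE b hb => ?_⟩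
  have h0 : (0 : ℝ) ∈ Icc 0 T := ⟨le_rfl, hT.le⟩
  have hM : 0 ≤ M := ((σ 0).A_nonneg).trans (hE 0 h0).2.2
  have hH0 : ∀ t ∈ Icc 0 T, 0 ≤ H t := fun t ht =>
    nonneg_of_mul_nonneg_right ((sq_nonneg _).trans (hE t ht).1) hκ
  have hsub : ∀ t ∈ Icc 0 b, t ∈ Icc 0 T := fun t ht => ⟨ht.1, ht.2.trans hb.2⟩
  have hfl : ∀ i, Kf i ≤ ∑ i, Kf i := fun i => le_sum3 hKf i
  set K5 := Kp + ∑ i, Kf i with hK5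
  have hE1 : ∀ t ∈ Icc 0 T, 1 + (σ t).E ^ 2 ≤ 1 + κ * H t := fun t ht => by
    linarith [(hE t ht).1]
  have hK50 : 0 ≤ K5 := by
    have := (hKf 0).trans (hfl 0); positivity
  have td : TD T (fun t => (σ t).en) fun t => (σ t).prod + ∑ i, D i ((σ t).flux i) :=
    (td_en hT hv hψ).congr fun t => enDot_eq _
  have : ∀ t, Sc (σ t).prod := fun t => C1_prod.1 _
  have : ∀ i t, Sc ((σ t).flux i) := fun i t => (C1_flux i).1 _
  have hHb : IntervalIntegrable H volume 0 b := hH.mono_set <| by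
    rw [uIcc_of_le hb.1, uIcc_of_le hT.le]; exact hsub
  obtain ⟨hint, hbal⟩ := td.integral_balance (R := fun t => K5 * (1 + κ * H t))
    ((intervalIntegrable_const.add (hH.const_mul κ)).const_mul K5)
    (fun t ht => (hp _).trans <| by
      have := hE1 t ht
      have := (hKf 0).trans (hfl 0)
      gcongr; linarith)
    (fun i t ht => (hf i _).trans <| by
      have := hE1 t ht
      have := hfl i
      gcongr; linarith) hb
  have hle : ∫ t in (0:ℝ)..b, I (σ t).prod ≤ ∫ t in (0:ℝ)..b, (K4 * M * κ - c / κ) * H t := by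
    refine intervalIntegral.integral_mono_on hb.1 hint (hHb.const_mul _) fun t ht => ?_
    obtain ⟨e1, e2, e3⟩ := hE t (hsub t ht)
    have : c / κ * H t ≤ c * (σ t).E ^ 2 := by
      rw [div_mul_eq_mul_div, div_le_iff₀ hκ]
      nlinarith
    have : K4 * ((σ t).A * (σ t).E ^ 2) ≤ K4 * (M * (κ * H t)) := by
      have := (σ t).A_nonneg
      gcongr
    linarith [h4 (σ t)]
  rw [intervalIntegral.integral_const_mul, hbal] at hle
  set J := ∫ t in (0:ℝ)..b, H t with hJ
  set S := ∫ t in (0:ℝ)..T, H t with hS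
  have hJ0 : 0 ≤ J := intervalIntegral.integral_nonneg hb.1 fun t ht => hH0 t (hsub t ht)
  have hJS : J ≤ S := intervalIntegral.integral_mono_interval le_rfl hb.1 hb.2
    ((ae_restrict_iff' measurableSet_Ioc).2 <| ae_of_all _ fun t ht => hH0 t ⟨ht.1.le, ht.2⟩) hH
  have hen : 0 ≤ I (σ b).en := nonneg_of_mul_nonneg_right ((sq_nonneg _).trans (h2 _)) hK2
  set Y := K3 * (σ 0).A ^ 2 + K4 * M * κ * S with hY
  have hY1 : I (σ b).en + c / κ * J ≤ Y := by
    have : K4 * M * κ * J ≤ K4 * M * κ * S := by gcongr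
    linarith [h3 (σ 0)]
  have hcκ : 0 ≤ c / κ * J := by positivity
  have a1 : (σ b).A ^ 2 ≤ K2 * Y := (h2 _).trans (by gcongr; linarith)
  have a2 : J ≤ κ / c * Y := by
    have : J = κ / c * (c / κ * J) := by field_simp
    rw [this]; gcongr; linarith
  have a3 : Y ≤ (K3 + K4 * κ) * ((σ 0).A ^ 2 + M * S) := by
    have : 0 ≤ K3 * (M * S) := by have := hJ0.trans hJS; positivity
    have : 0 ≤ K4 * κ * (σ 0).A ^ 2 := by positivity
    linarith
  calc (σ b).A ^ 2 + J ≤ (K2 + κ / c) * Y := by linarith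
    _ ≤ (K2 + κ / c) * ((K3 + K4 * κ) * ((σ 0).A ^ 2 + M * S)) := by gcongr
    _ = _ := by ring

end St

/-! ### Comparison with the Sobolev norms -/

namespace Temp

theorem coe_iterate_D (i : Fin 3) (n : ℕ) (f : Temp) : (pd i)^[n] f.1 = ((D i)^[n] f).1 := by
  induction n generalizing f with
  | zero => rfl
  | succ n ih => rw [Function.iterate_succ_apply, Function.iterate_succ_apply, ← ih]; rfl

/-- The derivative `∂₁^a ∂₂^b ∂₃^c`. -/
def DM (a b c : ℕ) (f : Temp) : Temp := (D 0)^[a] ((D 1)^[b] ((D 2)^[c] f))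

theorem hSq_coe (k : ℕ) (f : Temp) :
    hSq k f.1 = ∑ α ∈ midx k, Q (DM (α 0) (α 1) (α 2) f) := by
  refine Finset.sum_congr rfl fun α _ => ?_
  have : pdM α f.1 = (DM (α 0) (α 1) (α 2) f).1 := by
    rw [pdM, coe_iterate_D, coe_iterate_D, coe_iterate_D]; rfl
  rw [this]; rfl

theorem hSq_nonneg (k : ℕ) (f : Temp) : 0 ≤ hSq k f.1 := by
  rw [hSq_coe]; exact Finset.sum_nonneg fun _ _ => Q_nonneg _

theorem mem_midx {k a b c : ℕ} (h : a + b + c ≤ k) : ![a, b, c] ∈ midx k := by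
  simp only [midx, Finset.mem_filter, Fintype.mem_piFinset, Finset.mem_range, Fin.sum_univ_three]
  refine ⟨fun i => ?_, by simpa using h⟩
  fin_cases i <;> simp <;> omega

theorem N_DM_le {k a b c : ℕ} (h : a + b + c ≤ k) (f : Temp) : N (DM a b c f) ≤ √(hSq k f.1) := by
  refine Real.sqrt_le_sqrt ?_
  rw [hSq_coe]
  exact Finset.single_le_sum (f := fun α : Fin 3 → ℕ => Q (DM (α 0) (α 1) (α 2) f))
    (fun _ _ => Q_nonneg _) (mem_midx h)

/-- The `H²` norm, as a sum of `L²` norms. -/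
def H2 (f : Temp) : ℝ := N f + ∑ i, (N (D i f) + ∑ j, N (D j (D i f)))

theorem N_le_sqrt_hSq (k : ℕ) (f : Temp) : N f ≤ √(hSq k f.1) :=
  N_DM_le (a := 0) (b := 0) (c := 0) (Nat.zero_le _) f

theorem N_D_le {k : ℕ} (hk : 1 ≤ k) (f : Temp) (i : Fin 3) : N (D i f) ≤ √(hSq k f.1) := by
  fin_cases i
  · exact N_DM_le (a := 1) (b := 0) (c := 0) (by omega) f
  · exact N_DM_le (a := 0) (b := 1) (c := 0) (by omega) f
  · exact N_DM_le (a := 0) (b := 0) (c := 1) (by omega) f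

theorem N_DD_le (f : Temp) (i j : Fin 3) : N (D j (D i f)) ≤ √(hSq 2 f.1) := by
  have h01 := N_DM_le (k := 2) (a := 1) (b := 1) (c := 0) (by omega) f
  have h02 := N_DM_le (k := 2) (a := 1) (b := 0) (c := 1) (by omega) f
  have h12 := N_DM_le (k := 2) (a := 0) (b := 1) (c := 1) (by omega) f
  fin_cases i <;> fin_cases j
  · exact N_DM_le (a := 2) (b := 0) (c := 0) (by omega) f
  · exact (congrArg N (D_comm 1 0 f)).trans_le h01
  · exact (congrArg N (D_comm 2 0 f)).trans_le h02
  · exact h01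
  · exact N_DM_le (a := 0) (b := 2) (c := 0) (by omega) f
  · exact (congrArg N (D_comm 2 1 f)).trans_le h12
  · exact h02
  · exact h12
  · exact N_DM_le (a := 0) (b := 0) (c := 2) (by omega) f

theorem H2_le (f : Temp) : H2 f ≤ 13 * √(hSq 2 f.1) := by
  have : ∑ i, (N (D i f) + ∑ j, N (D j (D i f))) ≤ 3 * (√(hSq 2 f.1) + 3 * √(hSq 2 f.1)) :=
    St.sum_le_card_mul fun i => add_le_add (N_D_le (by omega) f i) <|
      St.sum_le_card_mul (N_DD_le f i)
  unfold H2
  linarith [N_le_sqrt_hSq 2 f]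

theorem H1_le (f : Temp) : H1 f ≤ 4 * √(hSq 1 f.1) := by
  have : ∑ i, N (D i f) ≤ 3 * √(hSq 1 f.1) := St.sum_le_card_mul (N_D_le le_rfl f)
  unfold H1 G
  linarith [N_le_sqrt_hSq 1 f]

theorem N_le_H2 (f : Temp) : N f ≤ H2 f :=
  le_add_of_nonneg_right <| Finset.sum_nonneg fun _ _ => add_nonneg (N_nonneg _) <|
    Finset.sum_nonneg fun _ _ => N_nonneg _

theorem N_DD_le_H2 (f : Temp) (i j : Fin 3) : N (D j (D i f)) ≤ H2 f := by
  refine le_trans ?_ (le_add_of_nonneg_left (N_nonneg f))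
  refine le_trans ?_ (St.le_sum3 (f := fun i => N (D i f) + ∑ j, N (D j (D i f)))
    (fun i => add_nonneg (N_nonneg _) (Finset.sum_nonneg fun _ _ => N_nonneg _)) i)
  exact (St.le_sum3 (f := fun j => N (D j (D i f))) (fun _ => N_nonneg _) j).trans
    (le_add_of_nonneg_left (N_nonneg _))

theorem N_D_le_H2 (f : Temp) (i : Fin 3) : N (D i f) ≤ H2 f := by
  refine le_trans ?_ (le_add_of_nonneg_left (N_nonneg f))
  refine le_trans ?_ (St.le_sum3 (f := fun i => N (D i f) + ∑ j, N (D j (D i f)))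
    (fun i => add_nonneg (N_nonneg _) (Finset.sum_nonneg fun _ _ => N_nonneg _)) i)
  exact le_add_of_nonneg_right (Finset.sum_nonneg fun _ _ => N_nonneg _)

theorem N_DM_le_H2 {a b c : ℕ} (h : a + b + c ≤ 2) (f : Temp) : N (DM a b c f) ≤ H2 f := by
  have ha : a ≤ 2 := by omega
  have hb : b ≤ 2 := by omega
  have hc : c ≤ 2 := by omega
  interval_cases a <;> interval_cases b <;> interval_cases c <;>
    first
    | omega
    | exact N_le_H2 f
    | exact N_D_le_H2 f _
    | exact N_DD_le_H2 f _ _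

theorem N_DM_le_H1 {a b c : ℕ} (h : a + b + c ≤ 1) (f : Temp) : N (DM a b c f) ≤ H1 f := by
  have hD : ∀ i, N (D i f) ≤ H1 f := fun i =>
    (St.le_sum3 (f := fun i => N (D i f)) (fun _ => N_nonneg _) i).trans
      (le_add_of_nonneg_left (N_nonneg f))
  have ha : a ≤ 1 := by omega
  have hb : b ≤ 1 := by omega
  have hc : c ≤ 1 := by omega
  interval_cases a <;> interval_cases b <;> interval_cases c <;>
    first
    | omega
    | exact le_add_of_nonneg_right (Finset.sum_nonneg fun _ _ => N_nonneg _)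
    | exact hD _

theorem hSq_le_card_mul {k : ℕ} {f : Temp} {X : ℝ}
    (h : ∀ {a b c : ℕ}, a + b + c ≤ k → N (DM a b c f) ≤ X) :
    hSq k f.1 ≤ (midx k).card * X ^ 2 := by
  rw [hSq_coe, ← nsmul_eq_mul]
  refine Finset.sum_le_card_nsmul _ _ _ fun α hα => ?_
  rw [← N_sq]
  refine pow_le_pow_left₀ (N_nonneg _) (h ?_) 2
  simpa [Fin.sum_univ_three] using (Finset.mem_filter.1 hα).2

theorem hSq_two_le (f : Temp) : hSq 2 f.1 ≤ (midx 2).card * H2 f ^ 2 :=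
  hSq_le_card_mul fun h => N_DM_le_H2 h f

theorem hSq_one_le (f : Temp) : hSq 1 f.1 ≤ (midx 1).card * H1 f ^ 2 :=
  hSq_le_card_mul fun h => N_DM_le_H1 h f

theorem H2_nonneg (f : Temp) : 0 ≤ H2 f := (N_nonneg f).trans (N_le_H2 f)

theorem normA_eq (v : Fin 3 → Temp) (ψ : Temp) :
    normA v ψ = ∑ l, H2 (v l) + ∑ i, H2 (D i ψ) := rfl

theorem normE_eq (v : Fin 3 → Temp) (ψ : Temp) :
    normE v ψ = ∑ l, ∑ i, H2 (D i (v l)) + ∑ i ∈ hIdx, ∑ j, H1 (D j (D i ψ)) := rfl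

theorem exists_normA_sq_equiv : ∃ K, 0 < K ∧ ∀ (v : Fin 3 → Temp) (ψ : Temp),
    normA v ψ ^ 2 ≤ K * (vecHSq 2 (fun l => (v l).1) + gradHSq 2 ψ.1) ∧
    vecHSq 2 (fun l => (v l).1) + gradHSq 2 ψ.1 ≤ K * normA v ψ ^ 2 := by
  set m : ℝ := ((midx 2).card : ℝ)
  refine ⟨78 ^ 2 + 6 * m, by positivity, fun v ψ => ?_⟩
  set X := vecHSq 2 (fun l => (v l).1) + gradHSq 2 ψ.1 with hX
  have n1 : 0 ≤ vecHSq 2 (fun l => (v l).1) := Finset.sum_nonneg fun l _ => hSq_nonneg 2 (v l)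
  have n2 : 0 ≤ gradHSq 2 ψ.1 := Finset.sum_nonneg fun i _ => hSq_nonneg 2 (D i ψ)
  have s1 : ∀ l, hSq 2 (v l).1 ≤ X := fun l =>
    (St.le_sum3 (f := fun l => hSq 2 (v l).1) (fun l => hSq_nonneg 2 (v l)) l).trans
      (le_add_of_nonneg_right n2)
  have s2 : ∀ i, hSq 2 (D i ψ).1 ≤ X := fun i =>
    (St.le_sum3 (f := fun i => hSq 2 (D i ψ).1) (fun i => hSq_nonneg 2 (D i ψ)) i).trans
      (le_add_of_nonneg_left n1)
  have a0 : 0 ≤ normA v ψ := by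
    rw [normA_eq]
    exact add_nonneg (Finset.sum_nonneg fun _ _ => H2_nonneg _)
      (Finset.sum_nonneg fun _ _ => H2_nonneg _)
  have t1 : ∀ l, H2 (v l) ≤ normA v ψ := fun l =>
    (St.le_sum3 (f := fun l => H2 (v l)) (fun _ => H2_nonneg _) l).trans
      (le_add_of_nonneg_right (Finset.sum_nonneg fun _ _ => H2_nonneg _))
  have t2 : ∀ i, H2 (D i ψ) ≤ normA v ψ := fun i =>
    (St.le_sum3 (f := fun i => H2 (D i ψ)) (fun _ => H2_nonneg _) i).trans
      (le_add_of_nonneg_left (Finset.sum_nonneg fun _ _ => H2_nonneg _))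
  constructor
  · have h : normA v ψ ≤ 78 * √X := by
      rw [normA_eq]
      have b1 : ∑ l, H2 (v l) ≤ 3 * (13 * √X) := St.sum_le_card_mul fun l =>
        (H2_le _).trans (by gcongr; exact s1 l)
      have b2 : ∑ i, H2 (D i ψ) ≤ 3 * (13 * √X) := St.sum_le_card_mul fun i =>
        (H2_le _).trans (by gcongr; exact s2 i)
      linarith
    have : 0 ≤ 6 * m * X := by positivity
    have := pow_le_pow_left₀ a0 h 2
    rw [mul_pow, Real.sq_sqrt (by positivity)] at this
    linarith
  · have b1 : vecHSq 2 (fun l => (v l).1) ≤ 3 * (m * normA v ψ ^ 2) :=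
      St.sum_le_card_mul fun l => (hSq_two_le (v l)).trans
        (by gcongr; exacts [H2_nonneg _, t1 l])
    have b2 : gradHSq 2 ψ.1 ≤ 3 * (m * normA v ψ ^ 2) :=
      St.sum_le_card_mul fun i => (hSq_two_le (D i ψ)).trans
        (by gcongr; exacts [H2_nonneg _, t2 i])
    linarith [sq_nonneg (normA v ψ)]

theorem exists_normE_sq_equiv : ∃ K, 0 < K ∧ ∀ (v : Fin 3 → Temp) (ψ : Temp),
    normE v ψ ^ 2 ≤ K * (gradVecHSq 2 (fun l => (v l).1) + gradHHSq 1 ψ.1) ∧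
    gradVecHSq 2 (fun l => (v l).1) + gradHHSq 1 ψ.1 ≤ K * normE v ψ ^ 2 := by
  set m : ℝ := ((midx 2).card : ℝ)
  set m' : ℝ := ((midx 1).card : ℝ)
  refine ⟨141 ^ 2 + 9 * m + 6 * m', by positivity, fun v ψ => ?_⟩
  have hsum : ∀ {f : Fin 3 → ℝ} {c : ℝ}, (∀ i ∈ hIdx, f i ≤ c) → ∑ i ∈ hIdx, f i ≤ 2 * c :=
    fun {f c} h => (Finset.sum_le_card_nsmul _ _ _ h).trans_eq (by
      rw [show hIdx.card = 2 from rfl, nsmul_eq_mul]; rfl)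
  have eψ : gradHHSq 1 ψ.1 = ∑ i ∈ hIdx, ∑ j, hSq 1 (D j (D i ψ)).1 :=
    Finset.sum_congr rfl fun i _ => Finset.sum_congr rfl fun j _ => by rw [D_comm j i]; rfl
  have ev : gradVecHSq 2 (fun l => (v l).1) = ∑ l, ∑ i, hSq 2 (D i (v l)).1 := rfl
  have n0 : ∀ i, 0 ≤ ∑ j, hSq 1 (D j (D i ψ)).1 := fun i =>
    Finset.sum_nonneg fun j _ => hSq_nonneg 1 _
  have n1 : 0 ≤ gradVecHSq 2 (fun l => (v l).1) :=
    Finset.sum_nonneg fun l _ => Finset.sum_nonneg fun i _ => hSq_nonneg 2 (D i (v l))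
  have n2 : 0 ≤ gradHHSq 1 ψ.1 := by rw [eψ]; exact Finset.sum_nonneg fun i _ => n0 i
  set X := gradVecHSq 2 (fun l => (v l).1) + gradHHSq 1 ψ.1 with hX
  have s1 : ∀ l i, hSq 2 (D i (v l)).1 ≤ X := fun l i =>
    (St.le_sum33 (f := fun l i => hSq 2 (D i (v l)).1) (fun _ _ => hSq_nonneg 2 _) l i).trans
      (le_add_of_nonneg_right n2)
  have s2 : ∀ i ∈ hIdx, ∀ j, hSq 1 (D j (D i ψ)).1 ≤ X := fun i hi j => by
    refine (St.le_sum3 (f := fun j => hSq 1 (D j (D i ψ)).1) (fun _ => hSq_nonneg 1 _) j).trans ?_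
    refine le_trans ?_ (le_add_of_nonneg_left n1)
    rw [eψ]
    exact Finset.single_le_sum (f := fun i => ∑ j, hSq 1 (D j (D i ψ)).1) (fun i _ => n0 i) hi
  have m1 : 0 ≤ ∑ l, ∑ i, H2 (D i (v l)) :=
    Finset.sum_nonneg fun _ _ => Finset.sum_nonneg fun _ _ => H2_nonneg _
  have m0 : ∀ i, 0 ≤ ∑ j, H1 (D j (D i ψ)) := fun i => Finset.sum_nonneg fun _ _ => H1_nonneg _
  have m2 : 0 ≤ ∑ i ∈ hIdx, ∑ j, H1 (D j (D i ψ)) := Finset.sum_nonneg fun i _ => m0 i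
  have a0 : 0 ≤ normE v ψ := by rw [normE_eq]; exact add_nonneg m1 m2
  have t1 : ∀ l i, H2 (D i (v l)) ≤ normE v ψ := fun l i =>
    (St.le_sum33 (f := fun l i => H2 (D i (v l))) (fun _ _ => H2_nonneg _) l i).trans
      (le_add_of_nonneg_right m2)
  have t2 : ∀ i ∈ hIdx, ∀ j, H1 (D j (D i ψ)) ≤ normE v ψ := fun i hi j => by
    refine (St.le_sum3 (f := fun j => H1 (D j (D i ψ))) (fun _ => H1_nonneg _) j).trans ?_
    refine le_trans ?_ (le_add_of_nonneg_left m1)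
    exact Finset.single_le_sum (f := fun i => ∑ j, H1 (D j (D i ψ))) (fun i _ => m0 i) hi
  constructor
  · have h : normE v ψ ≤ 141 * √X := by
      rw [normE_eq]
      have b1 : ∑ l, ∑ i, H2 (D i (v l)) ≤ 3 * (3 * (13 * √X)) := St.sum_le_card_mul fun l =>
        St.sum_le_card_mul fun i => (H2_le _).trans (by gcongr; exact s1 l i)
      have b2 : ∑ i ∈ hIdx, ∑ j, H1 (D j (D i ψ)) ≤ 2 * (3 * (4 * √X)) := hsum fun i hi =>
        St.sum_le_card_mul fun j => (H1_le _).trans (by gcongr; exact s2 i hi j)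
      linarith
    have hX0 : 0 ≤ X := add_nonneg n1 n2
    have : 0 ≤ (9 * m + 6 * m') * X := mul_nonneg (by positivity) hX0
    have := pow_le_pow_left₀ a0 h 2
    rw [mul_pow, Real.sq_sqrt hX0] at this
    linarith
  · have b1 : gradVecHSq 2 (fun l => (v l).1) ≤ 3 * (3 * (m * normE v ψ ^ 2)) := by
      rw [ev]
      exact St.sum_le_card_mul fun l => St.sum_le_card_mul fun i =>
        (hSq_two_le (D i (v l))).trans (by gcongr; exacts [H2_nonneg _, t1 l i])
    have b2 : gradHHSq 1 ψ.1 ≤ 2 * (3 * (m' * normE v ψ ^ 2)) := by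
      rw [eψ]
      exact hsum fun i hi => St.sum_le_card_mul fun j => (hSq_one_le (D j (D i ψ))).trans
        (by gcongr; exacts [H1_nonneg _, t2 i hi j])
    linarith [sq_nonneg (normE v ψ)]

theorem G2_D_le_normA (v : Fin 3 → Temp) (ψ : Temp) (i : Fin 3) : G2 (D i ψ) ≤ normA v ψ := by
  have h : G2 (D i ψ) ≤ H2 (D i ψ) := by
    unfold G2 H2 G
    rw [Finset.sum_add_distrib]
    exact le_add_of_nonneg_left (N_nonneg _)
  refine h.trans ?_
  rw [normA_eq]
  exact (St.le_sum3 (f := fun i => H2 (D i ψ)) (fun _ => H2_nonneg _) i).trans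
    (le_add_of_nonneg_left (Finset.sum_nonneg fun _ _ => H2_nonneg _))

end Temp

/-! ### Norms in time -/

section TimeNorms

variable {T : ℝ} {f : ℝ → ℝ}

theorem sq_supT_sqrt_le (hT : 0 ≤ T) {X : ℝ} (hX : 0 ≤ X) (h : ∀ t ∈ Icc 0 T, f t ≤ X) :
    (supT T fun t => √(f t)) ^ 2 ≤ X := by
  have h0 : 0 ≤ supT T fun t => √(f t) :=
    Real.sSup_nonneg (by rintro _ ⟨t, -, rfl⟩; exact Real.sqrt_nonneg _)
  have h1 : (supT T fun t => √(f t)) ≤ √X := by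
    refine csSup_le ((nonempty_Icc.2 hT).image _) ?_
    rintro _ ⟨t, ht, rfl⟩
    exact Real.sqrt_le_sqrt (h t ht)
  exact (pow_le_pow_left₀ h0 h1 2).trans_eq (Real.sq_sqrt hX)

theorem le_sq_supT_sqrt (hb : BddAbove ((fun t => √(f t)) '' Icc 0 T)) {t : ℝ}
    (ht : t ∈ Icc 0 T) (h0 : 0 ≤ f t) : f t ≤ (supT T fun t => √(f t)) ^ 2 := by
  rw [← Real.sq_sqrt h0]
  exact pow_le_pow_left₀ (Real.sqrt_nonneg _) (le_csSup hb ⟨t, ht, rfl⟩) 2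

theorem sq_l2T_sqrt (hT : 0 ≤ T) (h0 : ∀ t ∈ Icc 0 T, 0 ≤ f t) :
    (l2T T fun t => √(f t)) ^ 2 = ∫ t in (0:ℝ)..T, f t := by
  rw [l2T, Real.sq_sqrt (intervalIntegral.integral_nonneg hT fun t _ => sq_nonneg _)]
  refine intervalIntegral.integral_congr fun t ht => ?_
  rw [uIcc_of_le hT] at ht
  exact Real.sq_sqrt (h0 t ht)

theorem BT_sq (ψ : ℝ → Pt → ℝ) (v : Fin 3 → ℝ → Pt → ℝ) : BT T ψ v ^ 2 = BTsq T ψ v :=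
  Real.sq_sqrt (by unfold BTsq; positivity)

end TimeNorms

open Temp in
/-- The estimate under the smallness assumption `B_T ≤ c`. -/
theorem exists_BTsq_le_of_small : ∃ c C : ℝ, 0 < c ∧ 0 ≤ C ∧ ∀ T : ℝ, 0 < T →
    ∀ (ψ p : ℝ → Pt → ℝ) (v : Fin 3 → ℝ → Pt → ℝ),
      SmoothOn2 (Icc 0 T) ψ → SmoothOn2 (Icc 0 T) p → (∀ j, SmoothOn2 (Icc 0 T) (v j)) →
      (∀ t ∈ Icc (0:ℝ) T, IsSchwartz (ψ t) ∧ IsSchwartz (p t) ∧ ∀ j, IsSchwartz (v j t)) →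
      SolvesS (Icc 0 T) ψ v p → FiniteClass T ψ v → BT T ψ v ≤ c →
      BTsq T ψ v ≤ C * (vecHSq 2 (fun j => v j 0) + gradHSq 2 (ψ 0)) + C * BT T ψ v ^ 3 := by
  obtain ⟨K, hK, hA⟩ := exists_normA_sq_equiv
  obtain ⟨κ, hκ, hE⟩ := exists_normE_sq_equiv
  obtain ⟨Ks, hKs, hs⟩ := exists_sup_bound
  obtain ⟨Ce, hCe, he⟩ := St.exists_energy_estimate hκ
  refine ⟨1 / (10 * (Ks + 1) * (√K + 1)), (2 * K + 1) * Ce * (K + √K), by positivity,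
    by positivity, fun T hT ψ p v hψ hp hv hsch hS hfin hB => ?_⟩
  set B := BT T ψ v with hBdef
  have hB0 : 0 ≤ B := Real.sqrt_nonneg _
  have hB2 : B ^ 2 = BTsq T ψ v := BT_sq ψ v
  have hlift : ∀ t ∈ Icc 0 T, ∃ (V : Fin 3 → Temp) (Ψ : Temp), (∀ l, (V l).1 = v l t) ∧
      Ψ.1 = ψ t := fun t ht =>
    ⟨fun l => ofSchwartz ((hsch t ht).2.2 l), ofSchwartz (hsch t ht).1, fun _ => rfl, rfl⟩
  have hvec : ∀ t ∈ Icc 0 T, 0 ≤ vecHSq 2 fun j => v j t := fun t ht => by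
    obtain ⟨V, Ψ, hV, -⟩ := hlift t ht
    simp only [← hV]
    exact Finset.sum_nonneg fun l _ => hSq_nonneg 2 (V l)
  have hgrad : ∀ t ∈ Icc 0 T, 0 ≤ gradHSq 2 (ψ t) := fun t ht => by
    obtain ⟨V, Ψ, -, hΨ⟩ := hlift t ht
    rw [← hΨ]
    exact Finset.sum_nonneg fun i _ => hSq_nonneg 2 (D i Ψ)
  have hgV : ∀ t ∈ Icc 0 T, 0 ≤ gradVecHSq 2 fun j => v j t := fun t ht => by
    obtain ⟨V, Ψ, hV, -⟩ := hlift t ht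
    simp only [← hV]
    exact Finset.sum_nonneg fun l _ => Finset.sum_nonneg fun i _ => hSq_nonneg 2 (D i (V l))
  have hgH : ∀ t ∈ Icc 0 T, 0 ≤ gradHHSq 1 (ψ t) := fun t ht => by
    obtain ⟨V, Ψ, -, hΨ⟩ := hlift t ht
    rw [← hΨ]
    exact Finset.sum_nonneg fun i _ => Finset.sum_nonneg fun j _ => hSq_nonneg 1 (D i (D j Ψ))
  have hsplit : BTsq T ψ v = (supT T fun t => √(vecHSq 2 fun j => v j t)) ^ 2
      + (supT T fun t => √(gradHSq 2 (ψ t))) ^ 2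
      + ∫ t in (0:ℝ)..T, ((gradVecHSq 2 fun j => v j t) + gradHHSq 1 (ψ t)) := by
    rw [intervalIntegral.integral_add hfin.2.2.1 hfin.2.2.2, ← sq_l2T_sqrt hT.le hgV,
      ← sq_l2T_sqrt hT.le hgH, BTsq]
    ring
  set H : ℝ → ℝ := fun t => (gradVecHSq 2 fun j => v j t) + gradHHSq 1 (ψ t)
  set S := ∫ t in (0:ℝ)..T, H t
  have hS0 : 0 ≤ S := intervalIntegral.integral_nonneg hT.le fun t ht =>
    add_nonneg (hgV t ht) (hgH t ht)
  have hSB : S ≤ B ^ 2 := by rw [hB2, hsplit]; exact le_add_of_nonneg_left (by positivity)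
  have haB : ∀ t ∈ Icc 0 T, (vecHSq 2 fun j => v j t) + gradHSq 2 (ψ t) ≤ B ^ 2 := fun t ht => by
    linarith [le_sq_supT_sqrt hfin.1 ht (hvec t ht), le_sq_supT_sqrt hfin.2.1 ht (hgrad t ht)]
  have hnA : ∀ (V : Fin 3 → Temp) (Ψ : Temp), ∀ t ∈ Icc 0 T, (∀ l, (V l).1 = v l t) →
      Ψ.1 = ψ t → normA V Ψ ≤ √K * B := fun V Ψ t ht hV hΨ => by
    refine le_of_sq_le_sq ?_ (by positivity)
    rw [mul_pow, Real.sq_sqrt hK.le]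
    refine (hA V Ψ).1.trans ?_
    simp only [hV, hΨ]
    gcongr
    exact haB t ht
  have hB' : (10 * (Ks + 1) * (√K + 1)) * B ≤ 1 := by
    rw [le_div_iff₀ (by positivity)] at hB; linarith
  have hq := Real.sqrt_nonneg K
  have hp1 : 0 ≤ Ks * √K * B := by positivity
  have hp2 : 0 ≤ √K * B := by positivity
  have hp3 : 0 ≤ Ks * B := by positivity
  have hsmall : ∀ t ∈ Icc 0 T, ∀ (V : Fin 3 → Temp) (Ψ : Temp), (∀ l, Sc (V l)) → Sc Ψ →
      (∀ l, (V l).1 = v l t) → Ψ.1 = ψ t → normA V Ψ ≤ 1 ∧ Bd (D 2 Ψ) (1 / 10) :=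
    fun t ht V Ψ _ _ hV hΨ => by
    have h := hnA V Ψ t ht hV hΨ
    refine ⟨by linarith, fun x => (hs (D 2 Ψ) inferInstance x).trans ?_⟩
    have : Ks * G2 (D 2 Ψ) ≤ Ks * (√K * B) := by
      gcongr; exact (G2_D_le_normA V Ψ 2).trans h
    linarith
  obtain ⟨σ, hσ, tv, tψ⟩ := St.exists_trajectory hT hψ hp hv hsch hS hsmall
  have hA' : ∀ t ∈ Icc 0 T,
      (σ t).A ^ 2 ≤ K * ((vecHSq 2 fun j => v j t) + gradHSq 2 (ψ t)) ∧
      (vecHSq 2 fun j => v j t) + gradHSq 2 (ψ t) ≤ K * (σ t).A ^ 2 := fun t ht => by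
    have := hA (σ t).v (σ t).ψ
    simp only [(hσ t ht).1, (hσ t ht).2] at this
    exact this
  have h0 : (0 : ℝ) ∈ Icc 0 T := ⟨le_rfl, hT.le⟩
  have hest := he hT tv tψ (H := H) (M := √K * B) (hfin.2.2.1.add hfin.2.2.2) fun t ht => by
    have := hE (σ t).v (σ t).ψ
    simp only [(hσ t ht).1, (hσ t ht).2] at this
    exact ⟨this.1, this.2, hnA _ _ t ht (hσ t ht).2 (hσ t ht).1⟩
  set a0 := vecHSq 2 (fun j => v j 0) + gradHSq 2 (ψ 0) with ha0
  have ha0' : 0 ≤ a0 := add_nonneg (hvec 0 h0) (hgrad 0 h0)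
  set Y := Ce * ((σ 0).A ^ 2 + √K * B * S) with hY
  have hY0 : 0 ≤ Y := by positivity
  have hYle : Y ≤ Ce * ((K + √K) * (a0 + B ^ 3)) := by
    have e1 := (hA' 0 h0).1
    have e2 : √K * B * S ≤ √K * B * B ^ 2 := by gcongr
    have e3 : 0 ≤ √K * a0 := by positivity
    have e4 : 0 ≤ K * B ^ 3 := by positivity
    rw [hY]
    gcongr
    linarith
  have hX : ∀ t ∈ Icc 0 T, (vecHSq 2 fun j => v j t) + gradHSq 2 (ψ t) ≤ K * Y := fun t ht => by
    refine (hA' t ht).2.trans ?_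
    gcongr
    have : 0 ≤ ∫ s in (0:ℝ)..t, H s := intervalIntegral.integral_nonneg ht.1 fun s hs =>
      add_nonneg (hgV s ⟨hs.1, hs.2.trans ht.2⟩) (hgH s ⟨hs.1, hs.2.trans ht.2⟩)
    linarith [hest t ht]
  have hKY : 0 ≤ K * Y := by positivity
  have b1 := sq_supT_sqrt_le hT.le hKY fun t ht =>
    (le_add_of_nonneg_right (hgrad t ht)).trans (hX t ht)
  have b2 := sq_supT_sqrt_le hT.le hKY fun t ht =>
    (le_add_of_nonneg_left (hvec t ht)).trans (hX t ht)
  have b3 : S ≤ Y := by linarith [hest T ⟨hT.le, le_rfl⟩, sq_nonneg (σ T).A]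
  calc BTsq T ψ v ≤ (2 * K + 1) * Y := by rw [hsplit]; linarith
    _ ≤ (2 * K + 1) * (Ce * ((K + √K) * (a0 + B ^ 3))) := by gcongr
    _ = _ := by ring

/-- Lemma 2.3: the key a priori estimate `B_T² ≤ C B_0² + C B_T³ (1+B_T)²`. -/
theorem stmt_8 :
    ∃ C : ℝ, 0 < C ∧ ∀ T : ℝ, 0 < T → ∀ (ψ p : ℝ → Pt → ℝ) (v : Fin 3 → ℝ → Pt → ℝ),
      SmoothOn2 (Icc 0 T) ψ → SmoothOn2 (Icc 0 T) p → (∀ j, SmoothOn2 (Icc 0 T) (v j)) →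
      (∀ t ∈ Icc (0:ℝ) T, IsSchwartz (ψ t) ∧ IsSchwartz (p t) ∧ ∀ j, IsSchwartz (v j t)) →
      SolvesS (Icc 0 T) ψ v p → FiniteClass T ψ v →
      BTsq T ψ v ≤ C * (vecHSq 2 (fun j => v j 0) + gradHSq 2 (ψ 0))
        + C * BT T ψ v ^ 3 * (1 + BT T ψ v) ^ 2 := by
  obtain ⟨c, C, hc, hC, h⟩ := exists_BTsq_le_of_small
  refine ⟨C + 1 / c, by positivity, fun T hT ψ p v hψ hp hv hsch hS hfin => ?_⟩
  set B := BT T ψ v with hBdef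
  have hB0 : 0 ≤ B := Real.sqrt_nonneg _
  have hB2 : B ^ 2 = BTsq T ψ v := BT_sq ψ v
  have h0 : (0 : ℝ) ∈ Icc 0 T := ⟨le_rfl, hT.le⟩
  have ha0 : 0 ≤ vecHSq 2 (fun j => v j 0) + gradHSq 2 (ψ 0) :=
    add_nonneg
      (Finset.sum_nonneg fun j _ => Temp.hSq_nonneg 2 (Temp.ofSchwartz ((hsch 0 h0).2.2 j)))
      (Finset.sum_nonneg fun i _ => Temp.hSq_nonneg 2 (Temp.D i (Temp.ofSchwartz (hsch 0 h0).1)))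
  have hgrow : B ^ 3 ≤ B ^ 3 * (1 + B) ^ 2 :=
    le_mul_of_one_le_right (by positivity) (one_le_pow₀ (by linarith))
  have hx : 0 ≤ C * (B ^ 3 * (1 + B) ^ 2) := by positivity
  have hx' : 0 ≤ C * (vecHSq 2 (fun j => v j 0) + gradHSq 2 (ψ 0)) := by positivity
  have hy : 0 ≤ 1 / c * (B ^ 3 * (1 + B) ^ 2) := by positivity
  have hy' : 0 ≤ 1 / c * (vecHSq 2 (fun j => v j 0) + gradHSq 2 (ψ 0)) := by positivity
  rcases le_total B c with hsm | hlg
  · have := h T hT ψ p v hψ hp hv hsch hS hfin hsm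
    have : C * B ^ 3 ≤ C * (B ^ 3 * (1 + B) ^ 2) := by gcongr
    linarith
  · have : B ^ 2 ≤ 1 / c * B ^ 3 := by
      rw [one_div_mul_eq_div, le_div_iff₀ hc, pow_succ B 2]
      gcongr
    have : 1 / c * B ^ 3 ≤ 1 / c * (B ^ 3 * (1 + B) ^ 2) := by gcongr
    linarith

end
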